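/- arXiv:2204.12029 — 3 statements merged into one kernel-verified Lean document; each statement's English description precedes it below -/
import Mathlib

section
/- Let d ≥ 2, s ∈ (0,1), μ > 0, 2μ + λ > 0, and let u, v : ℝ^d → ℝ^d be Schwartz vector fields. Let M^s(ξ) := μ^s (2π|ξ|)^{2s} I + ((2μ+λ)^s − μ^s)(2π|ξ|)^{2s} (ξ⊗ξ)/|ξ|² for ξ ≠ 0. Then ∫_{ℝ^d} ⟨M^s(ξ) û(ξ), v̂(ξ)⟩ dξ = ∫_{ℝ^d} ⟨𝕃^s u(x), v(x)⟩ dx, where the left-hand inner product is the Hermitian inner product on ℂ^d (both sides are real), û and v̂ are the componentwise Fourier transforms, and 𝕃^s u is the fractional Lamé–Navier operator in its second-order-difference form. -/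
open Real MeasureTheory Filter
open scoped RealInnerProductSpace FourierTransform

noncomputable section

/-- `c_{d,s} = 2^{2s} s Γ(d/2+s)/(π^{d/2} Γ(1−s))`. -/
def cConst (d : ℕ) (s : ℝ) : ℝ :=
  (2 : ℝ) ^ (2 * s) * s * Real.Gamma ((d : ℝ) / 2 + s) /
    (π ^ ((d : ℝ) / 2) * Real.Gamma (1 - s))

/-- `κ_{d,s} = (d+2s) c_{d,s}`. -/
def kappaConst (d : ℕ) (s : ℝ) : ℝ := ((d : ℝ) + 2 * s) * cConst d s

/-- The fractional Lamé–Navier operator `𝕃^s u` in second-order-difference form. -/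
def lameFrac (d : ℕ) (s μ lam : ℝ)
    (u : SchwartzMap (EuclideanSpace ℝ (Fin d)) (EuclideanSpace ℝ (Fin d)))
    (x : EuclideanSpace ℝ (Fin d)) : EuclideanSpace ℝ (Fin d) :=
  (((2 * s + 1) * μ ^ s - (2 * μ + lam) ^ s) / (2 * s) * (cConst d s / 2)) •
      (∫ h : EuclideanSpace ℝ (Fin d),
        (‖h‖ ^ ((d : ℝ) + 2 * s))⁻¹ • ((2 : ℝ) • u x - u (x + h) - u (x - h))) +
    (((2 * μ + lam) ^ s - μ ^ s) / (2 * s) * (kappaConst d s / 2)) •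
      (∫ h : EuclideanSpace ℝ (Fin d),
        (⟪h, (2 : ℝ) • u x - u (x + h) - u (x - h)⟫ /
          (‖h‖ ^ 2 * ‖h‖ ^ ((d : ℝ) + 2 * s))) • h)

/-- The entries of the fractional multiplier matrix `M^s(ξ)`. -/
def lameSymbolPowEntry (d : ℕ) (s μ lam : ℝ) (ξ : EuclideanSpace ℝ (Fin d))
    (i j : Fin d) : ℝ :=
  μ ^ s * (2 * π * ‖ξ‖) ^ (2 * s) * (if i = j then 1 else 0) +
    ((2 * μ + lam) ^ s - μ ^ s) * (2 * π * ‖ξ‖) ^ (2 * s) * (ξ i * ξ j / ‖ξ‖ ^ 2)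

section Kernel

variable {V : Type*} [NormedAddCommGroup V] [InnerProductSpace ℝ V] [FiniteDimensional ℝ V]
  [MeasurableSpace V] [BorelSpace V]

lemma integrable_min_one_sq_mul_norm_rpow [Nontrivial V] {s : ℝ} (hs : s ∈ Set.Ioo (0 : ℝ) 1) :
    Integrable (fun h : V ↦ min 1 (‖h‖ ^ 2) * (‖h‖ ^ ((Module.finrank ℝ V : ℝ) + 2 * s))⁻¹) := by
  rw [integrable_fun_norm_addHaar volume
    (f := fun r : ℝ ↦ min 1 (r ^ 2) * (r ^ ((Module.finrank ℝ V : ℝ) + 2 * s))⁻¹)]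
  have hd : 1 ≤ Module.finrank ℝ V := Module.finrank_pos
  have key : ∀ r : ℝ, 0 < r → r ^ (Module.finrank ℝ V - 1) *
      (r ^ ((Module.finrank ℝ V : ℝ) + 2 * s))⁻¹ = r ^ (-1 - 2 * s) := by
    intro r hr
    rw [← rpow_natCast, ← rpow_neg hr.le, ← rpow_add hr]
    congr 1
    push_cast [hd]
    ring
  rw [← Set.Ioc_union_Ioi_eq_Ioi zero_le_one, integrableOn_union]
  constructor
  · have h1 : IntegrableOn (fun r : ℝ ↦ r ^ (1 - 2 * s)) (Set.Ioc 0 1) :=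
      (intervalIntegrable_iff_integrableOn_Ioc_of_le zero_le_one).1
        (intervalIntegral.intervalIntegrable_rpow' (by linarith [hs.2]))
    refine h1.congr_fun (fun r hr ↦ ?_) measurableSet_Ioc
    have hr0 : 0 < r := hr.1
    have : min 1 (r ^ 2) = r ^ 2 := min_eq_right (by nlinarith [hr.2])
    simp only [smul_eq_mul, this]
    rw [mul_left_comm, key r hr0, ← rpow_natCast, ← rpow_add hr0]
    congr 1
    push_cast
    ring
  · have h1 : IntegrableOn (fun r : ℝ ↦ r ^ (-1 - 2 * s)) (Set.Ioi 1) :=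
      integrableOn_Ioi_rpow_of_lt (by linarith [hs.1]) one_pos
    refine h1.congr_fun (fun r hr ↦ ?_) measurableSet_Ioi
    have hr1 : 1 < r := hr
    have : min 1 (r ^ 2) = 1 := min_eq_left (by nlinarith)
    simp only [smul_eq_mul, this, one_mul]
    rw [key r (by linarith)]

lemma integrable_norm_pow_mul_exp_neg_mul_sq [Nontrivial V] {t : ℝ} (ht : 0 < t) (k : ℕ) :
    Integrable (fun h : V ↦ ‖h‖ ^ k * rexp (-t * ‖h‖ ^ 2)) := by
  rw [integrable_fun_norm_addHaar volume (f := fun r : ℝ ↦ r ^ k * rexp (-t * r ^ 2))]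
  refine (integrableOn_rpow_mul_exp_neg_mul_sq ht
    (s := ((Module.finrank ℝ V - 1 + k : ℕ) : ℝ)) ?_).congr_fun (fun r hr ↦ ?_) measurableSet_Ioi
  · exact lt_of_lt_of_le (by norm_num) (Nat.cast_nonneg _)
  · simp only [smul_eq_mul, rpow_natCast, pow_add]
    ring

lemma integrable_mul_exp_neg_mul_norm_sq [Nontrivial V] {t : ℝ} (ht : 0 < t) {φ : V → ℝ}
    (hφ : Continuous φ) {C : ℝ} (hb : ∀ h, |φ h| ≤ C * (1 + ‖h‖) ^ 2) :
    Integrable (fun h : V ↦ φ h * rexp (-t * ‖h‖ ^ 2)) := by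
  have hI := fun k ↦ integrable_norm_pow_mul_exp_neg_mul_sq (V := V) ht k
  refine ((((hI 0).add ((hI 1).const_mul 2)).add (hI 2)).const_mul C).mono'
    (by fun_prop) (.of_forall fun h ↦ ?_)
  rw [norm_mul, norm_eq_abs, norm_eq_abs, abs_of_pos (exp_pos _)]
  calc _ ≤ C * (1 + ‖h‖) ^ 2 * rexp (-t * ‖h‖ ^ 2) := by
        gcongr
        exact hb h
    _ = _ := by
        simp only [Pi.add_apply]
        ring

/-- Integration by parts against a Gaussian weight. -/
lemma integral_inner_mul_exp_neg_mul_sq [Nontrivial V] {t : ℝ} (ht : 0 < t) (a : V)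
    {φ φ' : V → ℝ} (hφ : Continuous φ) (hφ' : Continuous φ') {C C' : ℝ}
    (hb : ∀ h, |φ h| ≤ C * (1 + ‖h‖)) (hb' : ∀ h, |φ' h| ≤ C' * (1 + ‖h‖))
    (hd : ∀ h, HasLineDerivAt ℝ φ (φ' h) h a) :
    ∫ h, ⟪h, a⟫ * φ h * rexp (-t * ‖h‖ ^ 2) =
      (2 * t)⁻¹ * ∫ h, φ' h * rexp (-t * ‖h‖ ^ 2) := by
  have hG : ∀ h : V, HasLineDerivAt ℝ (fun h : V ↦ rexp (-t * ‖h‖ ^ 2))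
      (rexp (-t * ‖h‖ ^ 2) * (-t * (2 * ⟪h, a⟫))) h a := by
    intro h
    have h1 : HasFDerivAt (fun h : V ↦ ‖h‖ ^ 2) (2 • (innerSL ℝ h)) h :=
      (hasStrictFDerivAt_norm_sq h).hasFDerivAt
    have h2 := ((h1.const_mul (-t)).exp).hasLineDerivAt a
    simpa using h2
  have hI : ∀ {ψ : V → ℝ} {K : ℝ}, Continuous ψ → (∀ h, |ψ h| ≤ K * (1 + ‖h‖)) →
      Integrable (fun h : V ↦ ψ h * rexp (-t * ‖h‖ ^ 2)) := by
    intro ψ K hψ hK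
    have hK0 : 0 ≤ K := by simpa using (abs_nonneg _).trans (hK 0)
    refine integrable_mul_exp_neg_mul_norm_sq ht hψ (C := K) fun h ↦ (hK h).trans ?_
    gcongr
    nlinarith [norm_nonneg h]
  have hI1 : Integrable (fun h : V ↦ ⟪h, a⟫ * φ h * rexp (-t * ‖h‖ ^ 2)) := by
    have hC0 : 0 ≤ C := by simpa using (abs_nonneg _).trans (hb 0)
    refine integrable_mul_exp_neg_mul_norm_sq ht (by fun_prop) (C := ‖a‖ * C) fun h ↦ ?_
    rw [abs_mul]
    calc _ ≤ (‖h‖ * ‖a‖) * (C * (1 + ‖h‖)) := by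
          gcongr
          · exact abs_real_inner_le_norm h a
          · exact hb h
      _ ≤ ((1 + ‖h‖) * ‖a‖) * (C * (1 + ‖h‖)) := by
          gcongr
          linarith
      _ = _ := by ring
  have ibp := integral_bilinear_hasLineDerivAt_right_eq_neg_left_of_integrable (μ := volume)
    (B := ContinuousLinearMap.mul ℝ ℝ) (v := a)
    (f := φ) (f' := φ') (g := fun h : V ↦ rexp (-t * ‖h‖ ^ 2))
    (g' := fun h ↦ rexp (-t * ‖h‖ ^ 2) * (-t * (2 * ⟪h, a⟫)))
    (by simpa using hI hφ' hb')
    (by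
      refine (hI1.const_mul (-2 * t)).congr (.of_forall fun h ↦ ?_)
      simp only [ContinuousLinearMap.mul_apply']
      ring)
    (by simpa using hI hφ hb)
    (fun h _ ↦ hd h) (fun h _ ↦ hG h)
  simp only [ContinuousLinearMap.mul_apply'] at ibp
  have h3 : ∫ h, φ h * (rexp (-t * ‖h‖ ^ 2) * (-t * (2 * ⟪h, a⟫))) =
      (-2 * t) * ∫ h, ⟪h, a⟫ * φ h * rexp (-t * ‖h‖ ^ 2) := by
    rw [← integral_const_mul]
    congr 1 with h
    ring
  rw [h3] at ibp
  rw [eq_inv_mul_iff_mul_eq₀ (by positivity)]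
  linarith

lemma integral_cos_mul_exp_neg_mul_sq {t : ℝ} (ht : 0 < t) (ξ : V) :
    ∫ h : V, cos (2 * π * ⟪h, ξ⟫) * rexp (-t * ‖h‖ ^ 2) =
      (π / t) ^ ((Module.finrank ℝ V : ℝ) / 2) * rexp (-(π ^ 2 * ‖ξ‖ ^ 2 / t)) := by
  have h0 : 0 < (t : ℂ).re := by simpa
  have h1 := GaussianFourier.integral_cexp_neg_mul_sq_norm_add h0 (2 * π * Complex.I) ξ
  have h2 := GaussianFourier.integrable_cexp_neg_mul_sq_norm_add h0 (2 * π * Complex.I) ξ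
  have h3 := congrArg Complex.re h1
  have h4 := integral_re h2
  simp only [RCLike.re_to_complex] at h4
  rw [← h4] at h3
  convert h3 using 1
  · congr 1 with h
    rw [Complex.exp_re]
    simp [← Complex.ofReal_pow, real_inner_comm, mul_comm]
  · have : ((π : ℂ) / t) ^ ((Module.finrank ℝ V : ℂ) / 2) *
        Complex.exp ((2 * π * Complex.I) ^ 2 * ‖ξ‖ ^ 2 / (4 * t)) =
        (((π / t) ^ ((Module.finrank ℝ V : ℝ) / 2) * rexp (-(π ^ 2 * ‖ξ‖ ^ 2 / t)) : ℝ) : ℂ) := by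
      push_cast
      rw [Complex.ofReal_cpow (by positivity)]
      push_cast
      congr 2
      rw [mul_pow, Complex.I_sq]
      have : (t : ℂ) ≠ 0 := by exact_mod_cast ht.ne'
      field_simp
      ring
    rw [this, Complex.ofReal_re]

lemma integral_inner_mul_inner_mul_one_sub_cos_mul_exp [Nontrivial V] {t : ℝ} (ht : 0 < t)
    (a b ξ : V) :
    ∫ h : V, ⟪h, a⟫ * (⟪h, b⟫ * (1 - cos (2 * π * ⟪h, ξ⟫))) * rexp (-t * ‖h‖ ^ 2) =
      (π / t) ^ ((Module.finrank ℝ V : ℝ) / 2) *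
        (⟪a, b⟫ / (2 * t) * (1 - rexp (-(π ^ 2 * ‖ξ‖ ^ 2 / t))) +
          π ^ 2 * ⟪ξ, a⟫ * ⟪ξ, b⟫ / t ^ 2 * rexp (-(π ^ 2 * ‖ξ‖ ^ 2 / t))) := by
  have hl : ∀ (c h v : V), HasDerivAt (fun r : ℝ ↦ ⟪h + r • v, c⟫) ⟪v, c⟫ 0 := by
    intro c h v
    have := ((hasDerivAt_id (0 : ℝ)).smul_const v).const_add h
    simpa using this.inner ℝ (hasDerivAt_const (0 : ℝ) c)
  have hin : ∀ c h : V, |⟪h, c⟫| ≤ ‖c‖ * (1 + ‖h‖) := fun c h ↦ by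
    have := abs_real_inner_le_norm h c
    nlinarith [norm_nonneg c]
  have h1 : ∀ h : V, 1 ≤ 1 + ‖h‖ := fun h ↦ by linarith [norm_nonneg h]
  have h2 : ∀ h : V, 1 ≤ (1 + ‖h‖) ^ 2 := fun h ↦ one_le_pow₀ (h1 h)
  have hI1 : Integrable (fun h : V ↦ cos (2 * π * ⟪h, ξ⟫) * rexp (-t * ‖h‖ ^ 2)) :=
    integrable_mul_exp_neg_mul_norm_sq ht (by fun_prop) (C := 1) fun h ↦ by
      linarith [abs_cos_le_one (2 * π * ⟪h, ξ⟫), h2 h]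
  have hI2 : Integrable (fun h : V ↦ rexp (-t * ‖h‖ ^ 2)) := by
    simpa using integrable_norm_pow_mul_exp_neg_mul_sq (V := V) ht 0
  have hbsin : ∀ h, |⟪h, b⟫ * sin (2 * π * ⟪h, ξ⟫)| ≤ ‖b‖ * (1 + ‖h‖) := fun h ↦ by
    rw [abs_mul]
    exact (mul_le_of_le_one_right (abs_nonneg _) (abs_sin_le_one _)).trans (hin b h)
  have hI3 : Integrable (fun h : V ↦ ⟪h, b⟫ * sin (2 * π * ⟪h, ξ⟫) * rexp (-t * ‖h‖ ^ 2)) :=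
    integrable_mul_exp_neg_mul_norm_sq ht (by fun_prop) (C := ‖b‖) fun h ↦ by
      refine (hbsin h).trans ?_
      gcongr
      nlinarith [h1 h]
  have hgauss : ∫ h : V, rexp (-t * ‖h‖ ^ 2) = (π / t) ^ ((Module.finrank ℝ V : ℝ) / 2) :=
    GaussianFourier.integral_rexp_neg_mul_sq_norm ht
  have hsin : ∫ h : V, ⟪h, b⟫ * sin (2 * π * ⟪h, ξ⟫) * rexp (-t * ‖h‖ ^ 2) =
      (2 * t)⁻¹ * ∫ h : V, (2 * π * ⟪b, ξ⟫) * cos (2 * π * ⟪h, ξ⟫) * rexp (-t * ‖h‖ ^ 2) := by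
    refine integral_inner_mul_exp_neg_mul_sq ht b (C := 1) (C' := |2 * π * ⟪b, ξ⟫|)
      (by fun_prop) (by fun_prop) (fun h ↦ ?_) (fun h ↦ ?_) (fun h ↦ ?_)
    · linarith [abs_sin_le_one (2 * π * ⟪h, ξ⟫), h1 h]
    · rw [abs_mul]
      gcongr
      exact (abs_cos_le_one _).trans (h1 h)
    · have := ((hl ξ h b).const_mul (2 * π)).sin
      simpa [HasLineDerivAt, mul_comm, mul_assoc, mul_left_comm] using this
  have hcb : ∀ h : V, |1 - cos (2 * π * ⟪h, ξ⟫)| ≤ 2 := fun h ↦ by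
    rw [abs_le]
    constructor <;> linarith [neg_one_le_cos (2 * π * ⟪h, ξ⟫), cos_le_one (2 * π * ⟪h, ξ⟫)]
  have hmain : ∫ h : V, ⟪h, a⟫ * (⟪h, b⟫ * (1 - cos (2 * π * ⟪h, ξ⟫))) * rexp (-t * ‖h‖ ^ 2) =
      (2 * t)⁻¹ * ∫ h : V, (⟪a, b⟫ * (1 - cos (2 * π * ⟪h, ξ⟫)) +
        2 * π * ⟪a, ξ⟫ * (⟪h, b⟫ * sin (2 * π * ⟪h, ξ⟫))) * rexp (-t * ‖h‖ ^ 2) := by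
    refine integral_inner_mul_exp_neg_mul_sq ht a (C := ‖b‖ * 2)
      (C' := |⟪a, b⟫| * 2 + |2 * π * ⟪a, ξ⟫| * ‖b‖)
      (by fun_prop) (by fun_prop) (fun h ↦ ?_) (fun h ↦ ?_) (fun h ↦ ?_)
    · rw [abs_mul]
      refine (mul_le_mul (hin b h) (hcb h) (abs_nonneg _) (by positivity)).trans_eq ?_
      ring
    · refine (abs_add_le _ _).trans ?_
      rw [abs_mul, abs_mul (2 * π * ⟪a, ξ⟫)]
      calc _ ≤ |⟪a, b⟫| * (2 * (1 + ‖h‖)) + |2 * π * ⟪a, ξ⟫| * (‖b‖ * (1 + ‖h‖)) := by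
            gcongr
            · linarith [hcb h, h1 h]
            · exact hbsin h
        _ = _ := by ring
    · have := (hl b h a).mul (((hl ξ h a).const_mul (2 * π)).cos.const_sub 1)
      simp only [HasLineDerivAt]
      convert! this using 1
      simp
      ring
  have hsplit : ∫ h : V, (⟪a, b⟫ * (1 - cos (2 * π * ⟪h, ξ⟫)) +
        2 * π * ⟪a, ξ⟫ * (⟪h, b⟫ * sin (2 * π * ⟪h, ξ⟫))) * rexp (-t * ‖h‖ ^ 2) =
      ⟪a, b⟫ * ((∫ h : V, rexp (-t * ‖h‖ ^ 2)) -
        ∫ h : V, cos (2 * π * ⟪h, ξ⟫) * rexp (-t * ‖h‖ ^ 2)) +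
      2 * π * ⟪a, ξ⟫ * ∫ h : V, ⟪h, b⟫ * sin (2 * π * ⟪h, ξ⟫) * rexp (-t * ‖h‖ ^ 2) := by
    rw [← integral_sub hI2 hI1, ← integral_const_mul, ← integral_const_mul,
      ← integral_add (by exact (hI2.sub hI1).const_mul _) (hI3.const_mul _)]
    congr 1 with h
    ring
  simp only [mul_assoc (2 * π * ⟪b, ξ⟫), integral_const_mul] at hsin
  rw [hmain, hsplit, hsin, hgauss, integral_cos_mul_exp_neg_mul_sq ht, real_inner_comm a ξ,
    real_inner_comm b ξ]
  field_simp

end Kernel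

section RealIntegrals

lemma integral_rpow_mul_exp_neg_div {s c : ℝ} (hs : s < 1) (hc : 0 < c) :
    ∫ t in Set.Ioi (0 : ℝ), t ^ (s - 2) * rexp (-(c / t)) = c ^ (s - 1) * Real.Gamma (1 - s) := by
  have h1 := integral_comp_rpow_Ioi (fun r : ℝ ↦ r ^ ((1 - s) - 1) * rexp (-(c * r)))
    (show (-1 : ℝ) ≠ 0 by norm_num)
  rw [integral_rpow_mul_exp_neg_mul_Ioi (by linarith) hc] at h1
  rw [one_div, inv_rpow hc.le, ← rpow_neg hc.le, neg_sub] at h1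
  rw [← h1]
  refine setIntegral_congr_fun measurableSet_Ioi fun t ht ↦ ?_
  have ht0 : 0 < t := ht
  simp only [abs_neg, abs_one, one_mul, smul_eq_mul]
  rw [← rpow_mul ht0.le, ← mul_assoc, ← rpow_add ht0, rpow_neg_one, ← div_eq_mul_inv]
  congr 2
  ring

lemma integrableOn_rpow_mul_exp_neg_div {s c : ℝ} (hs : s < 1) (hc : 0 < c) :
    IntegrableOn (fun t : ℝ ↦ t ^ (s - 2) * rexp (-(c / t))) (Set.Ioi 0) := by
  refine Integrable.of_integral_ne_zero ?_
  rw [integral_rpow_mul_exp_neg_div hs hc]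
  have := Real.Gamma_pos_of_pos (show 0 < 1 - s by linarith)
  positivity

lemma one_sub_exp_neg_mem {x : ℝ} (hx : 0 ≤ x) : 0 ≤ 1 - rexp (-x) ∧ 1 - rexp (-x) ≤ min 1 x := by
  refine ⟨by simpa using hx, le_min ?_ ?_⟩
  · linarith [exp_pos (-x)]
  · linarith [add_one_le_exp (-x)]

lemma integrableOn_rpow_mul_one_sub_exp_neg_div {s c : ℝ} (hs : s ∈ Set.Ioo (0 : ℝ) 1)
    (hc : 0 < c) :
    IntegrableOn (fun t : ℝ ↦ t ^ (s - 1) * (1 - rexp (-(c / t)))) (Set.Ioi 0) := by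
  have hmeas : Measurable (fun t : ℝ ↦ t ^ (s - 1) * (1 - rexp (-(c / t)))) := by fun_prop
  have hbd : ∀ t : ℝ, 0 < t → ‖t ^ (s - 1) * (1 - rexp (-(c / t)))‖ ≤
      t ^ (s - 1) * min 1 (c / t) := fun t ht ↦ by
    obtain ⟨h1, h2⟩ := one_sub_exp_neg_mem (div_pos hc ht).le
    rw [norm_of_nonneg (by positivity)]
    gcongr
  rw [← Set.Ioc_union_Ioi_eq_Ioi zero_le_one, integrableOn_union]
  constructor
  · have h1 : IntegrableOn (fun r : ℝ ↦ r ^ (s - 1)) (Set.Ioc 0 1) :=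
      (intervalIntegrable_iff_integrableOn_Ioc_of_le zero_le_one).1
        (intervalIntegral.intervalIntegrable_rpow' (by linarith [hs.1]))
    refine h1.mono' hmeas.aestronglyMeasurable
      ((ae_restrict_iff' measurableSet_Ioc).2 (.of_forall fun t ht ↦ (hbd t ht.1).trans ?_))
    exact mul_le_of_le_one_right (rpow_nonneg ht.1.le _) (min_le_left _ _)
  · have h1 : IntegrableOn (fun r : ℝ ↦ r ^ (s - 2) * c) (Set.Ioi 1) :=
      (integrableOn_Ioi_rpow_of_lt (by linarith [hs.2]) one_pos).mul_const _
    refine h1.mono' hmeas.aestronglyMeasurable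
      ((ae_restrict_iff' measurableSet_Ioi).2 (.of_forall fun t ht ↦ ?_))
    have ht0 : (0 : ℝ) < t := one_pos.trans ht
    refine (hbd t ht0).trans ?_
    calc _ ≤ t ^ (s - 1) * (c / t) := by
          gcongr
          exact min_le_right _ _
      _ = _ := by
          rw [show s - 2 = s - 1 - 1 by ring, rpow_sub_one ht0.ne' (s - 1)]
          ring

lemma integral_rpow_mul_one_sub_exp_neg_div {s c : ℝ} (hs : s ∈ Set.Ioo (0 : ℝ) 1) (hc : 0 < c) :
    ∫ t in Set.Ioi (0 : ℝ), t ^ (s - 1) * (1 - rexp (-(c / t))) =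
      c ^ s * Real.Gamma (1 - s) / s := by
  have hs0 : 0 < s := hs.1
  have hI1 := integrableOn_rpow_mul_one_sub_exp_neg_div hs hc
  have hI2 := integrableOn_rpow_mul_exp_neg_div hs.2 hc
  set F : ℝ → ℝ := fun t ↦ t ^ s / s * (1 - rexp (-(c / t))) with hF
  have hbd : ∀ t : ℝ, 0 ≤ t → 0 ≤ F t ∧ F t ≤ t ^ s / s ∧ F t ≤ c / s * t ^ (s - 1) := by
    intro t ht
    obtain ⟨h1, h2⟩ := one_sub_exp_neg_mem (div_nonneg hc.le ht)
    refine ⟨by positivity, ?_, ?_⟩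
    · exact mul_le_of_le_one_right (by positivity) (h2.trans (min_le_left _ _))
    · rcases ht.eq_or_lt with rfl | ht
      · simp only [hF, zero_rpow hs0.ne', zero_div, zero_mul]
        positivity
      · calc F t ≤ t ^ s / s * (c / t) := by
              simp only [hF]
              gcongr
              exact h2.trans (min_le_right _ _)
          _ = _ := by
              rw [rpow_sub_one ht.ne']
              ring
  have hder : ∀ t ∈ Set.Ioi (0 : ℝ), HasDerivAt F
      (t ^ (s - 1) * (1 - rexp (-(c / t))) - c / s * (t ^ (s - 2) * rexp (-(c / t)))) t := by
    intro t ht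
    have ht0 : 0 < t := ht
    have h1 := (hasDerivAt_rpow_const (p := s) (Or.inl ht0.ne')).div_const s
    have h2 : HasDerivAt (fun t : ℝ ↦ c / t) (-c / t ^ 2) t := by
      simpa [div_eq_mul_inv] using (hasDerivAt_inv ht0.ne').const_mul c
    convert! h1.mul (h2.neg.exp.const_sub 1) using 1
    rw [show s - 2 = s - 1 - 1 by ring, rpow_sub_one ht0.ne' (s - 1), rpow_sub_one ht0.ne']
    simp only [Pi.neg_apply]
    field_simp
    ring
  have hcont : ContinuousWithinAt F (Set.Ici 0) 0 := by
    have hF0 : F 0 = 0 := by simp [hF, hs0.ne']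
    rw [ContinuousWithinAt, hF0]
    have h0 : Tendsto (fun t : ℝ ↦ t ^ s / s) (nhdsWithin 0 (Set.Ici 0)) (nhds 0) := by
      have : ContinuousAt (fun t : ℝ ↦ t ^ s / s) 0 :=
        (continuousAt_rpow_const _ _ (Or.inr hs0.le)).div_const s
      simpa [hs0.ne'] using this.tendsto.mono_left nhdsWithin_le_nhds
    exact tendsto_of_tendsto_of_tendsto_of_le_of_le' tendsto_const_nhds h0
      (eventually_nhdsWithin_of_forall fun t ht ↦ (hbd t ht).1)
      (eventually_nhdsWithin_of_forall fun t ht ↦ (hbd t ht).2.1)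
  have htop : Tendsto F atTop (nhds 0) := by
    have h0 : Tendsto (fun t : ℝ ↦ c / s * t ^ (s - 1)) atTop (nhds 0) := by
      have := (tendsto_rpow_neg_atTop (show 0 < 1 - s by linarith [hs.2])).const_mul (c / s)
      simpa using this
    exact tendsto_of_tendsto_of_tendsto_of_le_of_le' tendsto_const_nhds h0
      ((eventually_ge_atTop 0).mono fun t ht ↦ (hbd t ht).1)
      ((eventually_ge_atTop 0).mono fun t ht ↦ (hbd t ht).2.2)
  have hftc := integral_Ioi_of_hasDerivAt_of_tendsto hcont hder (hI1.sub (hI2.const_mul _)) htop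
  rw [integral_sub hI1 (hI2.const_mul _), integral_const_mul,
    integral_rpow_mul_exp_neg_div hs.2 hc] at hftc
  have hF0 : F 0 = 0 := by simp [hF, hs0.ne']
  rw [hF0, rpow_sub_one hc.ne'] at hftc
  have : ∫ t in Set.Ioi (0 : ℝ), t ^ (s - 1) * (1 - rexp (-(c / t))) =
      c / s * (c ^ s / c * Real.Gamma (1 - s)) := by linarith
  rw [this]
  field_simp

end RealIntegrals

section LevyKernel

variable {V : Type*} [NormedAddCommGroup V] [InnerProductSpace ℝ V]

/-- The entry `⟨h, a⟩⟨h, b⟩ / (|h|² |h|^{d+2s})` of the matrix-valued Lévy kernel. -/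
def levyKernel (s : ℝ) (a b h : V) : ℝ :=
  ⟪h, a⟫ * ⟪h, b⟫ / (‖h‖ ^ 2 * ‖h‖ ^ ((Module.finrank ℝ V : ℝ) + 2 * s))

/-- The Fourier multiplier associated with `levyKernel s a b`. -/
def levySymbol (s : ℝ) (a b ξ : V) : ℝ :=
  2 * (π ^ ((Module.finrank ℝ V : ℝ) / 2) * Real.Gamma (1 - s) /
    Real.Gamma ((Module.finrank ℝ V : ℝ) / 2 + s + 1)) * (π * ‖ξ‖) ^ (2 * s) *
      (⟪a, b⟫ / (2 * s) + ⟪ξ, a⟫ * ⟪ξ, b⟫ / ‖ξ‖ ^ 2)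

lemma abs_levyKernel_le (s : ℝ) (a b h : V) :
    |levyKernel s a b h| ≤ ‖a‖ * ‖b‖ * (‖h‖ ^ ((Module.finrank ℝ V : ℝ) + 2 * s))⁻¹ := by
  have hr : 0 ≤ ‖h‖ ^ ((Module.finrank ℝ V : ℝ) + 2 * s) := by positivity
  rcases eq_or_ne h 0 with rfl | hh
  · simp only [levyKernel, inner_zero_left, zero_mul, zero_div, abs_zero]
    positivity
  · have hn : 0 < ‖h‖ := norm_pos_iff.2 hh
    rw [levyKernel, abs_div, abs_mul, abs_of_nonneg (by positivity : 0 ≤ ‖h‖ ^ 2 * _),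
      ← div_div, div_eq_mul_inv _ (‖h‖ ^ _)]
    gcongr
    rw [div_le_iff₀ (by positivity)]
    calc _ ≤ (‖h‖ * ‖a‖) * (‖h‖ * ‖b‖) := by
          gcongr <;> exact abs_real_inner_le_norm _ _
      _ = _ := by ring

lemma one_sub_cos_inner_le (h ξ : V) :
    1 - cos (2 * π * ⟪h, ξ⟫) ≤ (2 + 2 * π ^ 2 * ‖ξ‖ ^ 2) * min 1 (‖h‖ ^ 2) := by
  rcases le_total 1 (‖h‖ ^ 2) with h1 | h1
  · rw [min_eq_left h1]
    nlinarith [neg_one_le_cos (2 * π * ⟪h, ξ⟫), mul_nonneg (sq_nonneg π) (sq_nonneg ‖ξ‖)]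
  · rw [min_eq_right h1]
    have h2 := one_sub_sq_div_two_le_cos (x := 2 * π * ⟪h, ξ⟫)
    have h3 : ⟪h, ξ⟫ ^ 2 ≤ (‖h‖ * ‖ξ‖) ^ 2 := sq_le_sq' (neg_le_of_abs_le
      (abs_real_inner_le_norm h ξ)) (real_inner_le_norm h ξ)
    nlinarith [mul_le_mul_of_nonneg_left h3 (sq_nonneg π), sq_nonneg ‖h‖]

/-- The Lévy kernel as a superposition of Gaussians. -/
lemma integral_rpow_mul_exp_eq_levyKernel {s : ℝ} (hs : 0 < s) (a b : V) {h : V} (hh : h ≠ 0) :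
    ∫ t in Set.Ioi (0 : ℝ), t ^ ((Module.finrank ℝ V : ℝ) / 2 + s) *
        (⟪h, a⟫ * ⟪h, b⟫ * rexp (-t * ‖h‖ ^ 2)) =
      Real.Gamma ((Module.finrank ℝ V : ℝ) / 2 + s + 1) * levyKernel s a b h := by
  have hn : 0 < ‖h‖ := norm_pos_iff.2 hh
  have h1 := integral_rpow_mul_exp_neg_mul_Ioi
    (a := (Module.finrank ℝ V : ℝ) / 2 + s + 1) (r := ‖h‖ ^ 2) (by positivity) (by positivity)
  rw [add_sub_cancel_right] at h1
  have h2 : (1 / ‖h‖ ^ 2) ^ ((Module.finrank ℝ V : ℝ) / 2 + s + 1) =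
      (‖h‖ ^ 2 * ‖h‖ ^ ((Module.finrank ℝ V : ℝ) + 2 * s))⁻¹ := by
    rw [one_div, inv_rpow (by positivity), ← rpow_natCast, ← rpow_mul hn.le, ← rpow_add hn]
    congr 2
    push_cast
    ring
  rw [h2] at h1
  calc _ = ⟪h, a⟫ * ⟪h, b⟫ * ∫ t in Set.Ioi (0 : ℝ),
        t ^ ((Module.finrank ℝ V : ℝ) / 2 + s) * rexp (-(‖h‖ ^ 2 * t)) := by
        rw [← integral_const_mul]
        congr 1 with t
        rw [show -t * ‖h‖ ^ 2 = -(‖h‖ ^ 2 * t) by ring]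
        ring
    _ = _ := by
        rw [h1, levyKernel]
        ring

variable [FiniteDimensional ℝ V] [MeasurableSpace V] [BorelSpace V]

@[fun_prop]
lemma measurable_levyKernel (s : ℝ) (a b : V) : Measurable (levyKernel s a b) := by
  unfold levyKernel
  fun_prop

lemma integrable_levyKernel_mul_one_sub_cos [Nontrivial V] {s : ℝ} (hs : s ∈ Set.Ioo (0 : ℝ) 1)
    (a b ξ : V) :
    Integrable (fun h : V ↦ levyKernel s a b h * (1 - cos (2 * π * ⟪h, ξ⟫))) := by
  refine ((integrable_min_one_sq_mul_norm_rpow hs).const_mul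
    (‖a‖ * ‖b‖ * (2 + 2 * π ^ 2 * ‖ξ‖ ^ 2))).mono' (by fun_prop) (.of_forall fun h ↦ ?_)
  have h0 : 0 ≤ 1 - cos (2 * π * ⟪h, ξ⟫) := by linarith [cos_le_one (2 * π * ⟪h, ξ⟫)]
  rw [norm_mul, norm_eq_abs, norm_of_nonneg h0]
  refine (mul_le_mul (abs_levyKernel_le s a b h) (one_sub_cos_inner_le h ξ) h0
    (by positivity)).trans_eq ?_
  ring

lemma integrable_prod_rpow_mul_gaussian [Nontrivial V] {s : ℝ} (hs : s ∈ Set.Ioo (0 : ℝ) 1)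
    (a b ξ : V) :
    Integrable (Function.uncurry fun (h : V) (t : ℝ) ↦
      t ^ ((Module.finrank ℝ V : ℝ) / 2 + s) * (⟪h, a⟫ * ⟪h, b⟫ * rexp (-t * ‖h‖ ^ 2)) *
        (1 - cos (2 * π * ⟪h, ξ⟫))) (volume.prod (volume.restrict (Set.Ioi 0))) := by
  have hmeas : Measurable (Function.uncurry fun (h : V) (t : ℝ) ↦
      t ^ ((Module.finrank ℝ V : ℝ) / 2 + s) * (⟪h, a⟫ * ⟪h, b⟫ * rexp (-t * ‖h‖ ^ 2)) *
        (1 - cos (2 * π * ⟪h, ξ⟫))) := by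
    simp only [Function.uncurry_def]
    fun_prop
  have hne : ∀ᵐ h : V, h ≠ 0 := by
    simp [ae_iff]
  rw [integrable_prod_iff hmeas.aestronglyMeasurable]
  simp only [Function.uncurry_apply_pair]
  constructor
  · filter_upwards [hne] with h hh
    have hn : 0 < ‖h‖ := norm_pos_iff.2 hh
    have := integrableOn_rpow_mul_exp_neg_mul_rpow (p := 1) (b := ‖h‖ ^ 2)
      (s := (Module.finrank ℝ V : ℝ) / 2 + s)
      (by linarith [hs.1, Nat.cast_nonneg (α := ℝ) (Module.finrank ℝ V)]) one_pos (by positivity)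
    refine (Integrable.mul_const this (⟪h, a⟫ * ⟪h, b⟫ * (1 - cos (2 * π * ⟪h, ξ⟫)))).congr
      (.of_forall fun t ↦ ?_)
    simp only [rpow_one]
    rw [show -t * ‖h‖ ^ 2 = -‖h‖ ^ 2 * t by ring]
    ring
  · refine ((integrable_levyKernel_mul_one_sub_cos hs a b ξ).norm.const_mul
      (Real.Gamma ((Module.finrank ℝ V : ℝ) / 2 + s + 1))).congr ?_
    filter_upwards [hne] with h hh
    have h1 := integral_rpow_mul_exp_eq_levyKernel hs.1 a b hh
    have h0 : 0 ≤ 1 - cos (2 * π * ⟪h, ξ⟫) := by linarith [cos_le_one (2 * π * ⟪h, ξ⟫)]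
    obtain ⟨ε, hε⟩ : ∃ ε, |⟪h, a⟫ * ⟪h, b⟫| = ε * (⟪h, a⟫ * ⟪h, b⟫) := by
      rcases abs_choice (⟪h, a⟫ * ⟪h, b⟫) with h | h
      · exact ⟨1, by rw [h, one_mul]⟩
      · exact ⟨-1, by rw [h, neg_one_mul]⟩
    have hk : |levyKernel s a b h| = ε * levyKernel s a b h := by
      rw [levyKernel, abs_div, hε, abs_of_nonneg (by positivity : 0 ≤ ‖h‖ ^ 2 * _), mul_div_assoc]
    rw [norm_mul, norm_of_nonneg h0, norm_eq_abs, hk, ← mul_assoc, mul_left_comm, ← h1, mul_comm ε,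
      ← integral_mul_const, ← integral_mul_const]
    refine setIntegral_congr_fun measurableSet_Ioi fun t ht ↦ ?_
    have ht0 : 0 < t := ht
    simp only [norm_mul, norm_of_nonneg h0, norm_of_nonneg (exp_pos _).le,
      norm_of_nonneg (rpow_nonneg ht0.le _)]
    rw [← norm_mul, norm_eq_abs, hε]
    ring

/-- The Fourier symbol of the matrix-valued Lévy kernel. -/
lemma integral_levyKernel_mul_one_sub_cos [Nontrivial V] {s : ℝ} (hs : s ∈ Set.Ioo (0 : ℝ) 1)
    (a b ξ : V) :
    ∫ h : V, levyKernel s a b h * (2 * (1 - cos (2 * π * ⟪h, ξ⟫))) = levySymbol s a b ξ := by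
  have hs0 : 0 < s := hs.1
  rcases eq_or_ne ξ 0 with rfl | hξ
  · simp [levySymbol, hs0.ne']
  have hn : 0 < ‖ξ‖ := norm_pos_iff.2 hξ
  have hG : 0 < Real.Gamma ((Module.finrank ℝ V : ℝ) / 2 + s + 1) :=
    Real.Gamma_pos_of_pos (by linarith [hs.1, Nat.cast_nonneg (α := ℝ) (Module.finrank ℝ V)])
  have hne : ∀ᵐ h : V, h ≠ 0 := by
    simp [ae_iff]
  set c : ℝ := π ^ 2 * ‖ξ‖ ^ 2 with hc
  have hc0 : 0 < c := by positivity
  have hcs : c ^ s = (π * ‖ξ‖) ^ (2 * s) := by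
    rw [hc, ← mul_pow, ← rpow_natCast, ← rpow_mul (by positivity)]
    simp
  have hswap := integral_integral_swap (integrable_prod_rpow_mul_gaussian hs a b ξ)
  have hleft : ∫ h : V, ∫ t in Set.Ioi (0 : ℝ), t ^ ((Module.finrank ℝ V : ℝ) / 2 + s) *
      (⟪h, a⟫ * ⟪h, b⟫ * rexp (-t * ‖h‖ ^ 2)) * (1 - cos (2 * π * ⟪h, ξ⟫)) =
      Real.Gamma ((Module.finrank ℝ V : ℝ) / 2 + s + 1) / 2 *
        ∫ h : V, levyKernel s a b h * (2 * (1 - cos (2 * π * ⟪h, ξ⟫))) := by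
    rw [← integral_const_mul]
    refine integral_congr_ae ?_
    filter_upwards [hne] with h hh
    rw [integral_mul_const, integral_rpow_mul_exp_eq_levyKernel hs0 a b hh]
    ring
  have hright : ∫ t in Set.Ioi (0 : ℝ), ∫ h : V, t ^ ((Module.finrank ℝ V : ℝ) / 2 + s) *
      (⟪h, a⟫ * ⟪h, b⟫ * rexp (-t * ‖h‖ ^ 2)) * (1 - cos (2 * π * ⟪h, ξ⟫)) =
      π ^ ((Module.finrank ℝ V : ℝ) / 2) *
        (⟪a, b⟫ / 2 * (c ^ s * Real.Gamma (1 - s) / s) +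
          π ^ 2 * ⟪ξ, a⟫ * ⟪ξ, b⟫ * (c ^ (s - 1) * Real.Gamma (1 - s))) := by
    rw [← integral_rpow_mul_one_sub_exp_neg_div hs hc0, ← integral_rpow_mul_exp_neg_div hs.2 hc0,
      ← integral_const_mul, ← integral_const_mul, ← integral_add
        ((integrableOn_rpow_mul_one_sub_exp_neg_div hs hc0).const_mul _)
        ((integrableOn_rpow_mul_exp_neg_div hs.2 hc0).const_mul _), ← integral_const_mul]
    refine setIntegral_congr_fun measurableSet_Ioi fun t ht ↦ ?_
    have ht0 : 0 < t := ht
    have h1 := integral_inner_mul_inner_mul_one_sub_cos_mul_exp ht0 a b ξ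
    calc _ = t ^ ((Module.finrank ℝ V : ℝ) / 2 + s) * ∫ h : V,
          ⟪h, a⟫ * (⟪h, b⟫ * (1 - cos (2 * π * ⟪h, ξ⟫))) * rexp (-t * ‖h‖ ^ 2) := by
          rw [← integral_const_mul]
          congr 1 with h
          ring
      _ = _ := by
          rw [h1, ← hc, div_rpow pi_pos.le ht0.le, rpow_add ht0, rpow_sub_one ht0.ne',
            show s - 2 = s - 1 - 1 by ring, rpow_sub_one ht0.ne', rpow_sub_one ht0.ne']
          have : 0 < t ^ ((Module.finrank ℝ V : ℝ) / 2) := by positivity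
          field_simp
  rw [hleft, hright] at hswap
  rw [← mul_right_inj' (half_pos hG).ne', hswap, levySymbol, ← hcs, rpow_sub_one hc0.ne', hc]
  field_simp

end LevyKernel

section SecondDifference

open scoped SchwartzMap

variable {V : Type*} [NormedAddCommGroup V]

/-- The second-order difference `2 f(x) - f(x + h) - f(x - h)` as a Schwartz function of `x`. -/
def secondDiff [NormedSpace ℝ V] (f : 𝓢(V, ℂ)) (h : V) : 𝓢(V, ℂ) :=
  (2 : ℂ) • f - SchwartzMap.compSubConstCLM ℂ (-h) f - SchwartzMap.compSubConstCLM ℂ h f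

@[simp]
lemma secondDiff_apply [NormedSpace ℝ V] (f : 𝓢(V, ℂ)) (h x : V) :
    secondDiff f h x = 2 * f x - f (x + h) - f (x - h) := by
  simp [secondDiff]

variable [InnerProductSpace ℝ V] [FiniteDimensional ℝ V] [MeasurableSpace V] [BorelSpace V]

lemma fourier_compSubConstCLM (f : 𝓢(V, ℂ)) (h ξ : V) :
    𝓕 (SchwartzMap.compSubConstCLM ℂ h f) ξ =
      Complex.exp (↑(-(2 * π * ⟪h, ξ⟫)) * Complex.I) * 𝓕 f ξ := by
  have h1 := congrFun (VectorFourier.fourierIntegral_comp_add_right Real.fourierChar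
    (volume : Measure V) (innerₗ V) f (-h)) ξ
  have h2 : (SchwartzMap.compSubConstCLM ℂ h f : V → ℂ) = f ∘ fun v ↦ v + -h := by
    ext x
    simp [sub_eq_add_neg]
  rw [SchwartzMap.fourier_coe, SchwartzMap.fourier_coe, h2]
  refine h1.trans ?_
  rw [Circle.smul_def, Real.fourierChar_apply]
  simp only [innerₗ_apply_apply, inner_neg_left, mul_neg, smul_eq_mul]
  rfl

lemma fourier_secondDiff (f : 𝓢(V, ℂ)) (h ξ : V) :
    𝓕 (secondDiff f h) ξ = ((2 * (1 - cos (2 * π * ⟪h, ξ⟫)) : ℝ) : ℂ) * 𝓕 f ξ := by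
  have h1 : 𝓕 (secondDiff f h) = (2 : ℂ) • 𝓕 f -
      𝓕 (SchwartzMap.compSubConstCLM ℂ (-h) f) - 𝓕 (SchwartzMap.compSubConstCLM ℂ h f) := by
    simp only [secondDiff, ← SchwartzMap.fourierTransformCLM_apply ℂ, map_sub, map_smul]
  rw [h1, sub_apply, sub_apply, fourier_compSubConstCLM,
    fourier_compSubConstCLM, smul_apply]
  simp only [inner_neg_left, mul_neg, neg_neg, smul_eq_mul]
  push_cast
  rw [mul_sub, mul_one, Complex.two_cos]
  ring_nf

lemma norm_apply_le_integral_norm_fourier (f : 𝓢(V, ℂ)) (x : V) :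
    ‖f x‖ ≤ ∫ ξ, ‖𝓕 f ξ‖ := by
  have h1 : f x = 𝓕⁻ (𝓕 f : 𝓢(V, ℂ)) x := by
    rw [FourierTransform.fourierInv_fourier_eq]
  rw [h1, SchwartzMap.fourierInv_coe]
  exact VectorFourier.norm_fourierIntegral_le_integral_norm _ _ _ _ _

lemma integrable_quadratic_mul_norm_fourier (f : 𝓢(V, ℂ)) :
    Integrable fun ξ : V ↦ 2 * (2 + 2 * π ^ 2 * ‖ξ‖ ^ 2) * ‖𝓕 f ξ‖ := by
  refine ((((𝓕 f).integrable_pow_mul volume 0).const_mul 4).add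
    (((𝓕 f).integrable_pow_mul volume 2).const_mul (4 * π ^ 2))).congr (.of_forall fun ξ ↦ ?_)
  simp only [Pi.add_apply, pow_zero]
  ring

lemma norm_two_mul_one_sub_cos_mul_le (f : 𝓢(V, ℂ)) (h ξ : V) :
    ‖((2 * (1 - cos (2 * π * ⟪h, ξ⟫)) : ℝ) : ℂ) * 𝓕 f ξ‖ ≤
      2 * (2 + 2 * π ^ 2 * ‖ξ‖ ^ 2) * ‖𝓕 f ξ‖ * min 1 (‖h‖ ^ 2) := by
  have h0 : 0 ≤ 1 - cos (2 * π * ⟪h, ξ⟫) := by linarith [cos_le_one (2 * π * ⟪h, ξ⟫)]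
  rw [norm_mul, Complex.norm_of_nonneg (by positivity)]
  nlinarith [mul_le_mul_of_nonneg_right (one_sub_cos_inner_le h ξ) (norm_nonneg (𝓕 f ξ))]

lemma norm_secondDiff_le (f : 𝓢(V, ℂ)) (h x : V) :
    ‖secondDiff f h x‖ ≤
      (∫ ξ : V, 2 * (2 + 2 * π ^ 2 * ‖ξ‖ ^ 2) * ‖𝓕 f ξ‖) * min 1 (‖h‖ ^ 2) := by
  refine (norm_apply_le_integral_norm_fourier _ x).trans ?_
  rw [← integral_mul_const]
  refine integral_mono ((𝓕 (secondDiff f h)).integrable.norm)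
    ((integrable_quadratic_mul_norm_fourier f).mul_const _) fun ξ ↦ ?_
  simp only [fourier_secondDiff]
  exact norm_two_mul_one_sub_cos_mul_le f h ξ

lemma integral_secondDiff_mul_conj (f g : 𝓢(V, ℂ)) (h : V) :
    ∫ x, secondDiff f h x * (starRingEnd ℂ) (g x) =
      ∫ ξ, ((2 * (1 - cos (2 * π * ⟪h, ξ⟫)) : ℝ) : ℂ) * 𝓕 f ξ * (starRingEnd ℂ) (𝓕 g ξ) := by
  have := SchwartzMap.integral_inner_fourier_fourier g (secondDiff f h)
  simp only [RCLike.inner_apply, fourier_secondDiff] at this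
  exact this.symm

variable [Nontrivial V]

lemma integrable_levyKernel_mul_min {s : ℝ} (hs : s ∈ Set.Ioo (0 : ℝ) 1) (a b : V) :
    Integrable fun h : V ↦ |levyKernel s a b h| * min 1 (‖h‖ ^ 2) := by
  refine ((integrable_min_one_sq_mul_norm_rpow hs).const_mul (‖a‖ * ‖b‖)).mono' (by fun_prop)
    (.of_forall fun h ↦ ?_)
  have h0 : 0 ≤ min 1 (‖h‖ ^ 2) := by positivity
  rw [norm_mul, norm_of_nonneg h0, norm_eq_abs, abs_abs]
  refine (mul_le_mul_of_nonneg_right (abs_levyKernel_le s a b h) h0).trans_eq ?_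
  ring

lemma integrable_levyKernel_mul_secondDiff {s : ℝ} (hs : s ∈ Set.Ioo (0 : ℝ) 1) (a b : V)
    (f : 𝓢(V, ℂ)) (x : V) :
    Integrable fun h : V ↦ (levyKernel s a b h : ℂ) * secondDiff f h x := by
  have hf := f.continuous
  refine ((integrable_levyKernel_mul_min hs a b).const_mul
    (∫ ξ : V, 2 * (2 + 2 * π ^ 2 * ‖ξ‖ ^ 2) * ‖𝓕 f ξ‖)).mono'
    (by simp only [secondDiff_apply]; fun_prop) (.of_forall fun h ↦ ?_)
  rw [norm_mul, Complex.norm_real, norm_eq_abs]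
  refine (mul_le_mul_of_nonneg_left (norm_secondDiff_le f h x) (abs_nonneg _)).trans_eq ?_
  ring

lemma integrable_prod_levyKernel_mul_secondDiff {s : ℝ} (hs : s ∈ Set.Ioo (0 : ℝ) 1) (a b : V)
    (f g : 𝓢(V, ℂ)) :
    Integrable (Function.uncurry fun x h : V ↦
      (levyKernel s a b h : ℂ) * secondDiff f h x * (starRingEnd ℂ) (g x))
      (volume.prod volume) := by
  have hf := f.continuous
  have hg := g.continuous
  refine ((g.integrable (μ := volume)).norm.mul_prod
    ((integrable_levyKernel_mul_min hs a b).const_mul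
      (∫ ξ : V, 2 * (2 + 2 * π ^ 2 * ‖ξ‖ ^ 2) * ‖𝓕 f ξ‖))).mono'
    (Measurable.aestronglyMeasurable
      (by simp only [secondDiff_apply, Function.uncurry_def]; fun_prop))
    (.of_forall fun p ↦ ?_)
  simp only [Function.uncurry_def]
  rw [norm_mul, norm_mul, Complex.norm_real, norm_eq_abs, RCLike.norm_conj, mul_comm]
  refine mul_le_mul_of_nonneg_left ?_ (norm_nonneg _)
  refine (mul_le_mul_of_nonneg_left (norm_secondDiff_le f p.2 p.1) (abs_nonneg _)).trans_eq ?_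
  ring

lemma integrable_prod_levyKernel_mul_fourier {s : ℝ} (hs : s ∈ Set.Ioo (0 : ℝ) 1) (a b : V)
    (f g : 𝓢(V, ℂ)) :
    Integrable (Function.uncurry fun ξ h : V ↦
      (levyKernel s a b h : ℂ) * (((2 * (1 - cos (2 * π * ⟪h, ξ⟫)) : ℝ) : ℂ) * 𝓕 f ξ *
        (starRingEnd ℂ) (𝓕 g ξ))) (volume.prod volume) := by
  have hf := (𝓕 f).continuous
  have hg := (𝓕 g).continuous
  have hfg : Integrable fun ξ : V ↦ 2 * (2 + 2 * π ^ 2 * ‖ξ‖ ^ 2) * ‖𝓕 f ξ‖ * ‖𝓕 g ξ‖ :=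
    (integrable_quadratic_mul_norm_fourier f).mul_bdd (c := ∫ x, ‖g x‖) (by fun_prop)
      (.of_forall fun ξ ↦ by
        rw [norm_norm]
        exact VectorFourier.norm_fourierIntegral_le_integral_norm _ _ _ _ _)
  refine (hfg.mul_prod (integrable_levyKernel_mul_min hs a b)).mono'
    (Measurable.aestronglyMeasurable (by simp only [Function.uncurry_def]; fun_prop))
    (.of_forall fun p ↦ ?_)
  simp only [Function.uncurry_def]
  rw [norm_mul, norm_mul, Complex.norm_real, norm_eq_abs, RCLike.norm_conj]
  refine (mul_le_mul_of_nonneg_left (mul_le_mul_of_nonneg_right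
    (norm_two_mul_one_sub_cos_mul_le f p.2 p.1) (norm_nonneg (𝓕 g p.1)))
      (abs_nonneg _)).trans_eq ?_
  ring

/-- The integral operator with the Lévy kernel, acting on second-order differences. -/
def levyOperator (s : ℝ) (a b : V) (f : 𝓢(V, ℂ)) (x : V) : ℂ :=
  ∫ h : V, (levyKernel s a b h : ℂ) * secondDiff f h x

lemma integral_levyKernel_mul_fourier {s : ℝ} (hs : s ∈ Set.Ioo (0 : ℝ) 1) (a b : V)
    (z : ℂ) (ξ : V) :
    ∫ h : V, (levyKernel s a b h : ℂ) * (((2 * (1 - cos (2 * π * ⟪h, ξ⟫)) : ℝ) : ℂ) * z) =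
      levySymbol s a b ξ * z := by
  rw [← integral_levyKernel_mul_one_sub_cos hs, ← integral_complex_ofReal, ← integral_mul_const]
  congr 1 with h
  push_cast
  ring

lemma integrable_levyOperator_mul_conj {s : ℝ} (hs : s ∈ Set.Ioo (0 : ℝ) 1) (a b : V)
    (f g : 𝓢(V, ℂ)) :
    Integrable fun x : V ↦ levyOperator s a b f x * (starRingEnd ℂ) (g x) := by
  refine (integrable_prod_levyKernel_mul_secondDiff hs a b f g).integral_prod_left.congr
    (.of_forall fun x ↦ ?_)
  exact integral_mul_const ((starRingEnd ℂ) (g x)) _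

lemma integrable_levySymbol_mul_fourier {s : ℝ} (hs : s ∈ Set.Ioo (0 : ℝ) 1) (a b : V)
    (f g : 𝓢(V, ℂ)) :
    Integrable fun ξ : V ↦ (levySymbol s a b ξ : ℂ) * (𝓕 f ξ * (starRingEnd ℂ) (𝓕 g ξ)) := by
  refine (integrable_prod_levyKernel_mul_fourier hs a b f g).integral_prod_left.congr
    (.of_forall fun ξ ↦ ?_)
  simp only [Function.uncurry_apply_pair, mul_assoc]
  simp only [← mul_assoc (2 : ℝ)]
  exact integral_levyKernel_mul_fourier hs a b _ ξ

/-- The Fourier symbol of `levyOperator`, in the sense of quadratic forms. -/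
lemma integral_levyOperator_mul_conj {s : ℝ} (hs : s ∈ Set.Ioo (0 : ℝ) 1) (a b : V)
    (f g : 𝓢(V, ℂ)) :
    ∫ x, levyOperator s a b f x * (starRingEnd ℂ) (g x) =
      ∫ ξ, (levySymbol s a b ξ : ℂ) * (𝓕 f ξ * (starRingEnd ℂ) (𝓕 g ξ)) := by
  calc _ = ∫ x, ∫ h : V, (levyKernel s a b h : ℂ) * secondDiff f h x *
        (starRingEnd ℂ) (g x) := by
        congr 1 with x
        exact (integral_mul_const ((starRingEnd ℂ) (g x)) _).symm
    _ = ∫ h : V, (levyKernel s a b h : ℂ) * ∫ x, secondDiff f h x * (starRingEnd ℂ) (g x) := by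
        rw [integral_integral_swap (integrable_prod_levyKernel_mul_secondDiff hs a b f g)]
        congr 1 with h
        rw [← integral_const_mul]
        simp only [mul_assoc]
    _ = ∫ h : V, ∫ ξ, (levyKernel s a b h : ℂ) * (((2 * (1 - cos (2 * π * ⟪h, ξ⟫)) : ℝ) : ℂ) *
        𝓕 f ξ * (starRingEnd ℂ) (𝓕 g ξ)) := by
        congr 1 with h
        rw [integral_secondDiff_mul_conj, ← integral_const_mul]
    _ = _ := by
        rw [← integral_integral_swap (integrable_prod_levyKernel_mul_fourier hs a b f g)]
        congr 1 with ξ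
        rw [← integral_levyKernel_mul_fourier hs a b _ ξ]
        congr 1 with h
        ring

end SecondDifference

lemma integral_sum_mul_sum_add_mul_sum {ι α : Type*} [Fintype ι] [MeasurableSpace α]
    {m : Measure α} (A B : ℂ) {f g : ι → ι → α → ℂ} (hf : ∀ i j, Integrable (f i j) m)
    (hg : ∀ i j, Integrable (g i j) m) :
    ∫ x, ∑ i, (A * ∑ j, f i j x + B * ∑ j, g i j x) ∂m =
      ∑ i, (A * ∑ j, ∫ x, f i j x ∂m + B * ∑ j, ∫ x, g i j x ∂m) := by
  have hf' (i : ι) : Integrable (fun x ↦ A * ∑ j, f i j x) m :=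
    (integrable_finsetSum _ fun j _ ↦ hf i j).const_mul A
  have hg' (i : ι) : Integrable (fun x ↦ B * ∑ j, g i j x) m :=
    (integrable_finsetSum _ fun j _ ↦ hg i j).const_mul B
  rw [integral_finsetSum _ fun i _ ↦ by exact (hf' i).add (hg' i)]
  refine Finset.sum_congr rfl fun i _ ↦ ?_
  rw [integral_add (hf' i) (hg' i), integral_const_mul, integral_const_mul,
    integral_finsetSum _ fun j _ ↦ hf i j, integral_finsetSum _ fun j _ ↦ hg i j]

section Components

open scoped SchwartzMap

variable {d : ℕ}

local notation "E" => EuclideanSpace ℝ (Fin d)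

/-- The `j`-th component of a Schwartz vector field, as a complex-valued Schwartz function. -/
def componentSchwartz (j : Fin d) (u : 𝓢(E, E)) : 𝓢(E, ℂ) :=
  SchwartzMap.postcompCLM (𝕜 := ℝ) (Complex.ofRealCLM ∘L EuclideanSpace.proj j) u

@[simp]
lemma componentSchwartz_apply (j : Fin d) (u : 𝓢(E, E)) (x : E) :
    componentSchwartz j u x = ((u x j : ℝ) : ℂ) := rfl

lemma levyKernel_single (s : ℝ) (i j : Fin d) (h : E) :
    levyKernel s (EuclideanSpace.single i 1) (EuclideanSpace.single j 1) h =
      h i * h j / (‖h‖ ^ 2 * ‖h‖ ^ ((d : ℝ) + 2 * s)) := by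
  simp [levyKernel, EuclideanSpace.inner_single_right]

lemma sum_levyKernel_single {s : ℝ} (hs : 0 < s) (h : E) :
    ∑ l : Fin d, levyKernel s (EuclideanSpace.single l 1) (EuclideanSpace.single l 1) h =
      (‖h‖ ^ ((d : ℝ) + 2 * s))⁻¹ := by
  simp only [levyKernel_single, ← Finset.sum_div, ← sq, ← EuclideanSpace.real_norm_sq_eq]
  rcases eq_or_ne h 0 with rfl | hh
  · have : (d : ℝ) + 2 * s ≠ 0 := by positivity
    simp [zero_rpow this]
  · have hn : 0 < ‖h‖ := norm_pos_iff.2 hh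
    field_simp

lemma levySymbol_single (s : ℝ) (i j : Fin d) (ξ : E) :
    levySymbol s (EuclideanSpace.single i 1) (EuclideanSpace.single j 1) ξ =
      2 * (π ^ ((d : ℝ) / 2) * Real.Gamma (1 - s) / Real.Gamma ((d : ℝ) / 2 + s + 1)) *
        (π * ‖ξ‖) ^ (2 * s) * ((if i = j then 1 else 0) / (2 * s) + ξ i * ξ j / ‖ξ‖ ^ 2) := by
  simp [levySymbol, EuclideanSpace.inner_single_right, eq_comm]

lemma kappaConst_mul_levySymbol {s : ℝ} (hs : s ∈ Set.Ioo (0 : ℝ) 1) (i j : Fin d) (ξ : E) :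
    kappaConst d s / 2 *
        levySymbol s (EuclideanSpace.single i 1) (EuclideanSpace.single j 1) ξ =
      (2 * π * ‖ξ‖) ^ (2 * s) *
        ((if i = j then 1 else 0) + 2 * s * (ξ i * ξ j / ‖ξ‖ ^ 2)) := by
  have hs0 : 0 < s := hs.1
  have hG : Real.Gamma ((d : ℝ) / 2 + s) ≠ 0 := (Real.Gamma_pos_of_pos (by positivity)).ne'
  have hG' : Real.Gamma (1 - s) ≠ 0 := (Real.Gamma_pos_of_pos (by linarith [hs.2])).ne'
  have hπ : π ^ ((d : ℝ) / 2) ≠ 0 := by positivity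
  have hds : (d : ℝ) / 2 + s ≠ 0 := by positivity
  have hds' : (d : ℝ) + 2 * s ≠ 0 := by positivity
  rw [levySymbol_single, kappaConst, cConst, Real.Gamma_add_one hds, mul_assoc 2 π,
    mul_rpow zero_le_two (by positivity)]
  generalize ξ i * ξ j / ‖ξ‖ ^ 2 = r
  field_simp

lemma cConst_mul_sum_levySymbol {s : ℝ} (hs : s ∈ Set.Ioo (0 : ℝ) 1) (ξ : E) :
    cConst d s / 2 * ∑ l : Fin d,
        levySymbol s (EuclideanSpace.single l 1) (EuclideanSpace.single l 1) ξ =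
      (2 * π * ‖ξ‖) ^ (2 * s) := by
  have hs0 : 0 < s := hs.1
  have hds : (d : ℝ) + 2 * s ≠ 0 := by positivity
  rw [← mul_right_inj' hds, ← mul_assoc, ← mul_div_assoc, ← kappaConst, Finset.mul_sum]
  simp only [kappaConst_mul_levySymbol hs, if_true, ← Finset.mul_sum, Finset.sum_add_distrib,
    ← Finset.sum_div, ← sq, ← EuclideanSpace.real_norm_sq_eq]
  rcases eq_or_ne ξ 0 with rfl | hξ
  · have : 2 * s ≠ 0 := by positivity
    simp [zero_rpow this]
  · have hn : 0 < ‖ξ‖ := norm_pos_iff.2 hξ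
    simp [hn.ne', mul_comm]

lemma lameSymbolPowEntry_eq_levySymbol {s : ℝ} (hs : s ∈ Set.Ioo (0 : ℝ) 1) (μ lam : ℝ) (ξ : E)
    (i j : Fin d) :
    lameSymbolPowEntry d s μ lam ξ i j =
      ((2 * s + 1) * μ ^ s - (2 * μ + lam) ^ s) / (2 * s) * (cConst d s / 2) *
        (∑ l : Fin d, levySymbol s (EuclideanSpace.single l 1) (EuclideanSpace.single l 1) ξ) *
          (if i = j then 1 else 0) +
      ((2 * μ + lam) ^ s - μ ^ s) / (2 * s) * (kappaConst d s / 2) *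
        levySymbol s (EuclideanSpace.single j 1) (EuclideanSpace.single i 1) ξ := by
  have hs0 : 0 < s := hs.1
  rw [mul_assoc _ (cConst d s / 2), cConst_mul_sum_levySymbol hs, mul_assoc _ (kappaConst d s / 2),
    kappaConst_mul_levySymbol hs, lameSymbolPowEntry, mul_comm (ξ j)]
  simp only [eq_comm (a := j)]
  generalize ξ i * ξ j / ‖ξ‖ ^ 2 = r
  field_simp
  ring

variable [Nonempty (Fin d)]

lemma lameFrac_apply {s : ℝ} (hs : s ∈ Set.Ioo (0 : ℝ) 1) (μ lam : ℝ) (u : 𝓢(E, E)) (x : E)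
    (i : Fin d) :
    ((lameFrac d s μ lam u x i : ℝ) : ℂ) =
      ((((2 * s + 1) * μ ^ s - (2 * μ + lam) ^ s) / (2 * s) * (cConst d s / 2) : ℝ) : ℂ) *
        ∑ l : Fin d, levyOperator s (EuclideanSpace.single l 1) (EuclideanSpace.single l 1)
          (componentSchwartz i u) x +
      ((((2 * μ + lam) ^ s - μ ^ s) / (2 * s) * (kappaConst d s / 2) : ℝ) : ℂ) *
        ∑ j : Fin d, levyOperator s (EuclideanSpace.single j 1) (EuclideanSpace.single i 1)
          (componentSchwartz j u) x := by
  set F : E → E := fun h ↦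
    (‖h‖ ^ ((d : ℝ) + 2 * s))⁻¹ • ((2 : ℝ) • u x - u (x + h) - u (x - h)) with hF
  set G : E → E := fun h ↦ (⟪h, (2 : ℝ) • u x - u (x + h) - u (x - h)⟫ /
    (‖h‖ ^ 2 * ‖h‖ ^ ((d : ℝ) + 2 * s))) • h with hG
  have hF' (k : Fin d) (h : E) : ((F h k : ℝ) : ℂ) = ∑ l : Fin d,
      (levyKernel s (EuclideanSpace.single l 1) (EuclideanSpace.single l 1) h : ℂ) *
        secondDiff (componentSchwartz k u) h x := by
    rw [← Finset.sum_mul, ← Complex.ofReal_sum, sum_levyKernel_single hs.1]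
    simp [hF]
  have hG' (k : Fin d) (h : E) : ((G h k : ℝ) : ℂ) = ∑ j : Fin d,
      (levyKernel s (EuclideanSpace.single j 1) (EuclideanSpace.single k 1) h : ℂ) *
        secondDiff (componentSchwartz j u) h x := by
    simp only [hG, levyKernel_single, PiLp.smul_apply, PiLp.inner_apply, smul_eq_mul,
      Finset.sum_div, Finset.sum_mul, secondDiff_apply, componentSchwartz_apply]
    push_cast
    refine Finset.sum_congr rfl fun j _ ↦ ?_
    simp
    ring
  have hFi : Integrable F := by
    refine Integrable.of_eval_piLp fun k ↦ ?_
    have : Integrable fun h ↦ ((F h k : ℝ) : ℂ) := by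
      simp only [hF']
      exact integrable_finsetSum _ fun l _ ↦ integrable_levyKernel_mul_secondDiff hs _ _ _ _
    exact this.re
  have hGi : Integrable G := by
    refine Integrable.of_eval_piLp fun k ↦ ?_
    have : Integrable fun h ↦ ((G h k : ℝ) : ℂ) := by
      simp only [hG']
      exact integrable_finsetSum _ fun l _ ↦ integrable_levyKernel_mul_secondDiff hs _ _ _ _
    exact this.re
  have h1 : (((∫ h, F h) i : ℝ) : ℂ) = ∑ l : Fin d, levyOperator s (EuclideanSpace.single l 1)
      (EuclideanSpace.single l 1) (componentSchwartz i u) x := by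
    rw [eval_integral_piLp fun k ↦ hFi.eval_piLp k, ← integral_complex_ofReal]
    simp only [hF', levyOperator]
    exact integral_finsetSum _ fun l _ ↦ integrable_levyKernel_mul_secondDiff hs _ _ _ _
  have h2 : (((∫ h, G h) i : ℝ) : ℂ) = ∑ j : Fin d, levyOperator s (EuclideanSpace.single j 1)
      (EuclideanSpace.single i 1) (componentSchwartz j u) x := by
    rw [eval_integral_piLp fun k ↦ hGi.eval_piLp k, ← integral_complex_ofReal]
    simp only [hG', levyOperator]
    exact integral_finsetSum _ fun l _ ↦ integrable_levyKernel_mul_secondDiff hs _ _ _ _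
  rw [← h1, ← h2, lameFrac]
  simp only [PiLp.add_apply, PiLp.smul_apply, smul_eq_mul, Complex.ofReal_add, Complex.ofReal_mul,
    hF, hG]

end Components

/-- Parseval identity: `∫ ⟨M^s(ξ) û(ξ), v̂(ξ)⟩ dξ = ∫ ⟨𝕃^s u(x), v(x)⟩ dx`. -/
theorem lameFrac_fourier_symbol (d : ℕ) (hd : 2 ≤ d) (s : ℝ) (hs : s ∈ Set.Ioo (0 : ℝ) 1)
    (μ lam : ℝ) (hμ : 0 < μ) (hlam : 0 < 2 * μ + lam)
    (u v : SchwartzMap (EuclideanSpace ℝ (Fin d)) (EuclideanSpace ℝ (Fin d))) :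
    (∫ ξ : EuclideanSpace ℝ (Fin d),
      ∑ i : Fin d,
        (∑ j : Fin d, (lameSymbolPowEntry d s μ lam ξ i j : ℂ) *
            𝓕 (fun x : EuclideanSpace ℝ (Fin d) => ((u x j : ℝ) : ℂ)) ξ) *
          (starRingEnd ℂ) (𝓕 (fun x : EuclideanSpace ℝ (Fin d) => ((v x i : ℝ) : ℂ)) ξ)) =
    ((∫ x : EuclideanSpace ℝ (Fin d), ⟪lameFrac d s μ lam u x, v x⟫ : ℝ) : ℂ) := by
  have : Nonempty (Fin d) := ⟨⟨0, by omega⟩⟩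
  let e (i : Fin d) : EuclideanSpace ℝ (Fin d) := EuclideanSpace.single i 1
  have hu (w : SchwartzMap (EuclideanSpace ℝ (Fin d)) (EuclideanSpace ℝ (Fin d))) (j : Fin d) :
      𝓕 (fun x : EuclideanSpace ℝ (Fin d) => ((w x j : ℝ) : ℂ)) =
        (𝓕 (componentSchwartz j w) : SchwartzMap (EuclideanSpace ℝ (Fin d)) ℂ) := rfl
  set A := ((2 * s + 1) * μ ^ s - (2 * μ + lam) ^ s) / (2 * s) * (cConst d s / 2) with hA
  set B := ((2 * μ + lam) ^ s - μ ^ s) / (2 * s) * (kappaConst d s / 2) with hB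
  have hright (x : EuclideanSpace ℝ (Fin d)) :
      ((⟪lameFrac d s μ lam u x, v x⟫ : ℝ) : ℂ) = ∑ i : Fin d,
        ((A : ℂ) * ∑ l : Fin d, levyOperator s (e l) (e l) (componentSchwartz i u) x *
            (starRingEnd ℂ) (componentSchwartz i v x) +
          (B : ℂ) * ∑ j : Fin d, levyOperator s (e j) (e i) (componentSchwartz j u) x *
            (starRingEnd ℂ) (componentSchwartz i v x)) := by
    rw [PiLp.inner_apply, Complex.ofReal_sum]
    refine Finset.sum_congr rfl fun i _ ↦ ?_
    rw [RCLike.inner_apply, conj_trivial, mul_comm, Complex.ofReal_mul, lameFrac_apply hs,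
      componentSchwartz_apply, Complex.conj_ofReal, ← Finset.sum_mul, ← Finset.sum_mul]
    ring
  have hleft (ξ : EuclideanSpace ℝ (Fin d)) : ∑ i : Fin d,
        (∑ j : Fin d, (lameSymbolPowEntry d s μ lam ξ i j : ℂ) *
            𝓕 (componentSchwartz j u) ξ) * (starRingEnd ℂ) (𝓕 (componentSchwartz i v) ξ) =
      ∑ i : Fin d,
        ((A : ℂ) * ∑ l : Fin d, (levySymbol s (e l) (e l) ξ : ℂ) *
            (𝓕 (componentSchwartz i u) ξ * (starRingEnd ℂ) (𝓕 (componentSchwartz i v) ξ)) +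
          (B : ℂ) * ∑ j : Fin d, (levySymbol s (e j) (e i) ξ : ℂ) *
            (𝓕 (componentSchwartz j u) ξ * (starRingEnd ℂ) (𝓕 (componentSchwartz i v) ξ))) := by
    refine Finset.sum_congr rfl fun i _ ↦ ?_
    simp only [lameSymbolPowEntry_eq_levySymbol hs, ← hA, ← hB]
    simp only [Complex.ofReal_add, Complex.ofReal_mul,
      Complex.ofReal_sum, add_mul, Finset.sum_add_distrib, Finset.sum_mul, Finset.mul_sum]
    congr 1
    · rw [Finset.sum_eq_single i (by simp +contextual [eq_comm]) (by simp)]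
      simp [mul_assoc, e]
    · simp only [mul_assoc, e]
  simp only [hu, hleft]
  rw [← integral_complex_ofReal]
  simp only [hright]
  rw [integral_sum_mul_sum_add_mul_sum _ _
      (fun i l ↦ integrable_levySymbol_mul_fourier hs (e l) (e l) _ _)
      (fun i j ↦ integrable_levySymbol_mul_fourier hs (e j) (e i) _ _),
    integral_sum_mul_sum_add_mul_sum _ _
      (fun i l ↦ integrable_levyOperator_mul_conj hs (e l) (e l) _ _)
      (fun i j ↦ integrable_levyOperator_mul_conj hs (e j) (e i) _ _)]
  simp only [integral_levyOperator_mul_conj hs]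
end
end

section
/- Let d ≥ 2, s ∈ (0,1), μ > 0, 2μ + λ > 0, and let u : ℝ^d → ℝ^d be a Schwartz vector field. Then the scalar function g := div^s u is well defined by an absolutely convergent integral at every point, the integral defining ∇^s g(x) := k_{d,s} ∫_{ℝ^d} (g(y)−g(x)) (y−x)/|y−x|^{d+s+1} dy converges absolutely for every x, and for every x ∈ ℝ^d one has 𝕃^s u(x) = μ^s (−Δ)^s u(x) − ((2μ+λ)^s − μ^s) ∇^s(div^s u)(x), where (−Δ)^s u(x) := (c_{d,s}/2) ∫_{ℝ^d} (2u(x) − u(x+h) − u(x−h))/|h|^{d+2s} dh componentwise (the sign convention in which (−Δ)^s has Fourier multiplier (2π|ξ|)^{2s}). -/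
open Real MeasureTheory Filter
open scoped RealInnerProductSpace

noncomputable section

/-- `k_{d,s} = 2^s Γ((d+s+1)/2)/(π^{d/2} Γ((1−s)/2))`. -/
def kConst (d : ℕ) (s : ℝ) : ℝ :=
  (2 : ℝ) ^ s * Real.Gamma (((d : ℝ) + s + 1) / 2) /
    (π ^ ((d : ℝ) / 2) * Real.Gamma ((1 - s) / 2))

/-- The fractional Laplacian `(−Δ)^s u` (positive-multiplier convention),
in second-order-difference form, acting componentwise on a vector field. -/
def fracLap (d : ℕ) (s : ℝ)
    (u : SchwartzMap (EuclideanSpace ℝ (Fin d)) (EuclideanSpace ℝ (Fin d)))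
    (x : EuclideanSpace ℝ (Fin d)) : EuclideanSpace ℝ (Fin d) :=
  (cConst d s / 2) •
    ∫ h : EuclideanSpace ℝ (Fin d),
      (‖h‖ ^ ((d : ℝ) + 2 * s))⁻¹ • ((2 : ℝ) • u x - u (x + h) - u (x - h))

/-- The fractional divergence `div^s u`. -/
def fracDiv (d : ℕ) (s : ℝ)
    (u : SchwartzMap (EuclideanSpace ℝ (Fin d)) (EuclideanSpace ℝ (Fin d)))
    (x : EuclideanSpace ℝ (Fin d)) : ℝ :=
  kConst d s *
    ∫ y : EuclideanSpace ℝ (Fin d), ⟪u y - u x, y - x⟫ / ‖y - x‖ ^ ((d : ℝ) + s + 1)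

/-- The fractional gradient `∇^s g` of a scalar function. -/
def fracGrad (d : ℕ) (s : ℝ) (g : EuclideanSpace ℝ (Fin d) → ℝ)
    (x : EuclideanSpace ℝ (Fin d)) : EuclideanSpace ℝ (Fin d) :=
  kConst d s •
    ∫ y : EuclideanSpace ℝ (Fin d),
      ((g y - g x) / ‖y - x‖ ^ ((d : ℝ) + s + 1)) • (y - x)

section Kernels

variable {V : Type*} [NormedAddCommGroup V] [InnerProductSpace ℝ V] [FiniteDimensional ℝ V]
  [MeasurableSpace V] [BorelSpace V]

local notation "dim" => Module.finrank ℝ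

lemma integral_cos_mul_gaussian {t : ℝ} (ht : 0 < t) (ξ : V) :
    ∫ h : V, cos ⟪h, ξ⟫ * rexp (-t * ‖h‖ ^ 2) =
      (π / t) ^ ((dim V : ℝ) / 2) * rexp (-(‖ξ‖ ^ 2 / 4) / t) := by
  have h1 := GaussianFourier.integral_cexp_neg_mul_sq_norm_add (V := V) (b := (t : ℂ))
    (by simpa using ht) Complex.I ξ
  have h2 := GaussianFourier.integrable_cexp_neg_mul_sq_norm_add (V := V) (b := (t : ℂ))
    (by simpa using ht) Complex.I ξ
  have h3 := congrArg Complex.re h1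
  rw [← RCLike.re_eq_complex_re, ← integral_re h2] at h3
  convert h3 using 1
  · refine integral_congr_ae (ae_of_all _ fun h => ?_)
    simp only [RCLike.re_eq_complex_re]
    rw [Complex.exp_re]
    have e1 : (-(t : ℂ) * (‖h‖ : ℂ) ^ 2 + Complex.I * (⟪ξ, h⟫ : ℝ)).re = -t * ‖h‖ ^ 2 := by
      simp [← Complex.ofReal_pow]
    have e2 : (-(t : ℂ) * (‖h‖ : ℂ) ^ 2 + Complex.I * (⟪ξ, h⟫ : ℝ)).im = ⟪h, ξ⟫ := by
      simp [← Complex.ofReal_pow, real_inner_comm]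
    rw [e1, e2, mul_comm]
  · have : ((π : ℂ) / (t : ℂ)) ^ ((dim V : ℂ) / 2) *
        Complex.exp (Complex.I ^ 2 * (‖ξ‖ : ℂ) ^ 2 / (4 * t)) =
        (((π / t) ^ ((dim V : ℝ) / 2) * rexp (-(‖ξ‖ ^ 2 / 4) / t) : ℝ) : ℂ) := by
      rw [Complex.I_sq]
      push_cast
      rw [Complex.ofReal_cpow (by positivity)]
      push_cast
      congr 2
      field_simp
    rw [this, RCLike.re_eq_complex_re, Complex.ofReal_re]

/-- Gaussian integration by parts. -/
lemma integral_mul_inner_mul_gaussian {t : ℝ} (ht : 0 < t) (e : V) {f : V → ℝ}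
    (hf : Differentiable ℝ f)
    (h0 : Integrable fun h : V => f h * rexp (-t * ‖h‖ ^ 2))
    (h1 : Integrable fun h : V => f h * ⟪h, e⟫ * rexp (-t * ‖h‖ ^ 2))
    (h2 : Integrable fun h : V => fderiv ℝ f h e * rexp (-t * ‖h‖ ^ 2)) :
    ∫ h : V, f h * ⟪h, e⟫ * rexp (-t * ‖h‖ ^ 2) =
      1 / (2 * t) * ∫ h : V, fderiv ℝ f h e * rexp (-t * ‖h‖ ^ 2) := by
  have hg : ∀ h : V, HasFDerivAt (fun h : V => rexp (-t * ‖h‖ ^ 2))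
      (rexp (-t * ‖h‖ ^ 2) • (-t) • 2 • (innerSL ℝ h)) h := fun h =>
    (((hasStrictFDerivAt_norm_sq h).hasFDerivAt.const_mul (-t))).exp
  have hg' : ∀ h : V, f h * fderiv ℝ (fun h : V => rexp (-t * ‖h‖ ^ 2)) h e =
      (-(2 * t)) * (f h * ⟪h, e⟫ * rexp (-t * ‖h‖ ^ 2)) := fun h => by
    rw [(hg h).fderiv]
    simp
    ring
  have key := integral_mul_fderiv_eq_neg_fderiv_mul_of_integrable (μ := (volume : Measure V))
    (f := f) (g := fun h : V => rexp (-t * ‖h‖ ^ 2)) (v := e) h2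
    (by simp_rw [hg']; exact h1.const_mul _) h0 (fun h _ => hf h)
    (fun h _ => (hg h).differentiableAt)
  simp_rw [hg', integral_const_mul] at key
  rw [eq_comm, one_div, inv_mul_eq_iff_eq_mul₀ (by positivity)]
  linarith

variable [Nontrivial V]

lemma integrable_min_one_mul_norm_rpow_neg {α : ℝ} (hα : 0 < α) {m : ℕ}
    (hm : α < m) :
    Integrable fun h : V => min 1 (‖h‖ ^ m) * ‖h‖ ^ (-((dim V : ℝ) + α)) := by
  have hd : 1 ≤ dim V := Module.finrank_pos
  rw [integrable_fun_norm_addHaar (volume : Measure V)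
    (f := fun y => min 1 (y ^ m) * y ^ (-((dim V : ℝ) + α)))]
  have hpow : ∀ y : ℝ, 0 < y → y ^ (dim V - 1) * y ^ (-((dim V : ℝ) + α)) = y ^ (-1 - α) := by
    intro y hy
    rw [← rpow_natCast, ← rpow_add hy, Nat.cast_sub hd]
    congr 1; push_cast; ring
  rw [← Set.Ioc_union_Ioi_eq_Ioi zero_le_one, integrableOn_union]
  constructor
  · have h1 : IntegrableOn (fun y : ℝ => y ^ ((m : ℝ) - 1 - α)) (Set.Ioc 0 1) := by
      rw [← intervalIntegrable_iff_integrableOn_Ioc_of_le zero_le_one]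
      exact intervalIntegral.intervalIntegrable_rpow' (by linarith)
    refine h1.congr_fun (fun y hy => ?_) measurableSet_Ioc
    have hle : y ^ m ≤ 1 := pow_le_one₀ hy.1.le hy.2
    simp only [smul_eq_mul]
    rw [min_eq_right hle, mul_left_comm, hpow y hy.1, ← rpow_natCast, ← rpow_add hy.1]
    congr 1; ring
  · have h1 : IntegrableOn (fun y : ℝ => y ^ (-1 - α)) (Set.Ioi 1) :=
      integrableOn_Ioi_rpow_of_lt (by linarith) one_pos
    refine h1.congr_fun (fun y hy => ?_) measurableSet_Ioi
    have hy' : (1 : ℝ) < y := hy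
    simp only [smul_eq_mul]
    rw [min_eq_left (one_le_pow₀ hy'.le), one_mul, hpow y (by linarith)]

lemma integrable_norm_pow_mul_gaussian {t : ℝ} (ht : 0 < t) (k : ℕ) :
    Integrable fun h : V => ‖h‖ ^ k * rexp (-t * ‖h‖ ^ 2) := by
  rw [integrable_fun_norm_addHaar (volume : Measure V)
    (f := fun y => y ^ k * rexp (-t * y ^ 2))]
  have h1 := integrableOn_rpow_mul_exp_neg_mul_sq ht (s := ((dim V - 1 + k : ℕ) : ℝ))
    (by have := Nat.cast_nonneg (α := ℝ) (dim V - 1 + k); linarith)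
  refine h1.congr_fun (fun y hy => ?_) measurableSet_Ioi
  simp only [smul_eq_mul, rpow_natCast, pow_add, mul_assoc]

lemma integrable_mul_gaussian {t : ℝ} (ht : 0 < t) {f : V → ℝ} (hf : AEStronglyMeasurable f)
    {C : ℝ} {k : ℕ} (hC : ∀ h, |f h| ≤ C * ‖h‖ ^ k) :
    Integrable fun h : V => f h * rexp (-t * ‖h‖ ^ 2) := by
  refine ((integrable_norm_pow_mul_gaussian (V := V) ht k).const_mul C).mono'
    (hf.mul (by fun_prop)) (ae_of_all _ fun h => ?_)
  rw [norm_mul, norm_eq_abs, norm_of_nonneg (exp_pos _).le, ← mul_assoc]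
  gcongr
  exact hC h

lemma integral_sin_mul_inner_mul_gaussian {t : ℝ} (ht : 0 < t) (ξ e : V) :
    ∫ h : V, sin ⟪h, ξ⟫ * ⟪h, e⟫ * rexp (-t * ‖h‖ ^ 2) =
      1 / (2 * t) * (⟪ξ, e⟫ * ((π / t) ^ ((dim V : ℝ) / 2) * rexp (-(‖ξ‖ ^ 2 / 4) / t))) := by
  have hd : ∀ h : V, HasFDerivAt (fun h : V => sin ⟪h, ξ⟫)
      (cos ⟪h, ξ⟫ • ((innerSL ℝ).flip ξ)) h := fun h =>
    (((innerSL ℝ).flip ξ).hasFDerivAt (x := h)).sin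
  have hd' : ∀ h : V, fderiv ℝ (fun h : V => sin ⟪h, ξ⟫) h e = ⟪ξ, e⟫ * cos ⟪h, ξ⟫ :=
    fun h => by rw [(hd h).fderiv]; simp [real_inner_comm, innerSL_apply_apply ℝ, mul_comm]
  rw [integral_mul_inner_mul_gaussian ht e (fun h => (hd h).differentiableAt)]
  · simp_rw [hd', mul_assoc]
    rw [integral_const_mul, integral_cos_mul_gaussian ht]
  · exact integrable_mul_gaussian ht (by fun_prop) (C := 1) (k := 0)
      (fun h => by simpa using abs_sin_le_one _)
  · refine integrable_mul_gaussian ht (by fun_prop) (C := ‖e‖) (k := 1) (fun h => ?_)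
    rw [abs_mul, pow_one, mul_comm ‖e‖]
    exact (mul_le_mul (abs_sin_le_one _) (abs_real_inner_le_norm _ _) (abs_nonneg _)
      zero_le_one).trans_eq (one_mul _)
  · simp_rw [hd']
    refine integrable_mul_gaussian ht (by fun_prop) (C := |⟪ξ, e⟫|) (k := 0) (fun h => ?_)
    rw [abs_mul, pow_zero]
    gcongr
    exact abs_cos_le_one _

lemma integral_one_sub_cos_mul_inner_mul_inner_mul_gaussian {t : ℝ} (ht : 0 < t) (ξ p e : V) :
    ∫ h : V, (1 - cos ⟪h, ξ⟫) * ⟪h, p⟫ * ⟪h, e⟫ * rexp (-t * ‖h‖ ^ 2) =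
      1 / (2 * t) * (⟪p, e⟫ * ∫ h : V, (1 - cos ⟪h, ξ⟫) * rexp (-t * ‖h‖ ^ 2)) +
      (1 / (2 * t)) ^ 2 * (⟪ξ, p⟫ * ⟪ξ, e⟫ *
        ((π / t) ^ ((dim V : ℝ) / 2) * rexp (-(‖ξ‖ ^ 2 / 4) / t))) := by
  have hd : ∀ h : V, HasFDerivAt (fun h : V => (1 - cos ⟪h, ξ⟫) * ⟪h, p⟫)
      ((1 - cos ⟪h, ξ⟫) • ((innerSL ℝ).flip p) +
        ⟪h, p⟫ • -(-sin ⟪h, ξ⟫ • ((innerSL ℝ).flip ξ))) h := fun h =>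
    ((((innerSL ℝ).flip ξ).hasFDerivAt (x := h)).cos.const_sub 1).mul
      (((innerSL ℝ).flip p).hasFDerivAt (x := h))
  have hd' : ∀ h : V, fderiv ℝ (fun h : V => (1 - cos ⟪h, ξ⟫) * ⟪h, p⟫) h e =
      ⟪p, e⟫ * (1 - cos ⟪h, ξ⟫) + ⟪ξ, e⟫ * (sin ⟪h, ξ⟫ * ⟪h, p⟫) :=
    fun h => by rw [(hd h).fderiv]; simp [real_inner_comm, innerSL_apply_apply ℝ]; ring
  have hcos : ∀ h : V, |1 - cos ⟪h, ξ⟫| ≤ 2 := fun h => by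
    rw [abs_le]; constructor <;> linarith [neg_one_le_cos ⟪h, ξ⟫, cos_le_one ⟪h, ξ⟫]
  have i1 : Integrable fun h : V => (1 - cos ⟪h, ξ⟫) * rexp (-t * ‖h‖ ^ 2) :=
    integrable_mul_gaussian ht (by fun_prop) (C := 2) (k := 0) (fun h => by simpa using hcos h)
  have i2 : Integrable fun h : V => (sin ⟪h, ξ⟫ * ⟪h, p⟫) * rexp (-t * ‖h‖ ^ 2) := by
    refine integrable_mul_gaussian ht (by fun_prop) (C := ‖p‖) (k := 1) (fun h => ?_)
    rw [abs_mul, pow_one, mul_comm ‖p‖]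
    exact (mul_le_mul (abs_sin_le_one _) (abs_real_inner_le_norm _ _) (abs_nonneg _)
      zero_le_one).trans_eq (one_mul _)
  rw [integral_mul_inner_mul_gaussian ht e (fun h => (hd h).differentiableAt)]
  · simp_rw [hd', add_mul, mul_assoc]
    simp_rw [mul_assoc] at i2
    rw [integral_add (i1.const_mul _) (i2.const_mul _), integral_const_mul, integral_const_mul]
    have := integral_sin_mul_inner_mul_gaussian ht ξ p
    simp_rw [mul_assoc] at this
    rw [this]
    ring
  · refine integrable_mul_gaussian ht (by fun_prop) (C := 2 * ‖p‖) (k := 1) (fun h => ?_)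
    rw [abs_mul, pow_one, mul_assoc, mul_comm ‖p‖]
    exact mul_le_mul (hcos h) (abs_real_inner_le_norm _ _) (abs_nonneg _) zero_le_two
  · refine integrable_mul_gaussian ht (by fun_prop) (C := 2 * ‖p‖ * ‖e‖) (k := 2) (fun h => ?_)
    rw [abs_mul, abs_mul]
    calc _ ≤ 2 * (‖h‖ * ‖p‖) * (‖h‖ * ‖e‖) := by
          gcongr
          exacts [hcos h, abs_real_inner_le_norm _ _, abs_real_inner_le_norm _ _]
      _ = _ := by ring
  · simp_rw [hd', add_mul, mul_assoc]
    simp_rw [mul_assoc] at i2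
    exact (i1.const_mul _).add (i2.const_mul _)

lemma integral_rpow_mul_exp_neg_div_Ioi {a γ : ℝ} (ha : 0 < a) (hγ : 0 < γ) :
    ∫ t in Set.Ioi (0 : ℝ), t ^ (-γ - 1) * rexp (-a / t) = a ^ (-γ) * Real.Gamma γ := by
  have h1 := integral_comp_rpow_Ioi (fun y : ℝ => y ^ (γ - 1) * rexp (-(a * y)))
    (p := -1) (by norm_num)
  rw [integral_rpow_mul_exp_neg_mul_Ioi hγ ha, one_div, inv_rpow ha.le, ← rpow_neg ha.le] at h1
  rw [← h1]
  refine setIntegral_congr_fun measurableSet_Ioi fun t ht => ?_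
  have ht' : (0 : ℝ) < t := ht
  simp only [abs_neg, abs_one, one_mul, smul_eq_mul]
  rw [← mul_assoc, ← rpow_mul ht'.le, ← rpow_add ht', rpow_neg_one]
  congr 2 <;> ring_nf

/-- Subordination of a Riesz kernel to Gaussian kernels. -/
lemma integral_mul_norm_rpow_eq_integral_gaussian {β : ℝ} (hβ : 0 < β) {f : V → ℝ}
    (hf : AEStronglyMeasurable f)
    (hi : Integrable fun h : V => f h * ‖h‖ ^ (-(2 * β))) :
    IntegrableOn (fun t : ℝ => t ^ (β - 1) * ∫ h : V, f h * rexp (-t * ‖h‖ ^ 2)) (Set.Ioi 0) ∧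
    ∫ h : V, f h * ‖h‖ ^ (-(2 * β)) =
      (Real.Gamma β)⁻¹ *
        ∫ t in Set.Ioi (0 : ℝ), t ^ (β - 1) * ∫ h : V, f h * rexp (-t * ‖h‖ ^ 2) := by
  have hΓ := Gamma_pos_of_pos hβ
  have hne : ∀ᵐ h : V, h ≠ 0 := by
    simp [ae_iff, measure_singleton]
  have hrep : ∀ h : V, h ≠ 0 → ∫ t in Set.Ioi (0 : ℝ), t ^ (β - 1) * rexp (-t * ‖h‖ ^ 2) =
      ‖h‖ ^ (-(2 * β)) * Real.Gamma β := by
    intro h hh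
    have hp : 0 < ‖h‖ := norm_pos_iff.2 hh
    have := integral_rpow_mul_exp_neg_mul_Ioi hβ (pow_pos hp 2)
    rw [one_div, inv_rpow (by positivity), ← rpow_natCast ‖h‖ 2, ← rpow_mul hp.le,
      ← rpow_neg hp.le] at this
    push_cast at this
    rw [← this]
    refine setIntegral_congr_fun measurableSet_Ioi fun t _ => ?_
    simp only [rpow_two]
    ring_nf
  have h_int : ∀ h : V, h ≠ 0 →
      IntegrableOn (fun t : ℝ => t ^ (β - 1) * rexp (-t * ‖h‖ ^ 2)) (Set.Ioi 0) := by
    intro h hh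
    by_contra hcon
    have := hrep h hh
    rw [integral_undef hcon] at this
    have hp : 0 < ‖h‖ := norm_pos_iff.2 hh
    have : 0 < ‖h‖ ^ (-(2 * β)) * Real.Gamma β := by positivity
    linarith
  set F : V × ℝ → ℝ := fun z => f z.1 * (z.2 ^ (β - 1) * rexp (-z.2 * ‖z.1‖ ^ 2)) with hF
  have hFm : AEStronglyMeasurable F
      ((volume : Measure V).prod (volume.restrict (Set.Ioi (0 : ℝ)))) := by
    refine (hf.comp_fst).mul (Measurable.aestronglyMeasurable ?_)
    fun_prop
  have hFi : Integrable F ((volume : Measure V).prod (volume.restrict (Set.Ioi (0 : ℝ)))) := by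
    rw [integrable_prod_iff hFm]
    constructor
    · filter_upwards [hne] with h hh
      exact (h_int h hh).const_mul (f h)
    · refine (hi.norm.mul_const (Real.Gamma β)).congr ?_
      filter_upwards [hne] with h hh
      have : ∫ t in Set.Ioi (0 : ℝ), ‖F (h, t)‖ =
          ∫ t in Set.Ioi (0 : ℝ), ‖f h‖ * (t ^ (β - 1) * rexp (-t * ‖h‖ ^ 2)) := by
        refine setIntegral_congr_fun measurableSet_Ioi fun t ht => ?_
        have ht' : (0 : ℝ) < t := ht
        simp only [hF]
        rw [norm_mul, norm_of_nonneg (mul_nonneg (rpow_nonneg ht'.le _) (exp_pos _).le)]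
      rw [this, integral_const_mul, hrep h hh, norm_mul,
        norm_of_nonneg (rpow_nonneg (norm_nonneg h) _)]
      ring
  have hpull : ∀ t : ℝ, ∫ h : V, F (h, t) =
      t ^ (β - 1) * ∫ h : V, f h * rexp (-t * ‖h‖ ^ 2) := by
    intro t
    rw [← integral_const_mul]
    refine integral_congr_ae (ae_of_all _ fun h => ?_)
    simp only [hF]
    ring
  constructor
  · have := hFi.integral_prod_right
    simp_rw [hpull] at this
    exact this
  · have := integral_integral_swap (f := fun h t => F (h, t)) hFi
    simp_rw [hpull] at this
    rw [← this, eq_inv_mul_iff_mul_eq₀ hΓ.ne', ← integral_const_mul]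
    refine integral_congr_ae ?_
    filter_upwards [hne] with h hh
    simp only [hF]
    rw [integral_const_mul, hrep h hh]
    ring

lemma abs_sin_inner_le {V : Type*} [NormedAddCommGroup V] [InnerProductSpace ℝ V] (h ξ : V) :
    |sin ⟪h, ξ⟫| ≤ min 1 ‖h‖ * (1 + ‖ξ‖) := by
  have h0 := norm_nonneg h
  have h1 := norm_nonneg ξ
  rcases le_total 1 ‖h‖ with hh | hh
  · rw [min_eq_left hh]
    linarith [abs_sin_le_one ⟪h, ξ⟫]
  · rw [min_eq_right hh]
    have h2 : |sin ⟪h, ξ⟫| ≤ |⟪h, ξ⟫| := by simpa using abs_sin_sub_sin_le ⟪h, ξ⟫ 0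
    nlinarith [abs_real_inner_le_norm h ξ]

lemma abs_one_sub_cos_inner_le {V : Type*} [NormedAddCommGroup V] [InnerProductSpace ℝ V]
    (h ξ : V) :
    |1 - cos ⟪h, ξ⟫| ≤ 2 * (min 1 (‖h‖ ^ 2) * (1 + ‖ξ‖) ^ 2) := by
  have h0 := norm_nonneg h
  have h1 := norm_nonneg ξ
  rw [abs_of_nonneg (by linarith [cos_le_one ⟪h, ξ⟫])]
  rcases le_total 1 (‖h‖ ^ 2) with hh | hh
  · rw [min_eq_left hh]
    nlinarith [neg_one_le_cos ⟪h, ξ⟫]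
  · rw [min_eq_right hh]
    have h2 : ⟪h, ξ⟫ ^ 2 ≤ (‖h‖ * ‖ξ‖) ^ 2 := sq_le_sq' (by
      linarith [neg_abs_le ⟪h, ξ⟫, abs_real_inner_le_norm h ξ]) (real_inner_le_norm h ξ)
    have h3 : (‖h‖ * ‖ξ‖) ^ 2 ≤ ‖h‖ ^ 2 * (1 + ‖ξ‖) ^ 2 := by
      rw [mul_pow]; gcongr; linarith
    nlinarith [one_sub_sq_div_two_le_cos (x := ⟪h, ξ⟫), sq_nonneg ⟪h, ξ⟫]

lemma mul_rpow_neg_add_one {x p : ℝ} (hx : 0 ≤ x) (hp : 0 < p) :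
    x * x ^ (-(p + 1)) = x ^ (-p) := by
  rw [← rpow_one_add' hx (by linarith)]
  congr 1; ring

lemma sq_mul_rpow_neg_add_two {x p : ℝ} (hx : 0 ≤ x) (hp : 0 < p) :
    x ^ 2 * x ^ (-(p + 2)) = x ^ (-p) := by
  rw [← rpow_two, ← rpow_add' hx (by linarith)]
  congr 1; ring

/-- The Fourier multiplier of the fractional gradient. -/
lemma kConst_mul_integral_sin_mul_inner {s : ℝ} (hs : s ∈ Set.Ioo (0 : ℝ) 1) (ξ e : V) :
    kConst (dim V) s * ∫ h : V, sin ⟪h, ξ⟫ * ⟪h, e⟫ * ‖h‖ ^ (-((dim V : ℝ) + s + 1)) =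
      ‖ξ‖ ^ (s - 1) * ⟪ξ, e⟫ := by
  obtain ⟨hs0, hs1⟩ := hs
  have hn : (0 : ℝ) < dim V := by exact_mod_cast Module.finrank_pos (R := ℝ) (M := V)
  rcases eq_or_ne ξ 0 with rfl | hξ
  · simp
  have hξ' : 0 < ‖ξ‖ := norm_pos_iff.2 hξ
  set β : ℝ := ((dim V : ℝ) + s + 1) / 2 with hβ
  have hβ2 : (dim V : ℝ) + s + 1 = 2 * β := by rw [hβ]; ring
  have hβ0 : 0 < β := by positivity
  have hi : Integrable fun h : V => (sin ⟪h, ξ⟫ * ⟪h, e⟫) * ‖h‖ ^ (-(2 * β)) := by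
    refine (((integrable_min_one_mul_norm_rpow_neg (V := V) hs0 (m := 1)
      (by simpa using hs1)).const_mul ((1 + ‖ξ‖) * ‖e‖))).mono' (by fun_prop)
      (ae_of_all _ fun h => ?_)
    rw [← hβ2, norm_mul, norm_mul, norm_of_nonneg (rpow_nonneg (norm_nonneg h) _),
      ← mul_rpow_neg_add_one (p := (dim V : ℝ) + s) (norm_nonneg h) (by linarith), pow_one]
    calc _ ≤ (min 1 ‖h‖ * (1 + ‖ξ‖)) * (‖h‖ * ‖e‖) * ‖h‖ ^ (-((dim V : ℝ) + s + 1)) := by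
          gcongr
          exacts [abs_sin_inner_le h ξ, abs_real_inner_le_norm h e]
      _ = _ := by ring
  obtain ⟨-, key⟩ := integral_mul_norm_rpow_eq_integral_gaussian hβ0 (by fun_prop) hi
  have hT : ∫ t in Set.Ioi (0 : ℝ),
      t ^ (β - 1) * ∫ h : V, (sin ⟪h, ξ⟫ * ⟪h, e⟫) * rexp (-t * ‖h‖ ^ 2) =
      ⟪ξ, e⟫ / 2 * π ^ ((dim V : ℝ) / 2) *
        ((‖ξ‖ ^ 2 / 4) ^ (-((1 - s) / 2)) * Real.Gamma ((1 - s) / 2)) := by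
    rw [← integral_rpow_mul_exp_neg_div_Ioi (by positivity) (by linarith), ← integral_const_mul]
    refine setIntegral_congr_fun measurableSet_Ioi fun t ht => ?_
    have ht' : (0 : ℝ) < t := ht
    rw [integral_sin_mul_inner_mul_gaussian ht', div_rpow pi_pos.le ht'.le]
    have : t ^ (-((1 - s) / 2) - 1) = t ^ (β - 1) * t⁻¹ * (t ^ ((dim V : ℝ) / 2))⁻¹ := by
      rw [← rpow_neg_one, ← rpow_neg ht'.le, ← rpow_add ht', ← rpow_add ht']
      congr 1; rw [hβ]; ring
    rw [this]
    field_simp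
  rw [hβ2, key, hT]
  have hΓ1 := Gamma_pos_of_pos hβ0
  have hΓ2 : 0 < Real.Gamma ((1 - s) / 2) := Gamma_pos_of_pos (by linarith)
  have h4 : (‖ξ‖ ^ 2 / 4) ^ (-((1 - s) / 2)) = ‖ξ‖ ^ (s - 1) * 2 / (2 : ℝ) ^ s := by
    have : ‖ξ‖ ^ 2 / 4 = (‖ξ‖ / 2) ^ (2 : ℝ) := by rw [rpow_two]; ring
    rw [this, ← rpow_mul (by positivity), show (2 : ℝ) * -((1 - s) / 2) = s - 1 by ring,
      div_rpow hξ'.le zero_le_two, rpow_sub_one two_ne_zero s]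
    field_simp
  rw [h4, kConst, ← hβ]
  field_simp

/-- The Fourier multiplier of the difference of the two singular integrals in the
fractional Lamé–Navier operator. -/
lemma integral_one_sub_cos_mul_kernel {s : ℝ} (hs : s ∈ Set.Ioo (0 : ℝ) 1) (ξ p e : V) :
    ∫ h : V, (1 - cos ⟪h, ξ⟫) *
      (kappaConst (dim V) s * (⟪h, p⟫ * ⟪h, e⟫ * ‖h‖ ^ (-((dim V : ℝ) + 2 * s + 2))) -
        cConst (dim V) s * (⟪p, e⟫ * ‖h‖ ^ (-((dim V : ℝ) + 2 * s)))) =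
      2 * s * (‖ξ‖ ^ (2 * s - 2) * ⟪ξ, p⟫ * ⟪ξ, e⟫) := by
  obtain ⟨hs0, hs1⟩ := hs
  have hn : (0 : ℝ) < dim V := by exact_mod_cast Module.finrank_pos (R := ℝ) (M := V)
  rcases eq_or_ne ξ 0 with rfl | hξ
  · simp
  have hξ' : 0 < ‖ξ‖ := norm_pos_iff.2 hξ
  set β : ℝ := (dim V : ℝ) / 2 + s with hβ
  have hβ2 : (dim V : ℝ) + 2 * s = 2 * β := by rw [hβ]; ring
  have hβ3 : 2 * β + 2 = 2 * (β + 1) := by ring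
  have hβ0 : 0 < β := by positivity
  have hm := integrable_min_one_mul_norm_rpow_neg (V := V) (α := 2 * s) (by linarith) (m := 2)
    (by push_cast; linarith)
  rw [hβ2] at hm
  have i0 : Integrable fun h : V => (1 - cos ⟪h, ξ⟫) * ‖h‖ ^ (-(2 * β)) := by
    refine (hm.const_mul (2 * (1 + ‖ξ‖) ^ 2)).mono' (by fun_prop) (ae_of_all _ fun h => ?_)
    rw [norm_mul, norm_of_nonneg (rpow_nonneg (norm_nonneg h) _)]
    calc _ ≤ 2 * (min 1 (‖h‖ ^ 2) * (1 + ‖ξ‖) ^ 2) * ‖h‖ ^ (-(2 * β)) := by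
          gcongr
          exact abs_one_sub_cos_inner_le h ξ
      _ = _ := by ring
  have i1 : Integrable fun h : V =>
      ((1 - cos ⟪h, ξ⟫) * ⟪h, p⟫ * ⟪h, e⟫) * ‖h‖ ^ (-(2 * (β + 1))) := by
    refine (hm.const_mul (2 * (1 + ‖ξ‖) ^ 2 * ‖p‖ * ‖e‖)).mono' (by fun_prop)
      (ae_of_all _ fun h => ?_)
    rw [← hβ3, norm_mul, norm_mul, norm_mul, norm_of_nonneg (rpow_nonneg (norm_nonneg h) _),
      ← sq_mul_rpow_neg_add_two (p := 2 * β) (norm_nonneg h) (by linarith)]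
    calc _ ≤ 2 * (min 1 (‖h‖ ^ 2) * (1 + ‖ξ‖) ^ 2) * (‖h‖ * ‖p‖) * (‖h‖ * ‖e‖) *
            ‖h‖ ^ (-(2 * β + 2)) := by
          gcongr
          exacts [abs_one_sub_cos_inner_le h ξ, abs_real_inner_le_norm h p,
            abs_real_inner_le_norm h e]
      _ = _ := by ring
  obtain ⟨t0, key0⟩ := integral_mul_norm_rpow_eq_integral_gaussian hβ0 (by fun_prop) i0
  obtain ⟨t1, key1⟩ := integral_mul_norm_rpow_eq_integral_gaussian (by linarith) (by fun_prop) i1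
  have hT : (∫ t in Set.Ioi (0 : ℝ), t ^ (β + 1 - 1) *
        ∫ h : V, (1 - cos ⟪h, ξ⟫) * ⟪h, p⟫ * ⟪h, e⟫ * rexp (-t * ‖h‖ ^ 2)) -
      ⟪p, e⟫ / 2 * (∫ t in Set.Ioi (0 : ℝ), t ^ (β - 1) *
        ∫ h : V, (1 - cos ⟪h, ξ⟫) * rexp (-t * ‖h‖ ^ 2)) =
      ⟪ξ, p⟫ * ⟪ξ, e⟫ / 4 * π ^ ((dim V : ℝ) / 2) *
        ((‖ξ‖ ^ 2 / 4) ^ (-(1 - s)) * Real.Gamma (1 - s)) := by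
    rw [← integral_rpow_mul_exp_neg_div_Ioi (by positivity) (by linarith), ← integral_const_mul,
      ← integral_const_mul, ← integral_sub t1 (t0.const_mul _)]
    refine setIntegral_congr_fun measurableSet_Ioi fun t ht => ?_
    have ht' : (0 : ℝ) < t := ht
    rw [integral_one_sub_cos_mul_inner_mul_inner_mul_gaussian ht', div_rpow pi_pos.le ht'.le]
    have e1 : t ^ (-(1 - s) - 1) = t ^ (β - 1) * t⁻¹ * (t ^ ((dim V : ℝ) / 2))⁻¹ := by
      rw [← rpow_neg_one, ← rpow_neg ht'.le, ← rpow_add ht', ← rpow_add ht']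
      congr 1; rw [hβ]; ring
    have e2 : t ^ (β + 1 - 1) = t ^ (β - 1) * t := by
      rw [← rpow_add_one ht'.ne']; congr 1; ring
    rw [e1, e2]
    field_simp
    ring
  have hsplit : ∀ h : V, (1 - cos ⟪h, ξ⟫) *
      (kappaConst (dim V) s * (⟪h, p⟫ * ⟪h, e⟫ * ‖h‖ ^ (-(2 * (β + 1)))) -
        cConst (dim V) s * (⟪p, e⟫ * ‖h‖ ^ (-(2 * β)))) =
      kappaConst (dim V) s * (((1 - cos ⟪h, ξ⟫) * ⟪h, p⟫ * ⟪h, e⟫) * ‖h‖ ^ (-(2 * (β + 1)))) -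
        cConst (dim V) s * ⟪p, e⟫ * ((1 - cos ⟪h, ξ⟫) * ‖h‖ ^ (-(2 * β))) := fun h => by ring
  rw [hβ2, hβ3]
  simp_rw [hsplit]
  rw [integral_sub (i1.const_mul _) (i0.const_mul _), integral_const_mul, integral_const_mul,
    key0, key1, Gamma_add_one hβ0.ne', kappaConst, hβ2]
  have hΓ1 := Gamma_pos_of_pos hβ0
  have hΓ2 : 0 < Real.Gamma (1 - s) := Gamma_pos_of_pos (by linarith)
  have h4 : (‖ξ‖ ^ 2 / 4) ^ (-(1 - s)) = ‖ξ‖ ^ (2 * s - 2) * 4 / (2 : ℝ) ^ (2 * s) := by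
    have : ‖ξ‖ ^ 2 / 4 = (‖ξ‖ / 2) ^ (2 : ℝ) := by rw [rpow_two]; ring
    rw [this, ← rpow_mul (by positivity), show (2 : ℝ) * -(1 - s) = 2 * s - 2 by ring,
      div_rpow hξ'.le zero_le_two, rpow_sub two_pos (2 * s) 2, rpow_two]
    field_simp
    norm_num
  rw [h4] at hT
  rw [sub_eq_iff_eq_add] at hT
  rw [hT, cConst, ← hβ]
  field_simp
  ring

end Kernels

section PlaneWaves

variable {V : Type*} [NormedAddCommGroup V] [InnerProductSpace ℝ V]

/-- The real plane wave with frequency `ξ` and amplitudes `a`, `b`. -/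
def planeWave (x ξ a b : V) : V := cos ⟪x, ξ⟫ • a + sin ⟪x, ξ⟫ • b

lemma norm_planeWave_le (x ξ a b : V) : ‖planeWave x ξ a b‖ ≤ ‖a‖ + ‖b‖ := by
  refine (norm_add_le _ _).trans ?_
  rw [norm_smul, norm_smul, norm_eq_abs, norm_eq_abs]
  exact add_le_add (mul_le_of_le_one_left (norm_nonneg _) (abs_cos_le_one _))
    (mul_le_of_le_one_left (norm_nonneg _) (abs_sin_le_one _))

lemma planeWave_add (x h ξ a b : V) :
    planeWave (x + h) ξ a b =
      cos ⟪h, ξ⟫ • planeWave x ξ a b + sin ⟪h, ξ⟫ • planeWave x ξ b (-a) := by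
  simp only [planeWave, inner_add_left, cos_add, sin_add]
  module

lemma planeWave_sub (x h ξ a b : V) :
    planeWave (x - h) ξ a b =
      cos ⟪h, ξ⟫ • planeWave x ξ a b - sin ⟪h, ξ⟫ • planeWave x ξ b (-a) := by
  rw [sub_eq_add_neg x h, planeWave_add, inner_neg_left, cos_neg, sin_neg, neg_smul,
    ← sub_eq_add_neg]

lemma abs_one_sub_cos_inner_le' (h ξ : V) :
    |1 - cos ⟪h, ξ⟫| ≤ 2 * (min 1 ‖h‖ * (1 + ‖ξ‖)) := by
  have h0 := norm_nonneg h
  have h1 := norm_nonneg ξ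
  rcases le_total 1 ‖h‖ with hh | hh
  · rw [min_eq_left hh, abs_of_nonneg (by linarith [cos_le_one ⟪h, ξ⟫])]
    linarith [neg_one_le_cos ⟪h, ξ⟫]
  · rw [min_eq_right hh]
    have h2 : |1 - cos ⟪h, ξ⟫| ≤ |⟪h, ξ⟫| := by simpa using abs_cos_sub_cos_le 0 ⟪h, ξ⟫
    nlinarith [abs_real_inner_le_norm h ξ]

lemma norm_planeWave_sub_planeWave_le (x y ξ a b : V) :
    ‖planeWave y ξ a b - planeWave x ξ a b‖ ≤
      3 * min 1 ‖y - x‖ * ((1 + ‖ξ‖) * ‖a‖ + (1 + ‖ξ‖) * ‖b‖) := by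
  have e : planeWave y ξ a b - planeWave x ξ a b =
      -(1 - cos ⟪y - x, ξ⟫) • planeWave x ξ a b +
        sin ⟪y - x, ξ⟫ • planeWave x ξ b (-a) := by
    have := planeWave_add x (y - x) ξ a b
    rw [add_sub_cancel] at this
    rw [this]
    module
  have h1 := norm_planeWave_le x ξ a b
  have h2 := norm_planeWave_le x ξ b (-a)
  rw [norm_neg] at h2
  rw [e]
  calc _ ≤ |1 - cos ⟪y - x, ξ⟫| * (‖a‖ + ‖b‖) + |sin ⟪y - x, ξ⟫| * (‖b‖ + ‖a‖) := by
        refine (norm_add_le _ _).trans ?_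
        rw [norm_smul, norm_smul, norm_neg, norm_eq_abs, norm_eq_abs]
        gcongr
    _ ≤ 2 * (min 1 ‖y - x‖ * (1 + ‖ξ‖)) * (‖a‖ + ‖b‖) +
        (min 1 ‖y - x‖ * (1 + ‖ξ‖)) * (‖b‖ + ‖a‖) := by
        gcongr
        exacts [abs_one_sub_cos_inner_le' _ _, abs_sin_inner_le _ _]
    _ = _ := by ring

lemma norm_two_mul_one_sub_cos_smul_le (x h ξ a b : V) :
    ‖(2 * (1 - cos ⟪h, ξ⟫)) • planeWave x ξ a b‖ ≤
      4 * min 1 (‖h‖ ^ 2) * ((1 + ‖ξ‖) ^ 2 * ‖a‖ + (1 + ‖ξ‖) ^ 2 * ‖b‖) := by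
  rw [norm_smul, norm_mul, norm_ofNat]
  calc _ ≤ 2 * (2 * (min 1 (‖h‖ ^ 2) * (1 + ‖ξ‖) ^ 2)) * (‖a‖ + ‖b‖) := by
        gcongr
        exacts [abs_one_sub_cos_inner_le h ξ, norm_planeWave_le _ _ _ _]
    _ = _ := by ring

variable [MeasurableSpace V]

/-- `f` is a superposition of real plane waves whose amplitudes have finite moments of
order `m`. -/
structure IsSuperposition {Ω : Type*} [MeasurableSpace Ω] (ν : Measure Ω) (m : ℕ) (f : V → V)
    (ρ a b : Ω → V) : Prop where
  measurable_freq : Measurable ρ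
  measurable_left : Measurable a
  measurable_right : Measurable b
  integrable_left : Integrable (fun ω => (1 + ‖ρ ω‖) ^ m * ‖a ω‖) ν
  integrable_right : Integrable (fun ω => (1 + ‖ρ ω‖) ^ m * ‖b ω‖) ν
  eq_integral : ∀ x, f x = ∫ ω, planeWave x (ρ ω) (a ω) (b ω) ∂ν

namespace IsSuperposition

variable [FiniteDimensional ℝ V] [BorelSpace V]
  {Ω : Type*} [MeasurableSpace Ω] {ν : Measure Ω} {m : ℕ} {f : V → V} {ρ a b : Ω → V}

lemma mono {k : ℕ} (hkm : k ≤ m) (H : IsSuperposition ν m f ρ a b) :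
    IsSuperposition ν k f ρ a b := by
  have := H.measurable_freq
  have := H.measurable_left
  have := H.measurable_right
  refine ⟨H.1, H.2, H.3, H.4.mono' (by fun_prop) (ae_of_all _ fun ω => ?_),
    H.5.mono' (by fun_prop) (ae_of_all _ fun ω => ?_), H.6⟩ <;>
  · rw [norm_of_nonneg (by positivity)]
    gcongr
    linarith [norm_nonneg (ρ ω)]

lemma measurable_planeWave (H : IsSuperposition ν m f ρ a b) :
    Measurable fun z : V × Ω => planeWave z.1 (ρ z.2) (a z.2) (b z.2) := by
  have := H.measurable_freq
  have := H.measurable_left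
  have := H.measurable_right
  unfold planeWave
  fun_prop

lemma integrable_planeWave (H : IsSuperposition ν m f ρ a b) (x : V) :
    Integrable (fun ω => planeWave x (ρ ω) (a ω) (b ω)) ν := by
  have H0 := H.mono (Nat.zero_le m)
  refine (H0.integrable_left.add H0.integrable_right).mono'
    (H.measurable_planeWave.comp measurable_prodMk_left).aestronglyMeasurable
    (ae_of_all _ fun ω => ?_)
  simpa using norm_planeWave_le x (ρ ω) (a ω) (b ω)

lemma exists_norm_sub_le (H : IsSuperposition ν 1 f ρ a b) :
    ∃ C, ∀ x y, ‖f y - f x‖ ≤ C * min 1 ‖y - x‖ := by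
  refine ⟨3 * ∫ ω, ((1 + ‖ρ ω‖) * ‖a ω‖ + (1 + ‖ρ ω‖) * ‖b ω‖) ∂ν, fun x y => ?_⟩
  rw [H.eq_integral, H.eq_integral,
    ← integral_sub (H.integrable_planeWave y) (H.integrable_planeWave x),
    mul_right_comm, ← integral_const_mul]
  have h1 := H.integrable_left
  have h2 := H.integrable_right
  simp_rw [pow_one] at h1 h2
  exact norm_integral_le_of_norm_le ((h1.add h2).const_mul _)
    (ae_of_all _ fun ω => norm_planeWave_sub_planeWave_le x y _ _ _)

lemma measurable (H : IsSuperposition ν 1 f ρ a b) : Measurable f := by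
  obtain ⟨C, hC⟩ := H.exists_norm_sub_le
  have hL : LipschitzWith C.toNNReal f := LipschitzWith.of_dist_le_mul fun x y => by
    rw [dist_eq_norm, dist_eq_norm]
    refine (hC y x).trans ?_
    gcongr
    exacts [le_coe_toNNReal C, min_le_right _ _]
  exact hL.continuous.measurable

local notation "dim" => Module.finrank ℝ

variable {s : ℝ}

lemma integrable_smul_sub [Nontrivial V] (H : IsSuperposition ν 1 f ρ a b) (hs : s ∈ Set.Ioo (0 : ℝ) 1) (x : V) :
    Integrable fun h : V => ⟪f (x + h) - f x, h⟫ * ‖h‖ ^ (-((dim V : ℝ) + s + 1)) := by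
  have hn : (0 : ℝ) < dim V := by exact_mod_cast Module.finrank_pos (R := ℝ) (M := V)
  obtain ⟨C, hC⟩ := H.exists_norm_sub_le
  have hf := H.measurable
  refine (((integrable_min_one_mul_norm_rpow_neg (V := V) hs.1 (m := 1)
      (by simpa using hs.2)).const_mul C)).mono' (by fun_prop) (ae_of_all _ fun h => ?_)
  rw [norm_mul, norm_of_nonneg (rpow_nonneg (norm_nonneg h) _),
    ← mul_rpow_neg_add_one (p := (dim V : ℝ) + s) (norm_nonneg h) (by linarith [hs.1]), pow_one]
  calc _ ≤ C * min 1 ‖h‖ * ‖h‖ * ‖h‖ ^ (-((dim V : ℝ) + s + 1)) := by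
        gcongr
        refine (abs_real_inner_le_norm _ _).trans ?_
        gcongr
        simpa using hC x (x + h)
    _ = _ := by ring

/-- The fractional divergence acts on plane waves through its Fourier multiplier. -/
lemma kConst_mul_integral_eq [Nontrivial V] [SFinite ν] (H : IsSuperposition ν 1 f ρ a b) (hs : s ∈ Set.Ioo (0 : ℝ) 1)
    (x : V) :
    (Integrable fun y : V => ⟪f y - f x, y - x⟫ / ‖y - x‖ ^ ((dim V : ℝ) + s + 1)) ∧
    kConst (dim V) s * ∫ y : V, ⟪f y - f x, y - x⟫ / ‖y - x‖ ^ ((dim V : ℝ) + s + 1) =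
      ∫ ω, ‖ρ ω‖ ^ (s - 1) * ⟪ρ ω, planeWave x (ρ ω) (b ω) (-a ω)⟫ ∂ν := by
  have hn : (0 : ℝ) < dim V := by exact_mod_cast Module.finrank_pos (R := ℝ) (M := V)
  have hΦ := H.integrable_smul_sub hs x
  have hshift : ∀ y : V, ⟪f y - f x, y - x⟫ / ‖y - x‖ ^ ((dim V : ℝ) + s + 1) =
      (fun h : V => ⟪f (x + h) - f x, h⟫ * ‖h‖ ^ (-((dim V : ℝ) + s + 1))) (y - x) := fun y => by
    simp only [add_sub_cancel]
    rw [rpow_neg (norm_nonneg _), div_eq_mul_inv]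
  simp_rw [hshift]
  refine ⟨hΦ.comp_sub_right x, ?_⟩
  rw [integral_sub_right_eq_self
    (fun h : V => ⟪f (x + h) - f x, h⟫ * ‖h‖ ^ (-((dim V : ℝ) + s + 1)))]
  have hsym : ∀ h : V, ⟪f (x + h) - f x, h⟫ * ‖h‖ ^ (-((dim V : ℝ) + s + 1)) +
      ⟪f (x + -h) - f x, -h⟫ * ‖-h‖ ^ (-((dim V : ℝ) + s + 1)) =
      2 * ∫ ω, sin ⟪h, ρ ω⟫ * ⟪h, planeWave x (ρ ω) (b ω) (-a ω)⟫ *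
        ‖h‖ ^ (-((dim V : ℝ) + s + 1)) ∂ν := fun h => by
    have e1 : f (x + h) - f (x - h) =
        ∫ ω, (2 * sin ⟪h, ρ ω⟫) • planeWave x (ρ ω) (b ω) (-a ω) ∂ν := by
      rw [H.eq_integral, H.eq_integral,
        ← integral_sub (H.integrable_planeWave _) (H.integrable_planeWave _)]
      refine integral_congr_ae (ae_of_all _ fun ω => ?_)
      simp only [planeWave_add, planeWave_sub]
      module
    have i1 : Integrable (fun ω => (2 * sin ⟪h, ρ ω⟫) • planeWave x (ρ ω) (b ω) (-a ω)) ν := by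
      refine ((H.integrable_planeWave (x + h)).sub (H.integrable_planeWave (x - h))).congr
        (ae_of_all _ fun ω => ?_)
      simp only [Pi.sub_apply, planeWave_add, planeWave_sub]
      module
    rw [norm_neg, inner_neg_right, ← sub_eq_add_neg, neg_mul, ← sub_eq_add_neg, ← sub_mul,
      ← inner_sub_left, sub_sub_sub_cancel_right, e1, real_inner_comm, ← integral_inner i1,
      ← integral_mul_const, ← integral_const_mul]
    refine integral_congr_ae (ae_of_all _ fun ω => ?_)
    simp only [inner_smul_right]
    ring
  have hsum : 2 * ∫ h : V, ⟪f (x + h) - f x, h⟫ * ‖h‖ ^ (-((dim V : ℝ) + s + 1)) =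
      2 * ∫ h : V, ∫ ω, sin ⟪h, ρ ω⟫ * ⟪h, planeWave x (ρ ω) (b ω) (-a ω)⟫ *
        ‖h‖ ^ (-((dim V : ℝ) + s + 1)) ∂ν := by
    rw [← integral_const_mul 2 (fun h : V => ∫ ω, _ ∂ν)]
    simp_rw [← hsym]
    rw [integral_add hΦ hΦ.comp_neg, integral_neg_eq_self
      (fun h : V => ⟪f (x + h) - f x, h⟫ * ‖h‖ ^ (-((dim V : ℝ) + s + 1))), two_mul]
  rw [mul_left_cancel₀ two_ne_zero hsum, integral_integral_swap, ← integral_const_mul]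
  · refine integral_congr_ae (ae_of_all _ fun ω => ?_)
    exact kConst_mul_integral_sin_mul_inner hs (ρ ω) _
  · have := H.measurable_freq
    have hm1 := H.measurable_left
    have hm2 := H.measurable_right
    have h1 := H.integrable_left
    have h2 := H.integrable_right
    simp_rw [pow_one] at h1 h2
    refine ((integrable_min_one_mul_norm_rpow_neg (V := V) hs.1 (m := 1)
      (by simpa using hs.2)).mul_prod (h1.add h2)).mono' (Measurable.aestronglyMeasurable ?_)
      (ae_of_all _ fun z => ?_)
    · unfold planeWave
      fun_prop
    · simp only [Function.uncurry, Pi.add_apply]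
      rw [norm_mul, norm_mul, norm_of_nonneg (rpow_nonneg (norm_nonneg z.1) _),
        ← mul_rpow_neg_add_one (p := (dim V : ℝ) + s) (norm_nonneg z.1) (by linarith [hs.1]),
        pow_one]
      have hw := norm_planeWave_le x (ρ z.2) (b z.2) (-a z.2)
      rw [norm_neg] at hw
      calc _ ≤ (min 1 ‖z.1‖ * (1 + ‖ρ z.2‖)) * (‖z.1‖ * (‖b z.2‖ + ‖a z.2‖)) *
            ‖z.1‖ ^ (-((dim V : ℝ) + s + 1)) := by
            gcongr
            · exact abs_sin_inner_le _ _
            · refine (abs_real_inner_le_norm _ _).trans ?_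
              gcongr
        _ = _ := by ring

/-- The field `g e`, where `g` is the fractional divergence of a superposition of plane waves,
is again a superposition of plane waves. -/
lemma smul_integral (H : IsSuperposition ν 2 f ρ a b) (hs : s ∈ Set.Ioo (0 : ℝ) 1) (e : V) :
    IsSuperposition ν 1
      (fun x => (∫ ω, ‖ρ ω‖ ^ (s - 1) * ⟪ρ ω, planeWave x (ρ ω) (b ω) (-a ω)⟫ ∂ν) • e) ρ
      (fun ω => (‖ρ ω‖ ^ (s - 1) * ⟪ρ ω, b ω⟫) • e)
      (fun ω => (‖ρ ω‖ ^ (s - 1) * ⟪ρ ω, -a ω⟫) • e) := by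
  have := H.measurable_freq
  have hm1 := H.measurable_left
  have hm2 := H.measurable_right
  have hb : ∀ ξ c : V, ‖(1 + ‖ξ‖) ^ 1 * ‖(‖ξ‖ ^ (s - 1) * ⟪ξ, c⟫) • e‖‖ ≤
      ‖e‖ * ((1 + ‖ξ‖) ^ 2 * ‖c‖) := fun ξ c => by
    have h0 := norm_nonneg ξ
    have h1 : ‖ξ‖ ^ (s - 1) * ‖ξ‖ ≤ 1 + ‖ξ‖ := by
      rw [← rpow_add_one' h0 (by linarith [hs.1]), sub_add_cancel]
      calc ‖ξ‖ ^ s ≤ (1 + ‖ξ‖) ^ s := by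
            gcongr
            · exact hs.1.le
            · linarith
        _ ≤ (1 + ‖ξ‖) ^ (1 : ℝ) := rpow_le_rpow_of_exponent_le (by linarith) hs.2.le
        _ = _ := rpow_one _
    rw [norm_mul, norm_norm, norm_smul, norm_mul, norm_of_nonneg (rpow_nonneg h0 _), pow_one,
      norm_of_nonneg (by positivity : (0 : ℝ) ≤ 1 + ‖ξ‖)]
    calc _ ≤ (1 + ‖ξ‖) * (‖ξ‖ ^ (s - 1) * (‖ξ‖ * ‖c‖) * ‖e‖) := by
          gcongr
          exact abs_real_inner_le_norm _ _
      _ = (‖ξ‖ ^ (s - 1) * ‖ξ‖) * ((1 + ‖ξ‖) * ‖c‖ * ‖e‖) := by ring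
      _ ≤ (1 + ‖ξ‖) * ((1 + ‖ξ‖) * ‖c‖ * ‖e‖) := by gcongr
      _ = _ := by ring
  refine ⟨H.1, by fun_prop, by fun_prop,
    (H.integrable_right.const_mul ‖e‖).mono' (by fun_prop) (ae_of_all _ fun ω => hb _ _),
    (H.integrable_left.const_mul ‖e‖).mono' (by fun_prop) (ae_of_all _ fun ω =>
      (hb _ _).trans_eq (by rw [norm_neg])), fun x => ?_⟩
  rw [← integral_smul_const]
  refine integral_congr_ae (ae_of_all _ fun ω => ?_)
  simp only [planeWave, inner_add_right, inner_smul_right]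
  module

lemma two_smul_sub_sub_eq (H : IsSuperposition ν m f ρ a b) (x h : V) :
    Integrable (fun ω => (2 * (1 - cos ⟪h, ρ ω⟫)) • planeWave x (ρ ω) (a ω) (b ω)) ν ∧
    (2 : ℝ) • f x - f (x + h) - f (x - h) =
      ∫ ω, (2 * (1 - cos ⟪h, ρ ω⟫)) • planeWave x (ρ ω) (a ω) (b ω) ∂ν := by
  have i2 : Integrable (fun ω => (2 : ℝ) • planeWave x (ρ ω) (a ω) (b ω)) ν :=
    (H.integrable_planeWave x).smul (2 : ℝ)
  have i3 : Integrable (fun ω => (2 : ℝ) • planeWave x (ρ ω) (a ω) (b ω) -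
      planeWave (x + h) (ρ ω) (a ω) (b ω)) ν := i2.sub (H.integrable_planeWave _)
  have e : ∀ ω, (2 : ℝ) • planeWave x (ρ ω) (a ω) (b ω) - planeWave (x + h) (ρ ω) (a ω) (b ω) -
      planeWave (x - h) (ρ ω) (a ω) (b ω) =
      (2 * (1 - cos ⟪h, ρ ω⟫)) • planeWave x (ρ ω) (a ω) (b ω) := fun ω => by
    simp only [planeWave_add, planeWave_sub]
    module
  refine ⟨(i3.sub (H.integrable_planeWave (x - h))).congr (ae_of_all _ e), ?_⟩
  rw [H.eq_integral, H.eq_integral, H.eq_integral, ← integral_smul,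
    ← integral_sub i2 (H.integrable_planeWave _), ← integral_sub i3 (H.integrable_planeWave _)]
  exact integral_congr_ae (ae_of_all _ e)

lemma exists_norm_two_smul_sub_sub_le (H : IsSuperposition ν 2 f ρ a b) (x : V) :
    ∃ C, ∀ h, ‖(2 : ℝ) • f x - f (x + h) - f (x - h)‖ ≤ C * min 1 (‖h‖ ^ 2) := by
  refine ⟨4 * ∫ ω, ((1 + ‖ρ ω‖) ^ 2 * ‖a ω‖ + (1 + ‖ρ ω‖) ^ 2 * ‖b ω‖) ∂ν, fun h => ?_⟩
  rw [(H.two_smul_sub_sub_eq x h).2, mul_right_comm, ← integral_const_mul]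
  exact norm_integral_le_of_norm_le ((H.integrable_left.add H.integrable_right).const_mul _)
    (ae_of_all _ fun ω => norm_two_mul_one_sub_cos_smul_le _ _ _ _ _)

lemma integrable_inv_norm_rpow_smul [Nontrivial V] (H : IsSuperposition ν 2 f ρ a b)
    (hs : s ∈ Set.Ioo (0 : ℝ) 1) (x : V) :
    Integrable fun h : V => (‖h‖ ^ ((dim V : ℝ) + 2 * s))⁻¹ •
      ((2 : ℝ) • f x - f (x + h) - f (x - h)) := by
  obtain ⟨C, hC⟩ := H.exists_norm_two_smul_sub_sub_le x
  have hf := (H.mono one_le_two).measurable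
  refine (((integrable_min_one_mul_norm_rpow_neg (V := V) (α := 2 * s) (by linarith [hs.1]) (m := 2)
      (by push_cast; linarith [hs.2])).const_mul C)).mono' (by fun_prop) (ae_of_all _ fun h => ?_)
  rw [norm_smul, ← rpow_neg (norm_nonneg _), norm_of_nonneg (rpow_nonneg (norm_nonneg h) _),
    mul_comm, ← mul_assoc]
  gcongr
  exact hC h

lemma integrable_inner_div_smul [Nontrivial V] (H : IsSuperposition ν 2 f ρ a b)
    (hs : s ∈ Set.Ioo (0 : ℝ) 1) (x : V) :
    Integrable fun h : V => (⟪h, (2 : ℝ) • f x - f (x + h) - f (x - h)⟫ /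
      (‖h‖ ^ 2 * ‖h‖ ^ ((dim V : ℝ) + 2 * s))) • h := by
  have hf := (H.mono one_le_two).measurable
  refine (H.integrable_inv_norm_rpow_smul hs x).mono (by fun_prop) (ae_of_all _ fun h => ?_)
  rcases eq_or_ne h 0 with rfl | hh
  · simp
  have hp : 0 < ‖h‖ := norm_pos_iff.2 hh
  rw [norm_smul, norm_smul, norm_div, norm_mul, norm_pow, norm_norm, norm_inv]
  set q := ‖‖h‖ ^ ((dim V : ℝ) + 2 * s)‖ with hq
  have hq0 : 0 < q := norm_pos_iff.2 (rpow_pos_of_pos hp _).ne'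
  calc _ ≤ ‖h‖ * ‖(2 : ℝ) • f x - f (x + h) - f (x - h)‖ / (‖h‖ ^ 2 * q) * ‖h‖ := by
        gcongr
        exact abs_real_inner_le_norm _ _
    _ = _ := by field_simp

/-- The Fourier multiplier of the anisotropic part of the fractional Lamé–Navier operator. -/
lemma inner_kappaConst_smul_sub [Nontrivial V] [SFinite ν] (H : IsSuperposition ν 2 f ρ a b)
    (hs : s ∈ Set.Ioo (0 : ℝ) 1) (x e : V) :
    ⟪e, (kappaConst (dim V) s / 2) •
        (∫ h : V, (⟪h, (2 : ℝ) • f x - f (x + h) - f (x - h)⟫ /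
          (‖h‖ ^ 2 * ‖h‖ ^ ((dim V : ℝ) + 2 * s))) • h) -
      (cConst (dim V) s / 2) • (∫ h : V, (‖h‖ ^ ((dim V : ℝ) + 2 * s))⁻¹ •
        ((2 : ℝ) • f x - f (x + h) - f (x - h)))⟫ =
      ∫ ω, 2 * s * (‖ρ ω‖ ^ (2 * s - 2) * ⟪ρ ω, planeWave x (ρ ω) (a ω) (b ω)⟫ * ⟪ρ ω, e⟫) ∂ν := by
  have hn : (0 : ℝ) < dim V := by exact_mod_cast Module.finrank_pos (R := ℝ) (M := V)
  have iA := H.integrable_inv_norm_rpow_smul hs x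
  have iB := H.integrable_inner_div_smul hs x
  have hpt : ∀ h : V, ⟪e, (kappaConst (dim V) s / 2) •
        ((⟪h, (2 : ℝ) • f x - f (x + h) - f (x - h)⟫ /
          (‖h‖ ^ 2 * ‖h‖ ^ ((dim V : ℝ) + 2 * s))) • h) -
      (cConst (dim V) s / 2) • ((‖h‖ ^ ((dim V : ℝ) + 2 * s))⁻¹ •
        ((2 : ℝ) • f x - f (x + h) - f (x - h)))⟫ =
      ∫ ω, (1 - cos ⟪h, ρ ω⟫) * (kappaConst (dim V) s *
        (⟪h, planeWave x (ρ ω) (a ω) (b ω)⟫ * ⟪h, e⟫ * ‖h‖ ^ (-((dim V : ℝ) + 2 * s + 2))) -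
        cConst (dim V) s * (⟪planeWave x (ρ ω) (a ω) (b ω), e⟫ *
          ‖h‖ ^ (-((dim V : ℝ) + 2 * s)))) ∂ν := fun h => by
    obtain ⟨i1, e1⟩ := H.two_smul_sub_sub_eq x h
    rw [e1, inner_sub_right, inner_smul_right, inner_smul_right,
      inner_smul_right, inner_smul_right, ← integral_inner i1, ← integral_inner i1]
    have hk : (‖h‖ ^ 2 * ‖h‖ ^ ((dim V : ℝ) + 2 * s))⁻¹ =
        ‖h‖ ^ (-((dim V : ℝ) + 2 * s + 2)) := by
      rw [← rpow_two, ← rpow_add' (norm_nonneg _) (by linarith [hs.1]),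
        ← rpow_neg (norm_nonneg _), add_comm 2]
    rw [div_eq_mul_inv _ (_ * _), hk, ← rpow_neg (norm_nonneg _), mul_assoc, mul_comm (_ / 2),
      mul_assoc, ← integral_mul_const, ← mul_assoc, mul_comm (_ * _ : ℝ) (∫ ω, _ ∂ν),
      ← integral_mul_const,
      ← integral_sub ((i1.const_inner h).mul_const _) ((i1.const_inner e).mul_const _)]
    refine integral_congr_ae (ae_of_all _ fun ω => ?_)
    simp only [inner_smul_right]
    rw [real_inner_comm e h, real_inner_comm e (planeWave _ _ _ _)]
    ring
  have iA' : Integrable fun h : V => (cConst (dim V) s / 2) •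
      ((‖h‖ ^ ((dim V : ℝ) + 2 * s))⁻¹ • ((2 : ℝ) • f x - f (x + h) - f (x - h))) := iA.smul _
  have iB' : Integrable fun h : V => (kappaConst (dim V) s / 2) •
      ((⟪h, (2 : ℝ) • f x - f (x + h) - f (x - h)⟫ /
        (‖h‖ ^ 2 * ‖h‖ ^ ((dim V : ℝ) + 2 * s))) • h) := iB.smul _
  rw [← integral_smul, ← integral_smul, ← integral_sub iB' iA']
  refine (integral_inner (iB'.sub iA') e).symm.trans ?_
  simp only [Pi.sub_apply, hpt]
  rw [integral_integral_swap]
  · exact integral_congr_ae (ae_of_all _ fun ω => integral_one_sub_cos_mul_kernel hs _ _ _)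
  · have := H.measurable_freq
    have hm1 := H.measurable_left
    have hm2 := H.measurable_right
    refine (((integrable_min_one_mul_norm_rpow_neg (V := V) (α := 2 * s) (by linarith [hs.1])
      (m := 2) (by push_cast; linarith [hs.2])).const_mul
        (2 * (|kappaConst (dim V) s| + |cConst (dim V) s|) * ‖e‖)).mul_prod
          (H.integrable_left.add H.integrable_right)).mono' (Measurable.aestronglyMeasurable ?_)
      (ae_of_all _ fun z => ?_)
    · unfold planeWave
      fun_prop
    · obtain ⟨h, ω⟩ := z
      simp only [Function.uncurry, Pi.add_apply]
      set w := planeWave x (ρ ω) (a ω) (b ω)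
      have hw : ‖w‖ ≤ ‖a ω‖ + ‖b ω‖ := norm_planeWave_le _ _ _ _
      have hR := rpow_nonneg (norm_nonneg h) (-((dim V : ℝ) + 2 * s))
      have hR' := rpow_nonneg (norm_nonneg h) (-((dim V : ℝ) + 2 * s + 2))
      have hK : ‖kappaConst (dim V) s * (⟪h, w⟫ * ⟪h, e⟫ * ‖h‖ ^ (-((dim V : ℝ) + 2 * s + 2))) -
          cConst (dim V) s * (⟪w, e⟫ * ‖h‖ ^ (-((dim V : ℝ) + 2 * s)))‖ ≤
          (|kappaConst (dim V) s| + |cConst (dim V) s|) * ‖e‖ * (‖a ω‖ + ‖b ω‖) *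
            ‖h‖ ^ (-((dim V : ℝ) + 2 * s)) := by
        calc _ ≤ |kappaConst (dim V) s| * (‖h‖ * ‖w‖ * (‖h‖ * ‖e‖) *
                ‖h‖ ^ (-((dim V : ℝ) + 2 * s + 2))) +
              |cConst (dim V) s| * (‖w‖ * ‖e‖ * ‖h‖ ^ (-((dim V : ℝ) + 2 * s))) := by
              refine (norm_sub_le _ _).trans ?_
              rw [norm_mul, norm_mul, norm_mul, norm_mul, norm_mul, norm_of_nonneg hR,
                norm_of_nonneg hR']
              gcongr
              exacts [le_rfl, abs_real_inner_le_norm _ _, abs_real_inner_le_norm _ _, le_rfl,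
                abs_real_inner_le_norm _ _]
          _ = |kappaConst (dim V) s| * (‖w‖ * ‖e‖ *
                (‖h‖ ^ 2 * ‖h‖ ^ (-((dim V : ℝ) + 2 * s + 2)))) +
              |cConst (dim V) s| * (‖w‖ * ‖e‖ * ‖h‖ ^ (-((dim V : ℝ) + 2 * s))) := by ring
          _ = (|kappaConst (dim V) s| + |cConst (dim V) s|) * ‖e‖ * ‖w‖ *
                ‖h‖ ^ (-((dim V : ℝ) + 2 * s)) := by
              rw [sq_mul_rpow_neg_add_two (norm_nonneg h) (by linarith [hs.1])]; ring
          _ ≤ _ := by gcongr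
      rw [norm_mul]
      calc _ ≤ 2 * (min 1 (‖h‖ ^ 2) * (1 + ‖ρ ω‖) ^ 2) *
            ((|kappaConst (dim V) s| + |cConst (dim V) s|) * ‖e‖ * (‖a ω‖ + ‖b ω‖) *
            ‖h‖ ^ (-((dim V : ℝ) + 2 * s))) := by
            gcongr
            exact abs_one_sub_cos_inner_le _ _
        _ = _ := by ring

end IsSuperposition

end PlaneWaves

open scoped FourierTransform SchwartzMap in
lemma SchwartzMap.exists_eq_integral_cos_add_sin {E : Type*} [NormedAddCommGroup E]
    [InnerProductSpace ℝ E] [FiniteDimensional ℝ E] [MeasurableSpace E] [BorelSpace E]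
    (φ : 𝓢(E, ℝ)) :
    ∃ v : 𝓢(E, ℂ), ∀ x, φ x =
      ∫ ξ, (cos ⟪x, (2 * π) • ξ⟫ * (v ξ).re + sin ⟪x, (2 * π) • ξ⟫ * -(v ξ).im) := by
  set U : 𝓢(E, ℂ) := φ.postcompCLM Complex.ofRealCLM
  refine ⟨𝓕 U, fun x => ?_⟩
  have h1 : U x = ∫ ξ, Complex.exp (↑(2 * π * ⟪ξ, x⟫) * Complex.I) • (𝓕 U) ξ := by
    rw [← Real.fourierInv_eq', ← SchwartzMap.fourierInv_coe,
      FourierTransform.fourierInv_fourier_eq]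
  have hi : Integrable fun ξ => Complex.exp (↑(2 * π * ⟪ξ, x⟫) * Complex.I) • (𝓕 U) ξ := by
    refine (𝓕 U).integrable.norm.mono' (by fun_prop) (ae_of_all _ fun ξ => ?_)
    rw [norm_smul, Complex.norm_exp_ofReal_mul_I, one_mul]
  have h2 := congrArg Complex.re h1
  rw [← RCLike.re_eq_complex_re, ← integral_re hi] at h2
  refine (show φ x = _ from h2).trans (integral_congr_ae (ae_of_all _ fun ξ => ?_))
  simp only [RCLike.re_eq_complex_re, smul_eq_mul, Complex.mul_re, Complex.exp_ofReal_mul_I_re,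
    Complex.exp_ofReal_mul_I_im, inner_smul_right, real_inner_comm]
  ring

open scoped FourierTransform SchwartzMap in
lemma SchwartzMap.exists_isSuperposition {ι : Type*} [Fintype ι]
    (u : 𝓢(EuclideanSpace ℝ ι, EuclideanSpace ℝ ι)) (m : ℕ) :
    ∃ a b : EuclideanSpace ℝ ι → EuclideanSpace ℝ ι,
      IsSuperposition volume m u (fun ξ => (2 * π) • ξ) a b := by
  classical
  choose v hv using fun j : ι =>
    (u.postcompCLM (EuclideanSpace.proj (𝕜 := ℝ) j)).exists_eq_integral_cos_add_sin
  have h_int : ∀ {c : EuclideanSpace ℝ ι → EuclideanSpace ℝ ι}, Measurable c →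
      (∀ ξ j, ‖c ξ j‖ ≤ ‖v j ξ‖) →
      Integrable fun ξ : EuclideanSpace ℝ ι => (1 + ‖(2 * π) • ξ‖) ^ m * ‖c ξ‖ := by
    intro c hc hcv
    have hw : ∀ k j, Integrable fun ξ => ‖ξ‖ ^ k * ‖v j ξ‖ := fun k j =>
      (v j).integrable_pow_mul volume k
    refine (integrable_finsetSum Finset.univ fun j _ => ((hw 0 j).add (hw m j)).const_mul
      (2 ^ (m - 1) * (1 + (2 * π) ^ m))).mono' (by fun_prop) (ae_of_all _ fun ξ => ?_)
    have h1 : ‖c ξ‖ ≤ ∑ j, ‖v j ξ‖ := by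
      calc ‖c ξ‖ = ‖∑ j, EuclideanSpace.single j (c ξ j)‖ := by
            congr 1
            ext i
            simp [Pi.single_apply]
        _ ≤ ∑ j, ‖v j ξ‖ := (norm_sum_le _ _).trans (Finset.sum_le_sum fun j _ => by
            simpa using hcv ξ j)
    have h2 : (1 + ‖(2 * π) • ξ‖) ^ m ≤ 2 ^ (m - 1) * (1 + (2 * π) ^ m) * (1 + ‖ξ‖ ^ m) := by
      refine (add_pow_le zero_le_one (norm_nonneg _) m).trans ?_
      rw [norm_smul, norm_of_nonneg (by positivity), mul_pow (2 * π), one_pow, mul_assoc (2 ^ (m - 1))]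
      refine mul_le_mul_of_nonneg_left ?_ (by positivity)
      nlinarith [pow_nonneg (norm_nonneg ξ) m, pow_nonneg (by positivity : 0 ≤ 2 * π) m]
    rw [norm_mul, norm_norm, norm_of_nonneg (by positivity)]
    calc _ ≤ 2 ^ (m - 1) * (1 + (2 * π) ^ m) * (1 + ‖ξ‖ ^ m) * ∑ j, ‖v j ξ‖ := by gcongr
      _ = _ := by
        simp only [Finset.mul_sum, Pi.add_apply, pow_zero]
        exact Finset.sum_congr rfl fun j _ => by ring
  have ha : Measurable fun ξ => WithLp.toLp 2 fun j => (v j ξ).re := by fun_prop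
  have hb : Measurable fun ξ => WithLp.toLp 2 fun j => -(v j ξ).im := by fun_prop
  have H : IsSuperposition volume m
      (fun x => ∫ ξ, planeWave x ((2 * π) • ξ) (WithLp.toLp 2 fun j => (v j ξ).re)
        (WithLp.toLp 2 fun j => -(v j ξ).im)) (fun ξ => (2 * π) • ξ)
      (fun ξ => WithLp.toLp 2 fun j => (v j ξ).re)
      (fun ξ => WithLp.toLp 2 fun j => -(v j ξ).im) :=
    ⟨by fun_prop, ha, hb, h_int ha fun ξ j => Complex.abs_re_le_norm _,
      h_int hb fun ξ j => by simpa using Complex.abs_im_le_norm _, fun x => rfl⟩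
  refine ⟨_, _, H.1, H.2, H.3, H.4, H.5, fun x => ?_⟩
  ext j
  rw [eval_integral_piLp (integrable_piLp_iff.1 (H.integrable_planeWave x))]
  exact hv j x

namespace IsSuperposition

variable {V : Type*} [NormedAddCommGroup V] [InnerProductSpace ℝ V] [FiniteDimensional ℝ V]
  [Nontrivial V] [MeasurableSpace V] [BorelSpace V] {Ω : Type*} [MeasurableSpace Ω] {ν : Measure Ω}
  [SFinite ν] {f : V → V} {ρ a b : Ω → V} {s : ℝ}

local notation "dim" => Module.finrank ℝ

/-- The Fourier multiplier of the gradient of the divergence. -/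
lemma kConst_mul_integral_smul_eq (H : IsSuperposition ν 2 f ρ a b) (hs : s ∈ Set.Ioo (0 : ℝ) 1)
    {g : V → ℝ}
    (hg : ∀ x, g x = ∫ ω, ‖ρ ω‖ ^ (s - 1) * ⟪ρ ω, planeWave x (ρ ω) (b ω) (-a ω)⟫ ∂ν) (x e : V) :
    (Integrable fun y : V => ⟪e, ((g y - g x) / ‖y - x‖ ^ ((dim V : ℝ) + s + 1)) • (y - x)⟫) ∧
    kConst (dim V) s *
        ∫ y : V, ⟪e, ((g y - g x) / ‖y - x‖ ^ ((dim V : ℝ) + s + 1)) • (y - x)⟫ =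
      -∫ ω, ‖ρ ω‖ ^ (2 * s - 2) * ⟪ρ ω, planeWave x (ρ ω) (a ω) (b ω)⟫ * ⟪ρ ω, e⟫ ∂ν := by
  have h := (H.smul_integral hs e).kConst_mul_integral_eq hs x
  simp only [← hg, ← sub_smul, inner_smul_left, conj_trivial] at h
  have hpt : ∀ y : V, ⟪e, ((g y - g x) / ‖y - x‖ ^ ((dim V : ℝ) + s + 1)) • (y - x)⟫ =
      (g y - g x) * ⟪e, y - x⟫ / ‖y - x‖ ^ ((dim V : ℝ) + s + 1) := fun y => by
    rw [inner_smul_right]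
    ring
  simp only [hpt]
  refine ⟨h.1, h.2.trans ?_⟩
  rw [← integral_neg]
  refine integral_congr_ae (ae_of_all _ fun ω => ?_)
  simp only
  rcases eq_or_ne (ρ ω) 0 with h0 | h0
  · simp [h0]
  rw [show 2 * s - 2 = (s - 1) + (s - 1) by ring, rpow_add (norm_pos_iff.2 h0)]
  simp only [planeWave, inner_add_right, inner_smul_right, inner_neg_right]
  ring

end IsSuperposition

/-- `𝕃^s u = μ^s (−Δ)^s u − ((2μ+λ)^s − μ^s) ∇^s (div^s u)`, together with the absolute
convergence of all the integrals involved. -/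
theorem lameFrac_eq_fracLap_sub_fracGrad_fracDiv (d : ℕ) (hd : 2 ≤ d) (s : ℝ)
    (hs : s ∈ Set.Ioo (0 : ℝ) 1) (μ lam : ℝ) (hμ : 0 < μ) (hlam : 0 < 2 * μ + lam)
    (u : SchwartzMap (EuclideanSpace ℝ (Fin d)) (EuclideanSpace ℝ (Fin d))) :
    (∀ x : EuclideanSpace ℝ (Fin d),
      Integrable fun y : EuclideanSpace ℝ (Fin d) =>
        ⟪u y - u x, y - x⟫ / ‖y - x‖ ^ ((d : ℝ) + s + 1)) ∧
    (∀ x : EuclideanSpace ℝ (Fin d),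
      Integrable fun y : EuclideanSpace ℝ (Fin d) =>
        ((fracDiv d s u y - fracDiv d s u x) / ‖y - x‖ ^ ((d : ℝ) + s + 1)) • (y - x)) ∧
    (∀ x : EuclideanSpace ℝ (Fin d),
      lameFrac d s μ lam u x =
        μ ^ s • fracLap d s u x -
          ((2 * μ + lam) ^ s - μ ^ s) • fracGrad d s (fracDiv d s u) x) := by
  have : Nontrivial (EuclideanSpace ℝ (Fin d)) :=
    Module.nontrivial_of_finrank_pos (R := ℝ) (by simp; omega)
  have hdim : Module.finrank ℝ (EuclideanSpace ℝ (Fin d)) = d := finrank_euclideanSpace_fin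
  obtain ⟨a, b, H⟩ := u.exists_isSuperposition 2
  have hdiv := fun x => (H.mono one_le_two).kConst_mul_integral_eq hs x
  have hgrad := fun x e => H.kConst_mul_integral_smul_eq hs (g := fracDiv d s u)
    (fun x => by rw [← (hdiv x).2, hdim]; rfl) x e
  have hlame := fun x e => H.inner_kappaConst_smul_sub hs x e
  simp only [hdim] at hdiv hgrad hlame
  have h_int : ∀ x : EuclideanSpace ℝ (Fin d), Integrable fun y : EuclideanSpace ℝ (Fin d) =>
      ((fracDiv d s u y - fracDiv d s u x) / ‖y - x‖ ^ ((d : ℝ) + s + 1)) • (y - x) := fun x =>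
    integrable_piLp_iff.2 fun j => by
      have := (hgrad x (EuclideanSpace.single j 1)).1
      simpa only [EuclideanSpace.inner_single_left, map_one, one_mul] using this
  refine ⟨fun x => (hdiv x).1, h_int, fun x => ?_⟩
  have hs0 : s ≠ 0 := hs.1.ne'
  refine ext_inner_left ℝ fun e => ?_
  have h1 := hlame x e
  have h2 := (hgrad x e).2
  rw [integral_inner (h_int x)] at h2
  rw [integral_const_mul, ← neg_eq_iff_eq_neg.2 h2, inner_sub_right, inner_smul_right,
    inner_smul_right] at h1
  rw [lameFrac, fracLap, fracGrad, inner_add_right, inner_sub_right, inner_smul_right,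
    inner_smul_right, inner_smul_right, inner_smul_right, inner_smul_right, inner_smul_right,
    mul_assoc, mul_assoc _ (kappaConst d s / 2), eq_add_of_sub_eq h1]
  field_simp
  ring
end
end

section
/- Let d ≥ 2, μ > 0, 2μ + λ > 0, and s ∈ (0, d/2). Define Ψ^s(x) := (γ_{d,s}/(μ^s (2μ+λ)^s)) [ ((2s−1)(2μ+λ)^s + μ^s)/(d−2s) · |x|^{2s−d} I + ((2μ+λ)^s − μ^s) |x|^{2s−d} (x⊗x)/|x|² ] and B(ξ) := μ^{−s}(2π|ξ|)^{−2s} I + ((2μ+λ)^{−s} − μ^{−s})(2π|ξ|)^{−2s} (ξ⊗ξ)/|ξ|². Then for every Schwartz function v : ℝ^d → ℂ and all indices 1 ≤ i, j ≤ d, both integrals below converge absolutely and ∫_{ℝ^d} B_{ij}(ξ) v(ξ) dξ = ∫_{ℝ^d} Ψ^s_{ij}(x) v̂(x) dx, where v̂(x) = ∫_{ℝ^d} e^{−2πi ξ·x} v(ξ) dξ. (That is, the tempered distribution Ψ^s has Fourier transform [M^s(ξ)]^{−1} = B(ξ).) -/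
open Real MeasureTheory
open scoped FourierTransform

noncomputable section

/-- `γ_{d,s} = Γ((d+2−2s)/2)/(2^{2s} π^{d/2} Γ(1+s))`. -/
def gammaConst (d : ℕ) (s : ℝ) : ℝ :=
  Real.Gamma (((d : ℝ) + 2 - 2 * s) / 2) /
    ((2 : ℝ) ^ (2 * s) * π ^ ((d : ℝ) / 2) * Real.Gamma (1 + s))

/-- The entries of the Lamé–Navier–Riesz kernel `Ψ^s`. -/
def lameRieszKernelEntry (d : ℕ) (s μ lam : ℝ) (x : EuclideanSpace ℝ (Fin d))
    (i j : Fin d) : ℝ :=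
  gammaConst d s / (μ ^ s * (2 * μ + lam) ^ s) *
    (((2 * s - 1) * (2 * μ + lam) ^ s + μ ^ s) / ((d : ℝ) - 2 * s) *
        ‖x‖ ^ (2 * s - (d : ℝ)) * (if i = j then 1 else 0) +
      ((2 * μ + lam) ^ s - μ ^ s) * ‖x‖ ^ (2 * s - (d : ℝ)) * (x i * x j / ‖x‖ ^ 2))

/-- The entries of the inverse multiplier `[M^s(ξ)]^{−1}`. -/
def lameInverseSymbolEntry (d : ℕ) (s μ lam : ℝ) (ξ : EuclideanSpace ℝ (Fin d))
    (i j : Fin d) : ℝ :=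
  μ ^ (-s) * (2 * π * ‖ξ‖) ^ (-(2 * s)) * (if i = j then 1 else 0) +
    ((2 * μ + lam) ^ (-s) - μ ^ (-s)) * (2 * π * ‖ξ‖) ^ (-(2 * s)) *
      (ξ i * ξ j / ‖ξ‖ ^ 2)

section Superposition
variable {E : Type*} [MeasurableSpace E] {ν : Measure E} [SFinite ν]

theorem superposition_integrable_and_integral_eq {k : ℝ → E → ℝ} {K : E → ℝ} {w : E → ℂ}
    (hk : Measurable (Function.uncurry k)) (hk0 : ∀ t ∈ Set.Ioi (0 : ℝ), ∀ x, 0 ≤ k t x)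
    (hki : ∀ᵐ x ∂ν, IntegrableOn (fun t => k t x) (Set.Ioi 0))
    (hkK : ∀ᵐ x ∂ν, ∫ t in Set.Ioi 0, k t x = K x)
    (hw : AEStronglyMeasurable w ν) (hKw : Integrable (fun x => (K x : ℂ) * w x) ν) :
    IntegrableOn (fun t => ∫ x, (k t x : ℂ) * w x ∂ν) (Set.Ioi 0) ∧
      ∫ t in Set.Ioi 0, ∫ x, (k t x : ℂ) * w x ∂ν = ∫ x, (K x : ℂ) * w x ∂ν := by
  have hmeas : AEStronglyMeasurable (fun p : ℝ × E => (k p.1 p.2 : ℂ) * w p.2)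
      ((volume.restrict (Set.Ioi 0)).prod ν) :=
    (Complex.measurable_ofReal.comp hk).aestronglyMeasurable.mul hw.comp_snd
  have hint : Integrable (fun p : ℝ × E => (k p.1 p.2 : ℂ) * w p.2)
      ((volume.restrict (Set.Ioi 0)).prod ν) := by
    rw [integrable_prod_iff' hmeas]
    constructor
    · filter_upwards [hki] with x hx
      exact hx.integrable.ofReal.mul_const _
    · refine hKw.norm.congr ?_
      filter_upwards [hkK] with x hx
      have h1 : ∀ t ∈ Set.Ioi (0 : ℝ), ‖(k t x : ℂ) * w x‖ = k t x * ‖w x‖ := fun t ht => by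
        rw [norm_mul, Complex.norm_real, Real.norm_of_nonneg (hk0 t ht x)]
      rw [setIntegral_congr_fun measurableSet_Ioi h1, integral_mul_const, hx, norm_mul,
        Complex.norm_real, Real.norm_of_nonneg]
      rw [← hx]
      exact setIntegral_nonneg measurableSet_Ioi fun t ht => hk0 t ht x
  refine ⟨hint.integral_prod_left, ?_⟩
  rw [integral_integral_swap hint]
  refine integral_congr_ae ?_
  filter_upwards [hkK] with x hx
  rw [integral_mul_const, integral_complex_ofReal, hx]

end Superposition

theorem integrableOn_rpow_mul_exp_neg_pi_mul {c r : ℝ} (hc : 0 < c) (hr : 0 < r) :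
    IntegrableOn (fun t : ℝ => t ^ (c - 1) * exp (-(π * t * r ^ 2))) (Set.Ioi 0) := by
  have h := integrableOn_rpow_mul_exp_neg_mul_rpow (p := 1) (s := c - 1) (b := π * r ^ 2)
    (by linarith) one_pos (by positivity)
  refine h.congr_fun (fun t _ => ?_) measurableSet_Ioi
  simp only [rpow_one]
  ring_nf

theorem integral_rpow_mul_exp_neg_pi_mul {c r : ℝ} (hc : 0 < c) (hr : 0 < r) :
    ∫ t in Set.Ioi (0 : ℝ), t ^ (c - 1) * exp (-(π * t * r ^ 2)) =
      Gamma c * π ^ (-c) * r ^ (-(2 * c)) := by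
  have h := Real.integral_rpow_mul_exp_neg_mul_Ioi hc (r := π * r ^ 2) (by positivity)
  calc _ = ∫ t in Set.Ioi (0 : ℝ), t ^ (c - 1) * exp (-(π * r ^ 2 * t)) := by
        congr 1 with t
        ring_nf
    _ = _ := by
        rw [h, one_div, inv_rpow (by positivity), ← rpow_neg (by positivity),
          mul_rpow (by positivity) (by positivity), ← rpow_natCast r 2, ← rpow_mul hr.le]
        push_cast
        ring_nf

theorem gaussian_weight_comp_inv {c r t : ℝ} (ht : 0 < t) :
    (|(-1 : ℝ)| * t ^ ((-1 : ℝ) - 1)) •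
        ((t ^ (-1 : ℝ)) ^ (c - 1) * exp (-(π * t ^ (-1 : ℝ) * r ^ 2))) =
      t ^ (-c - 1) * exp (-(π * r ^ 2 / t)) := by
  rw [← rpow_mul ht.le, rpow_neg_one, smul_eq_mul, abs_neg, abs_one, one_mul, ← mul_assoc,
    ← rpow_add ht]
  ring_nf

theorem integrableOn_rpow_mul_exp_neg_pi_div {c r : ℝ} (hc : 0 < c) (hr : 0 < r) :
    IntegrableOn (fun t : ℝ => t ^ (-c - 1) * exp (-(π * r ^ 2 / t))) (Set.Ioi 0) := by
  have h := (integrableOn_Ioi_comp_rpow_iff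
    (fun t : ℝ => t ^ (c - 1) * exp (-(π * t * r ^ 2))) (p := -1) (by norm_num)).2
    (integrableOn_rpow_mul_exp_neg_pi_mul hc hr)
  exact h.congr_fun (fun t ht => gaussian_weight_comp_inv ht) measurableSet_Ioi

theorem integral_rpow_mul_exp_neg_pi_div {c r : ℝ} (hc : 0 < c) (hr : 0 < r) :
    ∫ t in Set.Ioi (0 : ℝ), t ^ (-c - 1) * exp (-(π * r ^ 2 / t)) =
      Gamma c * π ^ (-c) * r ^ (-(2 * c)) := by
  rw [← integral_rpow_mul_exp_neg_pi_mul hc hr, ← integral_comp_rpow_Ioi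
    (fun t : ℝ => t ^ (c - 1) * exp (-(π * t * r ^ 2))) (p := -1) (by norm_num)]
  exact setIntegral_congr_fun measurableSet_Ioi fun t ht => (gaussian_weight_comp_inv ht).symm

section GaussianMoments
variable {V : Type*} [NormedAddCommGroup V]

/-- The Gaussian `e^{-π t |v|²}`, with complex values. -/
def scaledGaussian (t : ℝ) (v : V) : ℂ := (exp (-(π * t * ‖v‖ ^ 2)) : ℝ)

theorem continuous_scaledGaussian (t : ℝ) : Continuous (scaledGaussian t : V → ℂ) := by
  unfold scaledGaussian
  fun_prop

variable [InnerProductSpace ℝ V]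

/-- The Fourier transform `t^{-d/2} e^{-π |x|²/t}` of the Gaussian `e^{-π t |v|²}`. -/
def dualGaussian (t : ℝ) (x : V) : ℂ :=
  (t ^ (-((Module.finrank ℝ V : ℝ) / 2)) * exp (-(π * ‖x‖ ^ 2 / t)) : ℝ)

theorem norm_inner_mul_le (a v : V) (z : ℂ) :
    ‖(inner ℝ a v : ℂ) * z‖ ≤ ‖a‖ * (‖v‖ * ‖z‖) := by
  rw [norm_mul, Complex.norm_real, ← mul_assoc]
  gcongr
  exact norm_inner_le_norm a v

theorem hasFDerivAt_dualGaussian (t : ℝ) (x : V) :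
    HasFDerivAt (dualGaussian t : V → ℂ)
      ((innerSL ℝ x).smulRight (-(2 * π / t) * dualGaussian t x)) x := by
  have h1 : HasFDerivAt (fun x : V => -(π * ‖x‖ ^ 2 / t)) ((-(2 * π / t)) • innerSL ℝ x) x := by
    have := ((hasStrictFDerivAt_norm_sq x).hasFDerivAt.const_mul π).mul_const (t⁻¹) |>.neg
    refine (this.congr_fderiv ?_)
    ext y
    simp
    ring
  have h2 := (h1.exp.const_mul (t ^ (-((Module.finrank ℝ V : ℝ) / 2))))
  have h3 := Complex.ofRealCLM.hasFDerivAt.comp x h2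
  refine h3.congr_fderiv ?_
  ext y
  simp [dualGaussian]
  ring

variable [FiniteDimensional ℝ V] [MeasurableSpace V] [BorelSpace V]

theorem fourier_inner_mul {f : V → ℂ} (hf : Integrable f)
    (hf' : Integrable fun v => ‖v‖ * ‖f v‖) (a x : V) :
    𝓕 (fun v => (inner ℝ a v : ℂ) * f v) x = Complex.I / (2 * π) * fderiv ℝ (𝓕 f) x a := by
  have hint : Integrable (VectorFourier.fourierSMulRight (innerSL ℝ) f) := by
    refine (hf'.const_mul (2 * π * ‖(innerSL ℝ : V →L[ℝ] V →L[ℝ] ℝ)‖)).mono' hf.1.fourierSMulRight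
      (Filter.Eventually.of_forall fun v => ?_)
    have := VectorFourier.norm_fourierSMulRight_le (innerSL ℝ : V →L[ℝ] V →L[ℝ] ℝ) f v
    linarith
  rw [Real.fderiv_fourier hf hf', Real.fourier_continuousLinearMap_apply hint]
  have h : (fun v : V => (VectorFourier.fourierSMulRight (innerSL ℝ) f v) a) =
      fun v => (-(2 * π * Complex.I)) • ((inner ℝ a v : ℂ) * f v) := by
    ext v
    simp [VectorFourier.fourierSMulRight_apply, innerSL_apply_apply ℝ, real_inner_comm v a]
  rw [h, Real.fourier_eq, Real.fourier_eq, ← integral_const_mul]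
  congr 1 with v
  simp only [Circle.smul_def, smul_eq_mul]
  have : (π : ℂ) ≠ 0 := by exact_mod_cast pi_ne_zero
  field_simp
  simp

theorem integrable_pow_norm_mul_gaussian [Nontrivial V] (n : ℕ) {b : ℝ} (hb : 0 < b) :
    Integrable fun v : V => ‖v‖ ^ n * exp (-b * ‖v‖ ^ 2) := by
  rw [integrable_fun_norm_addHaar volume (f := fun r : ℝ => r ^ n * exp (-b * r ^ 2))]
  have h := integrableOn_rpow_mul_exp_neg_mul_sq hb
    (s := ((Module.finrank ℝ V - 1 + n : ℕ) : ℝ)) (lt_of_lt_of_le (by norm_num) (Nat.cast_nonneg _))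
  refine h.congr_fun (fun t _ => ?_) measurableSet_Ioi
  simp only [rpow_natCast, smul_eq_mul]
  ring

theorem integrable_pow_norm_mul_scaledGaussian [Nontrivial V] (n : ℕ) {t : ℝ} (ht : 0 < t) :
    Integrable fun v : V => ‖v‖ ^ n * ‖scaledGaussian t v‖ := by
  refine (integrable_pow_norm_mul_gaussian (V := V) n (b := π * t) (by positivity)).congr
    (Filter.Eventually.of_forall fun v => ?_)
  simp only [scaledGaussian, Complex.norm_real, norm_eq_abs, abs_exp]
  ring_nf

theorem integrable_scaledGaussian [Nontrivial V] {t : ℝ} (ht : 0 < t) :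
    Integrable (scaledGaussian t : V → ℂ) := by
  rw [← integrable_norm_iff (continuous_scaledGaussian t).aestronglyMeasurable]
  simpa using integrable_pow_norm_mul_scaledGaussian (V := V) 0 ht

theorem integrable_pow_norm_mul_inner_mul_scaledGaussian [Nontrivial V] (n : ℕ) {t : ℝ} (ht : 0 < t)
    (a : V) : Integrable fun v : V => ‖v‖ ^ n * ‖(inner ℝ a v : ℂ) * scaledGaussian t v‖ := by
  refine ((integrable_pow_norm_mul_scaledGaussian (V := V) (n + 1) ht).const_mul ‖a‖).mono' ?_
    (Filter.Eventually.of_forall fun v => ?_)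
  · have := continuous_scaledGaussian (V := V) t
    exact Continuous.aestronglyMeasurable (by fun_prop)
  · rw [norm_mul, norm_norm, norm_pow, norm_norm]
    calc _ ≤ ‖v‖ ^ n * (‖a‖ * (‖v‖ * ‖scaledGaussian t v‖)) := by
          gcongr
          exact norm_inner_mul_le a v _
      _ = _ := by ring

theorem integrable_inner_mul_scaledGaussian [Nontrivial V] {t : ℝ} (ht : 0 < t)
    (a : V) : Integrable fun v : V => (inner ℝ a v : ℂ) * scaledGaussian t v := by
  have := continuous_scaledGaussian (V := V) t
  rw [← integrable_norm_iff (Continuous.aestronglyMeasurable (by fun_prop))]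
  simpa using integrable_pow_norm_mul_inner_mul_scaledGaussian (V := V) 0 ht a

theorem integrable_inner_mul_inner_mul_scaledGaussian [Nontrivial V] {t : ℝ} (ht : 0 < t)
    (a b : V) :
    Integrable fun v : V => (inner ℝ b v : ℂ) * ((inner ℝ a v : ℂ) * scaledGaussian t v) := by
  have := continuous_scaledGaussian (V := V) t
  refine ((integrable_pow_norm_mul_inner_mul_scaledGaussian (V := V) 1 ht a).const_mul ‖b‖).mono'
    (Continuous.aestronglyMeasurable (by fun_prop)) (Filter.Eventually.of_forall fun v => ?_)
  simpa using norm_inner_mul_le b v ((inner ℝ a v : ℂ) * scaledGaussian t v)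

theorem fourier_scaledGaussian {t : ℝ} (ht : 0 < t) :
    𝓕 (scaledGaussian t : V → ℂ) = dualGaussian t := by
  ext x
  have h := fourier_gaussian_innerProductSpace (V := V) (b := ((π * t : ℝ) : ℂ))
    (by rw [Complex.ofReal_re]; positivity) x
  have e : (fun v : V => Complex.exp (-((π * t : ℝ) : ℂ) * ‖v‖ ^ 2)) = scaledGaussian t := by
    ext v
    simp [scaledGaussian]
  rw [e] at h
  have hπ : (π : ℂ) ≠ 0 := by exact_mod_cast pi_ne_zero
  have htc : (t : ℂ) ≠ 0 := by exact_mod_cast ht.ne'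
  rw [h, dualGaussian, Complex.ofReal_mul (_ ^ _), rpow_neg ht.le, ← inv_rpow ht.le,
    Complex.ofReal_cpow (by positivity), Complex.ofReal_exp]
  congr 2
  · push_cast
    field_simp
  · push_cast
    rfl
  · push_cast
    field_simp

theorem fourier_inner_mul_scaledGaussian [Nontrivial V] {t : ℝ} (ht : 0 < t) (a x : V) :
    𝓕 (fun v : V => (inner ℝ a v : ℂ) * scaledGaussian t v) x =
      -(Complex.I / t) * ((inner ℝ a x : ℂ) * dualGaussian t x) := by
  rw [fourier_inner_mul (integrable_scaledGaussian ht)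
    (by simpa using integrable_pow_norm_mul_scaledGaussian (V := V) 1 ht),
    fourier_scaledGaussian ht, (hasFDerivAt_dualGaussian t x).fderiv]
  have hπ : (π : ℂ) ≠ 0 := by exact_mod_cast pi_ne_zero
  have htc : (t : ℂ) ≠ 0 := by exact_mod_cast ht.ne'
  simp [real_inner_comm]
  field_simp

theorem fourier_inner_mul_inner_mul_scaledGaussian [Nontrivial V] {t : ℝ} (ht : 0 < t) (a b x : V) :
    𝓕 (fun v : V => (inner ℝ b v : ℂ) * ((inner ℝ a v : ℂ) * scaledGaussian t v)) x =
      (inner ℝ a b / (2 * π * t) - inner ℝ a x * inner ℝ b x / t ^ 2) * dualGaussian t x := by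
  rw [fourier_inner_mul (integrable_inner_mul_scaledGaussian ht a)
    (by simpa using integrable_pow_norm_mul_inner_mul_scaledGaussian (V := V) 1 ht a),
    show 𝓕 (fun v : V => (inner ℝ a v : ℂ) * scaledGaussian t v) = _ from
      funext (fourier_inner_mul_scaledGaussian ht a)]
  have h1 : HasFDerivAt (fun y : V => (inner ℝ a y : ℂ)) (Complex.ofRealCLM.comp (innerSL ℝ a)) x :=
    (Complex.ofRealCLM.comp (innerSL ℝ a)).hasFDerivAt
  have h2 : HasFDerivAt
      (fun y : V => -(Complex.I / t) * ((inner ℝ a y : ℂ) * dualGaussian t y)) _ x :=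
    (h1.mul (hasFDerivAt_dualGaussian t x)).const_mul (-(Complex.I / t))
  rw [h2.fderiv]
  have hπ : (π : ℂ) ≠ 0 := by exact_mod_cast pi_ne_zero
  have htc : (t : ℂ) ≠ 0 := by exact_mod_cast ht.ne'
  simp [real_inner_comm]
  field_simp
  ring_nf
  simp only [Complex.I_sq]
  ring

theorem integral_fourier_mul_eq_flip {f g : V → ℂ} (hf : Integrable f) (hg : Integrable g) :
    ∫ ξ, f ξ * 𝓕 g ξ = ∫ x, 𝓕 f x * g x := by
  simpa using! (VectorFourier.integral_fourierIntegral_smul_eq_flip (L := innerₗ V)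
    Real.continuous_fourierChar continuous_inner hf hg).symm

end GaussianMoments

section RieszPairing
variable {V : Type*} [NormedAddCommGroup V] [InnerProductSpace ℝ V] [FiniteDimensional ℝ V]
  [MeasurableSpace V] [BorelSpace V]

theorem integrable_dualGaussian_mul {t : ℝ} (ht : 0 < t) {w : V → ℂ} (hw : Integrable w) :
    Integrable fun x => dualGaussian t x * w x := by
  refine hw.bdd_mul (c := t ^ (-((Module.finrank ℝ V : ℝ) / 2))) ?_
    (Filter.Eventually.of_forall fun x => ?_)
  · unfold dualGaussian
    exact Continuous.aestronglyMeasurable (by fun_prop)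
  · rw [dualGaussian, Complex.norm_real, norm_of_nonneg (by positivity)]
    exact mul_le_of_le_one_right (by positivity) (exp_le_one_iff.2 (neg_nonpos.2 (by positivity)))

theorem integrable_inner_mul_inner_mul_schwartz (v : SchwartzMap V ℂ) (a b : V) :
    Integrable fun x : V => (inner ℝ a x : ℂ) * (inner ℝ b x : ℂ) * v x := by
  have := v.continuous
  refine ((v.integrable_pow_mul volume 2).const_mul (‖a‖ * ‖b‖)).mono'
    (Continuous.aestronglyMeasurable (by fun_prop)) (Filter.Eventually.of_forall fun x => ?_)
  simp only [norm_mul, Complex.norm_real]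
  calc _ ≤ (‖a‖ * ‖x‖) * (‖b‖ * ‖x‖) * ‖v x‖ := by
        gcongr <;> exact norm_inner_le_norm _ _
    _ = _ := by ring

variable [Nontrivial V]

theorem integrable_norm_rpow_neg_mul_schwartz {p : ℝ} (hp0 : 0 ≤ p)
    (hp : p < Module.finrank ℝ V) (v : SchwartzMap V ℂ) :
    Integrable fun x : V => ((‖x‖ ^ (-p) : ℝ) : ℂ) * v x := by
  have hmeas : AEStronglyMeasurable (fun x : V => ((‖x‖ ^ (-p) : ℝ) : ℂ) * v x) volume := by
    have := v.continuous.measurable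
    exact Measurable.aestronglyMeasurable (by fun_prop)
  obtain ⟨C, -, hC⟩ := v.decay 0 0
  rw [← integrableOn_univ, ← Set.union_compl_self (Metric.ball (0 : V) 1), integrableOn_union]
  constructor
  · refine integrableOn_ball_of_norm_le_rpow (C := C) (Module.finrank_pos) hp
      (Filter.Eventually.of_forall fun x => ?_) hmeas
    have h := hC x
    simp only [pow_zero, norm_iteratedFDeriv_zero, one_mul] at h
    rw [norm_mul, Complex.norm_real, norm_of_nonneg (by positivity), mul_comm]
    gcongr
  · refine (v.integrable.norm.integrableOn).mono' hmeas.restrict ?_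
    refine (ae_restrict_iff' (Metric.isOpen_ball.measurableSet.compl)).2
      (Filter.Eventually.of_forall fun x hx => ?_)
    have hx1 : 1 ≤ ‖x‖ := by simpa using hx
    rw [norm_mul, Complex.norm_real, norm_of_nonneg (by positivity)]
    exact mul_le_of_le_one_left (norm_nonneg _) (rpow_le_one_of_one_le_of_nonpos hx1 (by linarith))

theorem integrable_norm_rpow_neg_mul_inner_mul_inner_mul_schwartz {c : ℝ} (hc0 : 0 ≤ c)
    (hc : c < (Module.finrank ℝ V : ℝ) / 2) (v : SchwartzMap V ℂ) (a b : V) :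
    Integrable fun x : V => ((‖x‖ ^ (-(2 * (c + 1))) : ℝ) : ℂ) *
      ((inner ℝ a x : ℂ) * (inner ℝ b x : ℂ) * v x) := by
  have h := (integrable_norm_rpow_neg_mul_schwartz (p := 2 * c) (by linarith) (by linarith) v).norm
  refine (h.const_mul (‖a‖ * ‖b‖)).mono' ?_ ?_
  · have := v.continuous.measurable
    exact Measurable.aestronglyMeasurable (by fun_prop)
  · filter_upwards [volume.ae_ne (0 : V)] with x hx
    have hx' : 0 < ‖x‖ := norm_pos_iff.2 hx
    have e : ‖x‖ ^ (-(2 * c)) = ‖x‖ ^ (-(2 * (c + 1))) * (‖x‖ * ‖x‖) := by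
      rw [← pow_two, ← rpow_natCast, ← rpow_add hx']
      push_cast
      ring_nf
    simp only [norm_mul, Complex.norm_real]
    rw [norm_of_nonneg (by positivity : 0 ≤ ‖x‖ ^ (-(2 * (c + 1)))),
      norm_of_nonneg (by positivity : 0 ≤ ‖x‖ ^ (-(2 * c))), e]
    calc _ ≤ ‖x‖ ^ (-(2 * (c + 1))) * ((‖a‖ * ‖x‖) * (‖b‖ * ‖x‖) * ‖v x‖) := by
          gcongr <;> exact norm_inner_le_norm _ _
      _ = _ := by ring

theorem superposition_scaledGaussian {c : ℝ} (hc : 0 < c) {w : V → ℂ}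
    (hw : AEStronglyMeasurable w volume)
    (hwi : Integrable fun x => ((‖x‖ ^ (-(2 * c)) : ℝ) : ℂ) * w x) :
    ∫ t in Set.Ioi (0 : ℝ), ((t ^ (c - 1) : ℝ) : ℂ) * ∫ x, scaledGaussian t x * w x =
      (Gamma c * π ^ (-c) : ℝ) * ∫ x, ((‖x‖ ^ (-(2 * c)) : ℝ) : ℂ) * w x := by
  have h := superposition_integrable_and_integral_eq (ν := (volume : Measure V))
    (k := fun t x => t ^ (c - 1) * exp (-(π * t * ‖x‖ ^ 2)))
    (K := fun x => Gamma c * π ^ (-c) * ‖x‖ ^ (-(2 * c))) (w := w)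
    (by unfold Function.uncurry; fun_prop)
    (fun t (ht : 0 < t) x => by positivity)
    (by filter_upwards [volume.ae_ne (0 : V)] with x hx using
          integrableOn_rpow_mul_exp_neg_pi_mul hc (norm_pos_iff.2 hx))
    (by filter_upwards [volume.ae_ne (0 : V)] with x hx using
          integral_rpow_mul_exp_neg_pi_mul hc (norm_pos_iff.2 hx))
    hw (by simpa only [Complex.ofReal_mul, mul_assoc] using
          hwi.const_mul ((Gamma c : ℂ) * ((π ^ (-c) : ℝ) : ℂ)))
  simpa only [scaledGaussian, Complex.ofReal_mul, mul_assoc, integral_const_mul] using h.2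

theorem superposition_dualGaussian {c : ℝ} (hc : 0 < c) {w : V → ℂ}
    (hw : AEStronglyMeasurable w volume)
    (hwi : Integrable fun x => ((‖x‖ ^ (-(2 * c)) : ℝ) : ℂ) * w x) :
    IntegrableOn (fun t : ℝ => ((t ^ ((Module.finrank ℝ V : ℝ) / 2 - c - 1) : ℝ) : ℂ) *
        ∫ x, dualGaussian t x * w x) (Set.Ioi 0) ∧
    ∫ t in Set.Ioi (0 : ℝ), ((t ^ ((Module.finrank ℝ V : ℝ) / 2 - c - 1) : ℝ) : ℂ) *
        ∫ x, dualGaussian t x * w x =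
      (Gamma c * π ^ (-c) : ℝ) * ∫ x, ((‖x‖ ^ (-(2 * c)) : ℝ) : ℂ) * w x := by
  have h := superposition_integrable_and_integral_eq (ν := (volume : Measure V))
    (k := fun t x => t ^ (-c - 1) * exp (-(π * ‖x‖ ^ 2 / t)))
    (K := fun x => Gamma c * π ^ (-c) * ‖x‖ ^ (-(2 * c))) (w := w)
    (by unfold Function.uncurry; fun_prop)
    (fun t (ht : 0 < t) x => by positivity)
    (by filter_upwards [volume.ae_ne (0 : V)] with x hx using
          integrableOn_rpow_mul_exp_neg_pi_div hc (norm_pos_iff.2 hx))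
    (by filter_upwards [volume.ae_ne (0 : V)] with x hx using
          integral_rpow_mul_exp_neg_pi_div hc (norm_pos_iff.2 hx))
    hw (by simpa only [Complex.ofReal_mul, mul_assoc] using
          hwi.const_mul ((Gamma c : ℂ) * ((π ^ (-c) : ℝ) : ℂ)))
  have e : Set.EqOn (fun t : ℝ => ∫ x, ((t ^ (-c - 1) * exp (-(π * ‖x‖ ^ 2 / t)) : ℝ) : ℂ) * w x)
      (fun t : ℝ => ((t ^ ((Module.finrank ℝ V : ℝ) / 2 - c - 1) : ℝ) : ℂ) *
        ∫ x, dualGaussian t x * w x) (Set.Ioi 0) := fun t (ht : 0 < t) => by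
    simp only
    rw [← integral_const_mul]
    congr 1 with x
    rw [dualGaussian, ← mul_assoc, ← Complex.ofReal_mul, ← mul_assoc, ← rpow_add ht]
    ring_nf
  refine ⟨h.1.congr_fun e measurableSet_Ioi, ?_⟩
  rw [← setIntegral_congr_fun measurableSet_Ioi e, h.2, ← integral_const_mul]
  congr 1 with x
  push_cast
  ring

/-- The Fourier transform of `|x|^{2s-n}`, tested against a Schwartz function. -/
theorem riesz_pairing {s : ℝ} (hs0 : 0 < s) (hs : s < (Module.finrank ℝ V : ℝ) / 2)
    (v : SchwartzMap V ℂ) :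
    ((Gamma ((Module.finrank ℝ V : ℝ) / 2 - s) *
        π ^ (-((Module.finrank ℝ V : ℝ) / 2 - s)) : ℝ) : ℂ) *
        ∫ x : V, ((‖x‖ ^ (-(2 * ((Module.finrank ℝ V : ℝ) / 2 - s))) : ℝ) : ℂ) *
          𝓕 (v : V → ℂ) x =
      (Gamma s * π ^ (-s) : ℝ) * ∫ ξ : V, ((‖ξ‖ ^ (-(2 * s)) : ℝ) : ℂ) * v ξ := by
  set h : ℝ := (Module.finrank ℝ V : ℝ) / 2 with hh
  rw [← SchwartzMap.fourier_coe, ← superposition_scaledGaussian (by linarith)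
      (𝓕 v).continuous.aestronglyMeasurable
      (integrable_norm_rpow_neg_mul_schwartz (by linarith) (by linarith) (𝓕 v)),
    ← (superposition_dualGaussian hs0 v.continuous.aestronglyMeasurable
      (integrable_norm_rpow_neg_mul_schwartz (by linarith) (by linarith) v)).2]
  refine setIntegral_congr_fun measurableSet_Ioi fun t ht => ?_
  rw [SchwartzMap.fourier_coe, integral_fourier_mul_eq_flip (integrable_scaledGaussian ht)
    v.integrable, fourier_scaledGaussian ht]

/-- The Fourier transform of `|x|^{2s-n-2} ⟨a, x⟩⟨b, x⟩`, tested against a Schwartz function. -/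
theorem riesz_quadratic_pairing {s : ℝ} (hs0 : 0 < s) (hs : s < (Module.finrank ℝ V : ℝ) / 2)
    (v : SchwartzMap V ℂ) (a b : V) :
    ((Gamma ((Module.finrank ℝ V : ℝ) / 2 - s + 1) *
        π ^ (-((Module.finrank ℝ V : ℝ) / 2 - s + 1)) : ℝ) : ℂ) *
        ∫ x : V, ((‖x‖ ^ (-(2 * ((Module.finrank ℝ V : ℝ) / 2 - s + 1))) : ℝ) : ℂ) *
          ((inner ℝ a x : ℂ) * (inner ℝ b x : ℂ) * 𝓕 (v : V → ℂ) x) =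
      (inner ℝ a b / (2 * π) : ℂ) *
          ((Gamma s * π ^ (-s) : ℝ) * ∫ ξ : V, ((‖ξ‖ ^ (-(2 * s)) : ℝ) : ℂ) * v ξ) -
        (Gamma (s + 1) * π ^ (-(s + 1)) : ℝ) * ∫ ξ : V, ((‖ξ‖ ^ (-(2 * (s + 1))) : ℝ) : ℂ) *
          ((inner ℝ a ξ : ℂ) * (inner ℝ b ξ : ℂ) * v ξ) := by
  have hcont : ∀ w : SchwartzMap V ℂ, AEStronglyMeasurable
      (fun x : V => (inner ℝ a x : ℂ) * (inner ℝ b x : ℂ) * w x) volume := fun w => by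
    have := w.continuous
    exact Continuous.aestronglyMeasurable (by fun_prop)
  obtain ⟨hi1, he1⟩ := superposition_dualGaussian hs0 v.continuous.aestronglyMeasurable
      (integrable_norm_rpow_neg_mul_schwartz (by linarith) (by linarith) v)
  obtain ⟨hi2, he2⟩ := superposition_dualGaussian (c := s + 1) (by linarith) (hcont v)
      (integrable_norm_rpow_neg_mul_inner_mul_inner_mul_schwartz hs0.le hs v a b)
  rw [← SchwartzMap.fourier_coe, ← superposition_scaledGaussian (by linarith) (hcont (𝓕 v))
      (integrable_norm_rpow_neg_mul_inner_mul_inner_mul_schwartz (by linarith) (by linarith)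
        (𝓕 v) a b), ← he1, ← he2, ← integral_const_mul, ← integral_sub (hi1.const_mul _) hi2]
  refine setIntegral_congr_fun measurableSet_Ioi fun t (ht : 0 < t) => ?_
  set h : ℝ := (Module.finrank ℝ V : ℝ) / 2 with hh
  have hG : Integrable fun x : V => dualGaussian t x * v x :=
    integrable_dualGaussian_mul ht v.integrable
  have hGq : Integrable fun x : V =>
      dualGaussian t x * ((inner ℝ a x : ℂ) * (inner ℝ b x : ℂ) * v x) :=
    integrable_dualGaussian_mul ht (integrable_inner_mul_inner_mul_schwartz v a b)
  have hF : ∫ x : V, scaledGaussian t x * ((inner ℝ a x : ℂ) * (inner ℝ b x : ℂ) * 𝓕 v x) =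
      ∫ x : V, (inner ℝ a b / (2 * π * t) - inner ℝ a x * inner ℝ b x / t ^ 2) *
        dualGaussian t x * v x := by
    simp_rw [← fourier_inner_mul_inner_mul_scaledGaussian ht a b]
    rw [← integral_fourier_mul_eq_flip (integrable_inner_mul_inner_mul_scaledGaussian ht a b)
      v.integrable, SchwartzMap.fourier_coe]
    congr 1 with x
    ring
  have hsplit : ∫ x : V, (inner ℝ a b / (2 * π * t) - inner ℝ a x * inner ℝ b x / t ^ 2) *
        dualGaussian t x * v x = (inner ℝ a b / (2 * π * t) : ℂ) * (∫ x : V, dualGaussian t x * v x)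
        - (1 / t ^ 2 : ℂ) * ∫ x : V, dualGaussian t x *
            ((inner ℝ a x : ℂ) * (inner ℝ b x : ℂ) * v x) := by
    rw [← integral_const_mul, ← integral_const_mul,
      ← integral_sub (hG.const_mul _) (hGq.const_mul _)]
    congr 1 with x
    ring
  rw [hF, hsplit]
  have e1 : t ^ (h - s + 1 - 1) = t ^ (h - s - 1) * t := by
    rw [← rpow_add_one ht.ne']
    ring_nf
  have e2 : t ^ (h - s + 1 - 1) = t ^ (h - (s + 1) - 1) * t ^ 2 := by
    rw [← rpow_natCast, ← rpow_add ht]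
    push_cast
    ring_nf
  have htc : (t : ℂ) ≠ 0 := by exact_mod_cast ht.ne'
  have hπ : (π : ℂ) ≠ 0 := by exact_mod_cast pi_ne_zero
  rw [mul_sub]
  congr 1
  · rw [e1]
    push_cast
    field_simp
  · rw [e2]
    push_cast
    field_simp

end RieszPairing

theorem lameInverseSymbolEntry_mul_eq (d : ℕ) {s : ℝ} (μ lam : ℝ) (ξ : EuclideanSpace ℝ (Fin d))
    (i j : Fin d) (z : ℂ) :
    (lameInverseSymbolEntry d s μ lam ξ i j : ℂ) * z =
      ((μ ^ (-s) * (2 * π) ^ (-(2 * s)) * (if i = j then 1 else 0) : ℝ) : ℂ) *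
          (((‖ξ‖ ^ (-(2 * s)) : ℝ) : ℂ) * z) +
        ((((2 * μ + lam) ^ (-s) - μ ^ (-s)) * (2 * π) ^ (-(2 * s)) : ℝ) : ℂ) *
          (((‖ξ‖ ^ (-(2 * (s + 1))) : ℝ) : ℂ) * ((ξ i : ℂ) * (ξ j : ℂ) * z)) := by
  have hq : ‖ξ‖ ^ (-(2 * s)) * (ξ i * ξ j / ‖ξ‖ ^ 2) = ‖ξ‖ ^ (-(2 * (s + 1))) * (ξ i * ξ j) := by
    rcases eq_or_ne ξ 0 with rfl | hξ
    · simp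
    · have h : 0 < ‖ξ‖ := norm_pos_iff.2 hξ
      have e : ‖ξ‖ ^ (-(2 * s)) = ‖ξ‖ ^ (-(2 * (s + 1))) * ‖ξ‖ ^ 2 := by
        rw [← rpow_natCast, ← rpow_add h]
        push_cast
        ring_nf
      rw [e]
      field_simp
  have e : lameInverseSymbolEntry d s μ lam ξ i j =
      μ ^ (-s) * (2 * π) ^ (-(2 * s)) * (if i = j then 1 else 0) * ‖ξ‖ ^ (-(2 * s)) +
        ((2 * μ + lam) ^ (-s) - μ ^ (-s)) * (2 * π) ^ (-(2 * s)) *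
          (‖ξ‖ ^ (-(2 * (s + 1))) * (ξ i * ξ j)) := by
    rw [← hq, lameInverseSymbolEntry, mul_rpow (by positivity) (norm_nonneg _)]
    ring
  rw [e]
  simp only [Complex.ofReal_add, Complex.ofReal_mul]
  ring

theorem lameRieszKernelEntry_mul_eq (d : ℕ) {s : ℝ} (μ lam : ℝ) (x : EuclideanSpace ℝ (Fin d))
    (i j : Fin d) (z : ℂ) :
    (lameRieszKernelEntry d s μ lam x i j : ℂ) * z =
      ((gammaConst d s / (μ ^ s * (2 * μ + lam) ^ s) *
          (((2 * s - 1) * (2 * μ + lam) ^ s + μ ^ s) / ((d : ℝ) - 2 * s)) *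
            (if i = j then 1 else 0) : ℝ) : ℂ) *
          (((‖x‖ ^ (-(2 * ((d : ℝ) / 2 - s))) : ℝ) : ℂ) * z) +
        ((gammaConst d s / (μ ^ s * (2 * μ + lam) ^ s) *
          ((2 * μ + lam) ^ s - μ ^ s) : ℝ) : ℂ) *
          (((‖x‖ ^ (-(2 * ((d : ℝ) / 2 - s + 1))) : ℝ) : ℂ) * ((x i : ℂ) * (x j : ℂ) * z)) := by
  have hq : ‖x‖ ^ (2 * s - (d : ℝ)) * (x i * x j / ‖x‖ ^ 2) =
      ‖x‖ ^ (-(2 * ((d : ℝ) / 2 - s + 1))) * (x i * x j) := by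
    rcases eq_or_ne x 0 with rfl | hx
    · simp
    · have h : 0 < ‖x‖ := norm_pos_iff.2 hx
      have e : ‖x‖ ^ (2 * s - (d : ℝ)) = ‖x‖ ^ (-(2 * ((d : ℝ) / 2 - s + 1))) * ‖x‖ ^ 2 := by
        rw [← rpow_natCast, ← rpow_add h]
        push_cast
        ring_nf
      rw [e]
      field_simp
  have e : lameRieszKernelEntry d s μ lam x i j =
      gammaConst d s / (μ ^ s * (2 * μ + lam) ^ s) *
          (((2 * s - 1) * (2 * μ + lam) ^ s + μ ^ s) / ((d : ℝ) - 2 * s)) *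
            (if i = j then 1 else 0) * ‖x‖ ^ (-(2 * ((d : ℝ) / 2 - s))) +
        gammaConst d s / (μ ^ s * (2 * μ + lam) ^ s) * ((2 * μ + lam) ^ s - μ ^ s) *
          (‖x‖ ^ (-(2 * ((d : ℝ) / 2 - s + 1))) * (x i * x j)) := by
    rw [← hq, lameRieszKernelEntry, show -(2 * ((d : ℝ) / 2 - s)) = 2 * s - (d : ℝ) by ring]
    ring
  rw [e]
  simp only [Complex.ofReal_add, Complex.ofReal_mul]
  ring

/-- The algebraic relation between the constants: `J₀, J₂` are the moments of the test function
against the symbol, `I₀, I₂` those of its Fourier transform against the kernel. -/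
theorem lame_constants_identity {P Ph T G H s h m L π' δ : ℝ} {I₀ I₂ J₀ J₂ : ℂ}
    (hP : P ≠ 0) (hPh : Ph ≠ 0) (hT : T ≠ 0) (hG : G ≠ 0) (hH : H ≠ 0) (hs : s ≠ 0)
    (hh : h - s ≠ 0) (hm : m ≠ 0) (hL : L ≠ 0) (hπ : π' ≠ 0)
    (h₀ : ((G * (P / Ph) : ℝ) : ℂ) * I₀ = ((H * P⁻¹ : ℝ) : ℂ) * J₀)
    (h₂ : (((h - s) * G * (P / Ph / π') : ℝ) : ℂ) * I₂ =
      (δ / (2 * π') : ℂ) * (((H * P⁻¹ : ℝ) : ℂ) * J₀) - ((s * H * (P⁻¹ / π') : ℝ) : ℂ) * J₂) :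
    ((m⁻¹ * (T * P ^ 2)⁻¹ * δ : ℝ) : ℂ) * J₀ + (((L⁻¹ - m⁻¹) * (T * P ^ 2)⁻¹ : ℝ) : ℂ) * J₂ =
      (((h - s) * G / (T * Ph * (s * H)) / (m * L) *
        (((2 * s - 1) * L + m) / (2 * h - 2 * s)) * δ : ℝ) : ℂ) * I₀ +
      (((h - s) * G / (T * Ph * (s * H)) / (m * L) * (L - m) : ℝ) : ℂ) * I₂ := by
  have hP' : (P : ℂ) ≠ 0 := by exact_mod_cast hP
  have hPh' : (Ph : ℂ) ≠ 0 := by exact_mod_cast hPh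
  have hT' : (T : ℂ) ≠ 0 := by exact_mod_cast hT
  have hG' : (G : ℂ) ≠ 0 := by exact_mod_cast hG
  have hH' : (H : ℂ) ≠ 0 := by exact_mod_cast hH
  have hs' : (s : ℂ) ≠ 0 := by exact_mod_cast hs
  have hh' : (h : ℂ) - s ≠ 0 := by exact_mod_cast hh
  have hm' : (m : ℂ) ≠ 0 := by exact_mod_cast hm
  have hL' : (L : ℂ) ≠ 0 := by exact_mod_cast hL
  have hπ' : (π' : ℂ) ≠ 0 := by exact_mod_cast hπ
  push_cast at h₀ h₂ ⊢
  have hI₀ : I₀ = H * J₀ * Ph / (G * P ^ 2) := by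
    field_simp at h₀ ⊢
    linear_combination h₀
  have hI₂ : I₂ = (δ / 2 * H * J₀ - s * H * J₂) * Ph / ((h - s) * G * P ^ 2) := by
    field_simp at h₂ ⊢
    linear_combination h₂
  rw [hI₀, hI₂, show (2 * h - 2 * s : ℂ) = 2 * (h - s) by ring]
  field_simp
  ring

/-- The tempered distribution `Ψ^s` has Fourier transform `[M^s(ξ)]^{−1}`: tested against
any Schwartz function `v`, both pairings converge absolutely and agree. -/
theorem lameRieszKernel_fourierTransform (d : ℕ) (hd : 2 ≤ d) (μ lam : ℝ)
    (hμ : 0 < μ) (hlam : 0 < 2 * μ + lam) (s : ℝ) (hs : s ∈ Set.Ioo 0 ((d : ℝ) / 2))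
    (v : SchwartzMap (EuclideanSpace ℝ (Fin d)) ℂ) (i j : Fin d) :
    Integrable (fun ξ : EuclideanSpace ℝ (Fin d) =>
      (lameInverseSymbolEntry d s μ lam ξ i j : ℂ) * v ξ) ∧
    Integrable (fun x : EuclideanSpace ℝ (Fin d) =>
      (lameRieszKernelEntry d s μ lam x i j : ℂ) * 𝓕 (v : EuclideanSpace ℝ (Fin d) → ℂ) x) ∧
    (∫ ξ : EuclideanSpace ℝ (Fin d), (lameInverseSymbolEntry d s μ lam ξ i j : ℂ) * v ξ) =
      ∫ x : EuclideanSpace ℝ (Fin d),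
        (lameRieszKernelEntry d s μ lam x i j : ℂ) *
          𝓕 (v : EuclideanSpace ℝ (Fin d) → ℂ) x := by
  obtain ⟨hs0, hsd⟩ := hs
  have hfin : (Module.finrank ℝ (EuclideanSpace ℝ (Fin d)) : ℝ) = d := by simp
  have : Nontrivial (EuclideanSpace ℝ (Fin d)) :=
    Module.nontrivial_of_finrank_pos (R := ℝ) (by rw [finrank_euclideanSpace_fin]; omega)
  set a : EuclideanSpace ℝ (Fin d) := EuclideanSpace.single i 1 with ha
  set b : EuclideanSpace ℝ (Fin d) := EuclideanSpace.single j 1 with hb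
  have hax : ∀ x : EuclideanSpace ℝ (Fin d), inner ℝ a x = x i := fun x => by
    simp [ha, EuclideanSpace.inner_single_left]
  have hbx : ∀ x : EuclideanSpace ℝ (Fin d), inner ℝ b x = x j := fun x => by
    simp [hb, EuclideanSpace.inner_single_left]
  have hab : inner ℝ a b = if i = j then (1 : ℝ) else 0 := by
    simp [hax, hb, PiLp.single_apply]
  have hJ₀ := integrable_norm_rpow_neg_mul_schwartz (p := 2 * s) (by linarith)
    (by rw [hfin]; linarith) v
  have hJ₂ := integrable_norm_rpow_neg_mul_inner_mul_inner_mul_schwartz (c := s) hs0.le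
    (by rwa [hfin]) v a b
  have hI₀ := integrable_norm_rpow_neg_mul_schwartz (p := 2 * ((d : ℝ) / 2 - s)) (by linarith)
    (by rw [hfin]; linarith) (𝓕 v)
  have hI₂ := integrable_norm_rpow_neg_mul_inner_mul_inner_mul_schwartz (c := (d : ℝ) / 2 - s)
    (by linarith) (by rw [hfin]; linarith) (𝓕 v) a b
  have h₀ := riesz_pairing hs0 (by rwa [hfin]) v
  have h₂ := riesz_quadratic_pairing hs0 (by rwa [hfin]) v a b
  rw [hab] at h₂
  simp only [hax, hbx, hfin, SchwartzMap.fourier_coe] at hJ₂ hI₀ hI₂ h₀ h₂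
  simp only [lameInverseSymbolEntry_mul_eq, lameRieszKernelEntry_mul_eq]
  refine ⟨(hJ₀.const_mul _).add (hJ₂.const_mul _), (hI₀.const_mul _).add (hI₂.const_mul _), ?_⟩
  rw [integral_add (hJ₀.const_mul _) (hJ₂.const_mul _),
    integral_add (hI₀.const_mul _) (hI₂.const_mul _)]
  simp only [integral_const_mul]
  have hds : 0 < (d : ℝ) / 2 - s := by linarith
  have hG := Gamma_pos_of_pos hds
  have hH := Gamma_pos_of_pos hs0
  rw [show -((d : ℝ) / 2 - s) = s - (d : ℝ) / 2 by ring, rpow_sub pi_pos,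
    rpow_neg pi_pos.le] at h₀
  rw [show -((d : ℝ) / 2 - s + 1) = s - (d : ℝ) / 2 - 1 by ring, rpow_sub_one pi_ne_zero,
    rpow_sub pi_pos, show -(s + 1) = -s - 1 by ring, rpow_sub_one pi_ne_zero,
    rpow_neg pi_pos.le, Gamma_add_one hds.ne', Gamma_add_one hs0.ne'] at h₂
  have key := lame_constants_identity (P := π ^ s) (Ph := π ^ ((d : ℝ) / 2))
    (T := (2 : ℝ) ^ (2 * s)) (G := Gamma ((d : ℝ) / 2 - s)) (H := Gamma s) (s := s)
    (h := (d : ℝ) / 2) (m := μ ^ s) (L := (2 * μ + lam) ^ s) (π' := π)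
    (by positivity) (by positivity) (by positivity) hG.ne' hH.ne' hs0.ne' hds.ne'
    (by positivity) (by positivity) pi_ne_zero
    h₀ h₂
  have hγ : gammaConst d s = ((d : ℝ) / 2 - s) * Gamma ((d : ℝ) / 2 - s) /
      ((2 : ℝ) ^ (2 * s) * π ^ ((d : ℝ) / 2) * (s * Gamma s)) := by
    rw [gammaConst, ← Gamma_add_one hds.ne', add_comm 1 s, Gamma_add_one hs0.ne']
    ring_nf
  have hc : (2 * π) ^ (-(2 * s)) = ((2 : ℝ) ^ (2 * s) * (π ^ s) ^ 2)⁻¹ := by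
    rw [rpow_neg (by positivity), mul_rpow two_pos.le pi_pos.le, ← rpow_natCast (π ^ s),
      ← rpow_mul pi_pos.le]
    push_cast
    ring_nf
  rw [hγ, hc, rpow_neg hμ.le, rpow_neg hlam.le]
  rw [mul_div_cancel₀ (d : ℝ) two_ne_zero] at key
  exact key
end
end
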